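/- Let D be a domain in ℂⁿ and let a₁,…,a_m : D → ℂ be continuous functions. If the set 𝓔 = {(z,w) ∈ D × ℂ : wᵐ + a₁(z)w^{m−1} + ⋯ + a_m(z) = 0} is a pluripolar subset of ℂ^{n+1}, then the functions a₁,…,a_m are holomorphic on D. -/

import Mathlib

open Metric Set Polynomial

noncomputable section

/-- A function `u : ℂ → EReal` is subharmonic on an open set `U` if it is upper
semicontinuous on `U` and satisfies the maximum principle with respect to harmonic
majorants of the form `Re p`, `p` a complex polynomial, on every closed disc in `U`. -/
def SubharmonicOn (u : ℂ → EReal) (U : Set ℂ) : Prop :=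
  UpperSemicontinuousOn u U ∧
    ∀ (c : ℂ) (r : ℝ), 0 < r → closedBall c r ⊆ U →
      ∀ p : Polynomial ℂ,
        (∀ z ∈ sphere c r, u z ≤ (((p.eval z).re : ℝ) : EReal)) →
        ∀ z ∈ closedBall c r, u z ≤ (((p.eval z).re : ℝ) : EReal)

/-- `u : ℂ^N → [-∞, ∞)` is plurisubharmonic if it is upper semicontinuous, takes values
in `[-∞, ∞)`, and its restriction to every complex affine line is subharmonic. -/
def Plurisubharmonic {N : ℕ} (u : (Fin N → ℂ) → EReal) : Prop :=
  UpperSemicontinuous u ∧ (∀ z, u z ≠ ⊤) ∧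
    ∀ a b : Fin N → ℂ, SubharmonicOn (fun t : ℂ => u (a + t • b)) Set.univ

/-- A set `E ⊆ ℂ^N` is pluripolar if there is a plurisubharmonic function on `ℂ^N`,
not identically `-∞`, which is `-∞` on `E`. -/
def Pluripolar {N : ℕ} (E : Set (Fin N → ℂ)) : Prop :=
  ∃ u : (Fin N → ℂ) → EReal,
    Plurisubharmonic u ∧ ¬ (∀ z, u z = ⊥) ∧ ∀ z ∈ E, u z = ⊥

section part1
open ComplexConjugate in
/-- Density of trigonometric polynomials on a circle. -/
lemma trig_approx {f : ℂ → ℂ} {c : ℂ} {r : ℝ} (hr : 0 < r) (hf : ContinuousOn f (sphere c r))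
    {ε : ℝ} (hε : 0 < ε) : ∃ A C1 : ℂ[X], ∀ ζ ∈ sphere (0:ℂ) 1,
      ‖f (c + r * ζ) - (A.eval ζ + conj (ζ * C1.eval ζ))‖ < ε := by
  have hT : Fact ((0:ℝ) < 2 * Real.pi) := ⟨Real.two_pi_pos⟩
  have hmem : ∀ x : AddCircle (2 * Real.pi), c + r * (AddCircle.toCircle x : ℂ) ∈ sphere c r := by
    intro x
    have := Circle.norm_coe (AddCircle.toCircle x)
    simp [abs_of_pos hr, this]
  let g : C(AddCircle (2 * Real.pi), ℂ) := ⟨fun x => f (c + r * (AddCircle.toCircle x : ℂ)), by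
    rw [continuousOn_iff_continuous_domRestrict] at hf
    have : Continuous (fun x : AddCircle (2 * Real.pi) => (⟨_, hmem x⟩ : sphere c r)) := by
      apply Continuous.subtype_mk
      have := AddCircle.continuous_toCircle (T := 2 * Real.pi)
      fun_prop
    exact hf.comp this⟩
  have hg : g ∈ closure ((Submodule.span ℂ (range (@fourier (2 * Real.pi))) : Submodule ℂ _) : Set C(AddCircle (2 * Real.pi), ℂ)) := by
    have := span_fourier_closure_eq_top (T := 2 * Real.pi)
    have h2 : g ∈ (Submodule.span ℂ (range (@fourier (2 * Real.pi)))).topologicalClosure := by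
      rw [this]; trivial
    exact h2
  obtain ⟨q, hq, hqd⟩ := Metric.mem_closure_iff.1 hg ε hε
  have key : ∃ A C1 : ℂ[X], ∀ x : AddCircle (2 * Real.pi), q x = A.eval (AddCircle.toCircle x : ℂ) + conj ((AddCircle.toCircle x : ℂ) * C1.eval (AddCircle.toCircle x : ℂ)) := by
    refine Submodule.span_induction ?_ ?_ ?_ ?_ hq
    · rintro _ ⟨n, rfl⟩
      have hz : ∀ x : AddCircle (2 * Real.pi), fourier n x = (AddCircle.toCircle x : ℂ) ^ n := by
        intro x
        rw [fourier_apply, AddCircle.toCircle_zsmul]; simp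
      rcases n with n | n
      · refine ⟨X ^ n, 0, fun x => ?_⟩
        rw [hz]; simp
      · refine ⟨0, X ^ n, fun x => ?_⟩
        rw [hz]
        rw [zpow_negSucc, ← inv_pow, ← Circle.coe_inv, Circle.coe_inv_eq_conj]
        simp [pow_succ']
    · exact ⟨0, 0, by simp⟩
    · rintro a b - - ⟨A, B, h⟩ ⟨A', B', h'⟩
      refine ⟨A + A', B + B', fun x => ?_⟩
      simp [h, h']; ring
    · rintro k b - ⟨A, B, h⟩
      refine ⟨C k * A, C (conj k) * B, fun x => ?_⟩
      simp [h]; ring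
  obtain ⟨A, C1, h⟩ := key
  refine ⟨A, C1, fun ζ hζ => ?_⟩
  obtain ⟨x, hx⟩ := (AddCircle.homeomorphCircle hT.out.ne').surjective (⟨ζ, by simpa [Submonoid.unitSphere] using hζ⟩ : Circle)
  have hx' : (AddCircle.toCircle x : ℂ) = ζ := by
    have : ((AddCircle.homeomorphCircle hT.out.ne' x : Circle) : ℂ) = ζ := by rw [hx]
    rwa [AddCircle.homeomorphCircle_apply] at this
  have h3 := (ContinuousMap.dist_lt_iff hε).1 hqd x
  rw [dist_eq_norm, h, hx'] at h3
  have h4 : g x = f (c + r * (AddCircle.toCircle x : ℂ)) := rfl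
  rwa [h4, hx'] at h3

end part1

section part2
/-- Real-valued subharmonic functions on the plane. -/
def SubR (φ : ℂ → ℝ) : Prop :=
  UpperSemicontinuous φ ∧ ∀ (c : ℂ) (r : ℝ), 0 < r → ∀ p : ℂ[X],
    (∀ z ∈ sphere c r, φ z ≤ (p.eval z).re) → ∀ z ∈ closedBall c r, φ z ≤ (p.eval z).re

/-- Truncation of an extended real. -/
def trunc (M : ℝ) (x : EReal) : ℝ := (max x (((-M : ℝ)) : EReal)).toReal

lemma trunc_coe {M : ℝ} {x : EReal} (hx : x ≠ ⊤) : ((trunc M x : ℝ) : EReal) = max x ((-M : ℝ) : EReal) := by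
  unfold trunc
  apply EReal.coe_toReal
  · intro h
    rcases max_choice x ((-M : ℝ) : EReal) with h' | h' <;> rw [h'] at h
    · exact hx h
    · exact EReal.coe_ne_top _ h
  · intro h
    have := le_max_right x ((-M : ℝ) : EReal)
    rw [h] at this
    exact EReal.coe_ne_bot _ (le_bot_iff.1 this)

lemma trunc_le {M : ℝ} {x : EReal} (hx : x ≠ ⊤) {y : ℝ} : trunc M x ≤ y ↔ x ≤ y ∧ -M ≤ y := by
  rw [← EReal.coe_le_coe_iff, trunc_coe hx, max_le_iff, EReal.coe_le_coe_iff]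

lemma trunc_lt {M : ℝ} {x : EReal} (hx : x ≠ ⊤) {y : ℝ} : trunc M x < y ↔ x < y ∧ -M < y := by
  rw [← EReal.coe_lt_coe_iff, trunc_coe hx, max_lt_iff, EReal.coe_lt_coe_iff]

lemma neg_le_trunc {M : ℝ} {x : EReal} (hx : x ≠ ⊤) : -M ≤ trunc M x :=
  ((trunc_le hx).1 le_rfl).2

lemma le_trunc {M : ℝ} {x : EReal} (hx : x ≠ ⊤) : x ≤ trunc M x :=
  ((trunc_le hx).1 le_rfl).1

lemma trunc_bot {M : ℝ} : trunc M ⊥ = -M := by simp [trunc]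

lemma usc_trunc {X : Type*} [TopologicalSpace X] {u : X → EReal} (hu : UpperSemicontinuous u)
    (ht : ∀ z, u z ≠ ⊤) (M : ℝ) : UpperSemicontinuous (fun z => trunc M (u z)) := by
  intro x y hxy
  rw [trunc_lt (ht x)] at hxy
  filter_upwards [hu x y hxy.1] with z hz
  rw [trunc_lt (ht z)]
  exact ⟨hz, hxy.2⟩

/-- minimum principle for real parts of polynomials -/
lemma re_poly_ge {c : ℂ} {r : ℝ} (hr : 0 < r) {p : ℂ[X]} {M : ℝ} 
    (h : ∀ z ∈ sphere c r, M ≤ (p.eval z).re) : ∀ z ∈ closedBall c r, M ≤ (p.eval z).re := by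
  intro z hz
  have hd : Differentiable ℂ (fun z => Complex.exp (-(p.eval z))) := 
    (p.differentiable.neg).cexp
  have := Complex.norm_le_of_forall_mem_frontier_norm_le (U := ball c r) isBounded_ball
    (f := fun z => Complex.exp (-(p.eval z))) (C := Real.exp (-M)) hd.diffContOnCl
    (fun w hw => by
      rw [frontier_ball c hr.ne'] at hw
      rw [Complex.norm_exp]
      have := h w hw
      simpa using this) (z := z) (by rwa [closure_ball c hr.ne'])
  rw [Complex.norm_exp] at this
  simpa using this

lemma SubharmonicOn.subR {u : ℂ → EReal} (hu : SubharmonicOn u univ) (ht : ∀ z, u z ≠ ⊤) (M : ℝ) :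
    SubR (fun z => trunc M (u z)) := by
  refine ⟨usc_trunc (upperSemicontinuousOn_univ_iff.1 hu.1) ht M, ?_⟩
  intro c r hr p hp z hz
  simp only [trunc_le (ht _)] at hp ⊢
  exact ⟨hu.2 c r hr (subset_univ _) p (fun z hz => (hp z hz).1) z hz,
    re_poly_ge hr (fun z hz => (hp z hz).2) z hz⟩

lemma poly_mean (p : ℂ[X]) (c : ℂ) (r : ℝ) : Real.circleAverage (fun z => (p.eval z).re) c r = (p.eval c).re := by
  have h := DiffContOnCl.circleAverage (f := fun z => p.eval z) (c := c) (R := r) p.differentiable.diffContOnCl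
  have h2 := ContinuousLinearMap.circleAverage_comp_comm (c := c) (R := r) (f := fun z => p.eval z) Complex.reCLM
    (p.continuous.continuousOn.circleIntegrable')
  rw [h] at h2
  exact h2

lemma SubR.le_avg_cont {φ : ℂ → ℝ} (hφ : SubR φ) {c : ℂ} {r : ℝ} (hr : 0 < r) {f : ℂ → ℝ}
    (hf : ContinuousOn f (sphere c r)) (h : ∀ z ∈ sphere c r, φ z ≤ f z) : 
    φ c ≤ Real.circleAverage f c r := by
  apply le_of_forall_pos_le_add
  intro ε hε
  obtain ⟨A, C1, hA⟩ := trig_approx (f := fun z => (f z : ℂ)) hr (by fun_prop) (half_pos hε)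
  let q : ℂ[X] := (A + X * C1).comp (C ((r:ℂ)⁻¹) * (X - C c))
  have hq : ∀ z ∈ sphere c r, |f z - (q.eval z).re| < ε / 2 := by
    intro z hz
    have hz1 : (r:ℂ)⁻¹ * (z - c) ∈ sphere (0:ℂ) 1 := by
      simp at hz ⊢
      rw [hz, abs_of_pos hr]; field_simp
    have h2 := hA _ hz1
    have h3 : c + r * ((r:ℂ)⁻¹ * (z - c)) = z := by
      have : (r:ℂ) ≠ 0 := by exact_mod_cast hr.ne'
      field_simp; ring
    rw [h3] at h2
    have h4 := (Complex.abs_re_le_norm _).trans_lt h2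
    refine lt_of_eq_of_lt ?_ h4
    simp [q]
    congr 1; ring
  have hq1 : ∀ z ∈ sphere c r, φ z ≤ ((q + C ((ε/2 : ℝ):ℂ)).eval z).re := by
    intro z hz
    have := abs_lt.1 (hq z hz)
    have := h z hz
    simp only [eval_add, eval_C, Complex.add_re, Complex.ofReal_re]
    linarith
  have h5 := hφ.2 c r hr _ hq1 c (mem_closedBall_self hr.le)
  have hr' : |r| = r := abs_of_pos hr
  have h6 : Real.circleAverage (fun z => ((q - C ((ε/2 : ℝ):ℂ)).eval z).re) c r ≤ Real.circleAverage f c r := by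
    apply Real.circleAverage_mono
    · exact (Complex.continuous_re.comp (Polynomial.continuous _)).continuousOn.circleIntegrable'
    · exact ContinuousOn.circleIntegrable' (by rwa [hr'])
    · intro z hz
      rw [hr'] at hz
      have := abs_lt.1 (hq z hz)
      simp only [eval_sub, eval_C, Complex.sub_re, Complex.ofReal_re]
      linarith
  rw [poly_mean] at h6
  simp only [eval_add, eval_sub, eval_C, Complex.add_re, Complex.sub_re, Complex.ofReal_re] at h5 h6
  linarith

/-- A bounded usc function is a decreasing limit of continuous ones. -/
lemma usc_approx {X : Type*} [PseudoMetricSpace X] {ψ : X → ℝ} (hψ : UpperSemicontinuous ψ) {b B : ℝ}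
    (hb : ∀ x, b ≤ ψ x) (hB : ∀ x, ψ x ≤ B) : ∃ f : ℕ → X → ℝ, (∀ k, Continuous (f k)) ∧
      (∀ k x, ψ x ≤ f k x) ∧ (∀ k x, f k x ≤ B) ∧ 
      ∀ x, Filter.Tendsto (fun k => f k x) Filter.atTop (nhds (ψ x)) := by
  let f : ℕ → X → ℝ := fun k x => ⨆ y, (ψ y - k * dist x y)
  have hbd : ∀ (k : ℕ) x, BddAbove (range fun y => ψ y - k * dist x y) := by
    intro k x
    refine ⟨B, ?_⟩
    rintro _ ⟨y, rfl⟩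
    have : (0:ℝ) ≤ k * dist x y := by positivity
    have := hB y
    simp only; linarith
  have hle : ∀ (k:ℕ) x y, ψ y - k * dist x y ≤ f k x := fun k x y => le_ciSup (hbd k x) y
  refine ⟨f, ?_, ?_, ?_, ?_⟩
  · intro k
    have : LipschitzWith (k : NNReal) (f k) := by
      apply LipschitzWith.of_le_add_mul
      intro x y
      have : Nonempty X := ⟨x⟩
      apply ciSup_le
      intro z
      have h1 := hle k y z
      have h2 := dist_triangle_left y z x
      have h3 : (k:ℝ) * dist y z ≤ k * (dist x y + dist x z) := by gcongr
      simp only [NNReal.coe_natCast]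
      linarith
    exact this.continuous
  · intro k x
    have := hle k x x
    simpa using this
  · intro k x
    have : Nonempty X := ⟨x⟩
    apply ciSup_le
    intro y
    have : (0:ℝ) ≤ k * dist x y := by positivity
    have := hB y
    linarith
  · intro x
    have : Nonempty X := ⟨x⟩
    rw [Metric.tendsto_atTop]
    intro ε hε
    obtain ⟨δ, hδ, h⟩ := Metric.eventually_nhds_iff.1 (hψ x (ψ x + ε/2) (by linarith))
    obtain ⟨N, hN⟩ := exists_nat_gt ((B - b) / δ)
    refine ⟨N, fun k hk => ?_⟩
    have h1 : ψ x ≤ f k x := by simpa using hle k x x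
    have h2 : f k x ≤ ψ x + ε / 2 := by
      apply ciSup_le
      intro y
      by_cases hy : dist y x < δ
      · have := h hy
        have : (0:ℝ) ≤ k * dist x y := by positivity
        linarith
      · push Not at hy
        rw [dist_comm] at hy
        have h3 : (N:ℝ) ≤ k := by exact_mod_cast hk
        have h4 : (N:ℝ) * δ ≤ k * dist x y := by gcongr
        rw [div_lt_iff₀ hδ] at hN
        have := hB y
        have := hb x
        linarith
    rw [Real.dist_eq, abs_of_nonneg (by linarith)]
    linarith

lemma SubR.le_avg {φ : ℂ → ℝ} (hφ : SubR φ) {b : ℝ} (hb : ∀ z, b ≤ φ z) (c : ℂ) {r : ℝ} (hr : 0 < r) :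
    φ c ≤ Real.circleAverage φ c r := by
  obtain ⟨B, hB⟩ := (hφ.1.upperSemicontinuousOn (sphere c r)).bddAbove_of_isCompact (isCompact_sphere c r)
  have hB' : ∀ z ∈ sphere c r, φ z ≤ max B b := fun z hz => (hB ⟨z, hz, rfl⟩).trans (le_max_left _ _)
  obtain ⟨f, hf1, hf2, hf3, hf4⟩ := usc_approx (ψ := fun z => min (φ z) (max B b)) (b := b) (B := max B b)
    (hφ.1.inf upperSemicontinuous_const) (fun z => le_min (hb z) (le_max_right _ _)) (fun z => min_le_right _ _)
  have h1 : ∀ k, φ c ≤ Real.circleAverage (f k) c r := by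
    intro k
    refine hφ.le_avg_cont hr (hf1 k).continuousOn (fun z hz => ?_)
    refine le_trans ?_ (hf2 k z)
    exact le_min le_rfl (hB' z hz)
  have h2 : Filter.Tendsto (fun k => Real.circleAverage (f k) c r) Filter.atTop (nhds (Real.circleAverage φ c r)) := by
    unfold Real.circleAverage
    apply Filter.Tendsto.const_smul
    apply intervalIntegral.tendsto_integral_filter_of_dominated_convergence (fun _ => max |b| |max B b|)
    · filter_upwards with k
      exact ((hf1 k).comp (continuous_circleMap c r)).aestronglyMeasurable
    · filter_upwards with k
      filter_upwards with θ _
      rw [Real.norm_eq_abs]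
      apply abs_le_max_abs_abs
      · refine le_trans ?_ (hf2 k _)
        exact le_min (hb _) (le_max_right _ _)
      · exact hf3 k _
    · exact intervalIntegrable_const
    · filter_upwards with θ _
      have := hf4 (circleMap c r θ)
      rwa [min_eq_left (hB' _ (circleMap_mem_sphere c hr.le θ))] at this
  exact ge_of_tendsto' h2 h1

end part2

section part3
lemma poly_approx_local {g : ℂ → ℂ} {w0 : ℂ} (hg : AnalyticAt ℂ g w0) : ∃ s1 > 0, ∀ ε > 0, ∃ q : ℂ[X],
    ∀ w ∈ closedBall w0 s1, ‖g w - q.eval w‖ < ε := by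
  obtain ⟨p, r, hp⟩ := hg
  obtain ⟨s, hs0, hsr⟩ := ENNReal.lt_iff_exists_nnreal_btwn.1 hp.r_pos
  have hs : 0 < s := by exact_mod_cast hs0
  have hu := hp.tendstoUniformlyOn' hsr
  refine ⟨s / 2, by positivity, fun ε hε => ?_⟩
  obtain ⟨n, hn⟩ := (Metric.tendstoUniformlyOn_iff.1 hu ε hε).exists
  refine ⟨∑ k ∈ Finset.range n, C (p.coeff k) * (X - C w0) ^ k, fun w hw => ?_⟩
  have h1 := hn w (by
    rw [mem_closedBall] at hw; rw [mem_ball]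
    have : (0:ℝ) < s := by exact_mod_cast hs
    linarith)
  rw [dist_eq_norm] at h1
  have h2 : (∑ k ∈ Finset.range n, C (p.coeff k) * (X - C w0) ^ k).eval w = p.partialSum n (w - w0) := ?_
  · rwa [h2]
  simp only [FormalMultilinearSeries.partialSum, eval_finsetSum, eval_mul, eval_C, eval_pow, eval_sub, eval_X]
  apply Finset.sum_congr rfl
  intro k _
  rw [FormalMultilinearSeries.apply_eq_pow_smul_coeff, smul_eq_mul, mul_comm]

lemma SubR.max_principle {φ : ℂ → ℝ} (hφ : SubR φ) {K : Set ℂ} (hK : IsCompact K) {h : ℂ → ℝ}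
    (hh : ContinuousOn h K) {M : ℝ} (H : ∀ w ∈ K, φ w + h w ≤ M ∨ (K ∈ nhds w ∧ ∃ g : ℂ → ℂ, 
      AnalyticAt ℂ g w ∧ ∀ᶠ x in nhds w, h x = (g x).re)) : ∀ w ∈ K, φ w + h w ≤ M := by
  intro w1 hw1
  by_contra hcon
  push Not at hcon
  obtain ⟨ρ, hρ0, hρ⟩ := hK.isBounded.exists_pos_norm_le
  set d := φ w1 + h w1 - M with hd
  have hd0 : 0 < d := by rw [hd]; linarith
  obtain ⟨ε, hε0, hε⟩ : ∃ ε > 0, ε * ρ ^ 2 < d := ⟨d / (2 * ρ ^ 2), by positivity, by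
    field_simp; linarith⟩
  have husc : UpperSemicontinuousOn (fun w => φ w + (h w + ε * ‖w‖ ^ 2)) K := by
    apply UpperSemicontinuousOn.add (hφ.1.upperSemicontinuousOn K)
    apply ContinuousOn.upperSemicontinuousOn
    fun_prop
  obtain ⟨w0, hw0, hmax⟩ := husc.exists_isMaxOn ⟨w1, hw1⟩ hK
  have h1 : φ w1 + (h w1 + ε * ‖w1‖ ^ 2) ≤ φ w0 + (h w0 + ε * ‖w0‖ ^ 2) := hmax hw1
  rcases H w0 hw0 with h2 | ⟨hKn, g, hg, hge⟩
  · have h3 : ε * ‖w0‖ ^ 2 ≤ ε * ρ ^ 2 := by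
      have := hρ w0 hw0
      gcongr
    have h4 : 0 ≤ ε * ‖w1‖ ^ 2 := by positivity
    linarith
  · obtain ⟨s1, hs1, hpa⟩ := poly_approx_local hg
    obtain ⟨s2, hs2, hball⟩ := Metric.mem_nhds_iff.1 (Filter.inter_mem hKn hge)
    set s := min s1 (s2 / 2) with hs
    have hs0 : 0 < s := lt_min hs1 (by linarith)
    obtain ⟨q, hq⟩ := hpa (ε * s ^ 2 / 4) (by positivity)
    have hsub : ∀ w ∈ closedBall w0 s, w ∈ K ∧ h w = (g w).re ∧ ‖g w - q.eval w‖ < ε * s ^ 2 / 4 := by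
      intro w hw
      have hw' : dist w w0 ≤ s := hw
      have ha : w ∈ ball w0 s2 := by
        rw [mem_ball]
        have := min_le_right s1 (s2 / 2)
        linarith
      refine ⟨(hball ha).1, (hball ha).2, hq w ?_⟩
      rw [mem_closedBall]
      exact hw'.trans (min_le_left _ _)
    let T : ℝ := φ w0 + (h w0 + ε * ‖w0‖ ^ 2)
    let p : ℂ[X] := C ((T - ε * (‖w0‖ ^ 2 + s ^ 2) + ε * s ^ 2 / 4 : ℝ) : ℂ) - q - 
      C (2 * ε * (starRingEnd ℂ) w0) * (X - C w0)
    have hpe : ∀ w, (p.eval w).re = (T - ε * (‖w0‖ ^ 2 + s ^ 2) + ε * s ^ 2 / 4) - (q.eval w).re 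
        - 2 * ε * (w0.re * (w.re - w0.re) + w0.im * (w.im - w0.im)) := by
      intro w
      simp only [p, eval_sub, eval_C, eval_mul, eval_X, Complex.sub_re, Complex.ofReal_re]
      simp
      ring
    have hs' : ∀ w ∈ sphere w0 s, φ w ≤ (p.eval w).re := by
      intro w hw
      obtain ⟨a1, a2, a3⟩ := hsub w (sphere_subset_closedBall hw)
      have a4 : φ w + (h w + ε * ‖w‖ ^ 2) ≤ T := hmax a1
      have a5 := abs_lt.1 ((Complex.abs_re_le_norm _).trans_lt a3)
      simp only [Complex.sub_re] at a5
      have a6 : ‖w‖ ^ 2 = ‖w0‖ ^ 2 + s ^ 2 + 2 * (w0.re * (w.re - w0.re) + w0.im * (w.im - w0.im)) := by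
        have : ‖w - w0‖ = s := by simpa [dist_eq_norm] using hw
        rw [← this, Complex.sq_norm, Complex.sq_norm, Complex.sq_norm, Complex.normSq_apply, Complex.normSq_apply,
          Complex.normSq_apply]
        simp; ring
      rw [hpe, a2] at *
      rw [a6] at a4
      nlinarith
    have h5 := hφ.2 w0 s hs0 p hs' w0 (mem_closedBall_self hs0.le)
    rw [hpe] at h5
    obtain ⟨a1, a2, a3⟩ := hsub w0 (mem_closedBall_self hs0.le)
    have a5 := abs_lt.1 ((Complex.abs_re_le_norm _).trans_lt a3)
    simp only [Complex.sub_re] at a5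
    simp only [sub_self, mul_zero, add_zero, sub_zero, T, a2] at h5
    have : 0 < ε * s ^ 2 := by positivity
    linarith

end part3

section part4
lemma log_norm_eq_re {f : ℂ → ℂ} {w0 : ℂ} (hf : AnalyticAt ℂ f w0) (h0 : f w0 ≠ 0) :
    ∃ g : ℂ → ℂ, AnalyticAt ℂ g w0 ∧ ∀ᶠ x in nhds w0, Real.log ‖f x‖ = (g x).re := by
  refine ⟨fun x => Complex.log (f x / f w0) + Real.log ‖f w0‖, ?_, ?_⟩
  · apply AnalyticAt.add _ analyticAt_const
    apply AnalyticAt.clog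
    · exact hf.div analyticAt_const h0
    · simp [div_self h0]
  · filter_upwards [hf.continuousAt.eventually_ne h0] with x hx
    rw [Complex.add_re, Complex.log_re, Complex.ofReal_re, norm_div, Real.log_div]
    · ring
    · simpa using hx
    · simpa using h0

lemma prod_lower (n : ℕ) : ∀ y : ℝ, (n.factorial : ℝ) / 4 ^ n ≤ ∏ i ∈ Finset.range n, max 1 |y - i| := by
  induction n with
  | zero => intro y; simp
  | succ n ih =>
    intro y
    have hn : ((n + 1 : ℕ) : ℝ) / 4 ≤ max 1 ((n : ℝ) / 2) := by
      push_cast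
      rcases Nat.eq_zero_or_pos n with h | h
      · subst h; norm_num
      · have : (1:ℝ) ≤ n := by exact_mod_cast h
        exact le_trans (by linarith) (le_max_right _ _)
    have e : ((n + 1).factorial : ℝ) / 4 ^ (n + 1) = (n.factorial : ℝ) / 4 ^ n * (((n + 1 : ℕ) : ℝ) / 4) := by
      rw [Nat.factorial_succ, pow_succ]; push_cast; field_simp
    rw [e]
    rcases le_total ((n:ℝ) / 2) y with h | h
    · rw [Finset.prod_range_succ']
      apply mul_le_mul
      · refine (ih (y - 1)).trans (le_of_eq ?_)
        apply Finset.prod_congr rfl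
        intro i _
        push_cast; congr 2; ring
      · refine hn.trans (max_le_max le_rfl ?_)
        simp only [Nat.cast_zero, sub_zero]
        exact h.trans (le_abs_self _)
      · positivity
      · positivity
    · rw [Finset.prod_range_succ]
      apply mul_le_mul (ih y)
      · refine hn.trans (max_le_max le_rfl ?_)
        rw [abs_sub_comm]
        exact le_trans (by linarith) (le_abs_self _)
      · positivity
      · positivity

lemma uniform_eps {c : ℂ} {s1 s2 : ℝ} (h1 : 0 < s1) {O : Set ℂ} (hO : IsOpen O)
    (hbad : ∀ s ∈ Icc s1 s2, ∃ w ∈ sphere c s, w ∈ O) :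
    ∃ ε > 0, ∀ s ∈ Icc s1 s2, ∃ w ∈ sphere c s, ball w ε ⊆ O := by
  refine isCompact_Icc.induction_on (p := fun S => ∃ ε > 0, ∀ s ∈ S, ∃ w ∈ sphere c s, ball w ε ⊆ O)
    ⟨1, one_pos, by simp⟩ ?_ ?_ ?_
  · rintro S T hST ⟨ε, hε, h⟩
    exact ⟨ε, hε, fun s hs => h s (hST hs)⟩
  · rintro S T ⟨ε, hε, h⟩ ⟨ε', hε', h'⟩
    refine ⟨min ε ε', lt_min hε hε', ?_⟩
    rintro s (hs | hs)
    · obtain ⟨w, hw, hb⟩ := h s hs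
      exact ⟨w, hw, (ball_subset_ball (min_le_left _ _)).trans hb⟩
    · obtain ⟨w, hw, hb⟩ := h' s hs
      exact ⟨w, hw, (ball_subset_ball (min_le_right _ _)).trans hb⟩
  · intro s hs
    obtain ⟨w, hw, hwO⟩ := hbad s hs
    obtain ⟨ε, hε, hb⟩ := Metric.isOpen_iff.1 hO w hwO
    have hs0 : 0 < s := h1.trans_le hs.1
    have hw' : ‖w - c‖ = s := by simpa [dist_eq_norm] using hw
    refine ⟨ball s (ε/2) ∩ Ioi 0, mem_nhdsWithin_of_mem_nhds (Filter.inter_mem (ball_mem_nhds _ (by linarith)) (Ioi_mem_nhds hs0)), ε / 2, by linarith, ?_⟩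
    rintro s' ⟨hs', hs'0⟩
    have hs'0 : 0 < s' := hs'0
    have hsC : (s:ℂ) ≠ 0 := by exact_mod_cast hs0.ne'
    refine ⟨c + (s' / s : ℂ) * (w - c), ?_, ?_⟩
    · simp [hw', abs_of_pos hs0, abs_of_pos hs'0, hs0.ne']
    · refine (ball_subset_ball' ?_).trans hb
      have : dist (c + (s' / s : ℂ) * (w - c)) w = |s' - s| := by
        rw [dist_eq_norm]
        have : c + (s' / s : ℂ) * (w - c) - w = ((s' - s : ℝ) / s : ℂ) * (w - c) := by
          push_cast; field_simp; ring
        rw [this, norm_mul, norm_div, hw', Complex.norm_real, Complex.norm_real, Real.norm_eq_abs, Real.norm_eq_abs, abs_of_pos hs0]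
        field_simp
      rw [this]
      rw [mem_ball, Real.dist_eq] at hs'
      linarith

lemma good_circle {φ : ℂ → EReal} (hφ : SubharmonicOn φ univ) (ht : ∀ z, φ z ≠ ⊤) {c : ℂ} {s1 s2 : ℝ} 
    (h1 : 0 < s1) (h12 : s1 < s2) 
    (hbad : ∀ N : ℝ, ∀ s ∈ Icc s1 s2, ∃ w ∈ sphere c s, φ w < ((-N : ℝ) : EReal)) (ws : ℂ) : φ ws = ⊥ := by
  set R := s2 + 2 * (‖ws - c‖ + s2) + 1 with hR
  have hRs : 2 * (‖ws - c‖ + s2) ≤ R - s2 := by linarith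
  have hns := norm_nonneg (ws - c)
  have husc := usc_trunc (upperSemicontinuousOn_univ_iff.1 hφ.1) ht 0
  obtain ⟨B, hB⟩ := (husc.upperSemicontinuousOn (closedBall c R)).bddAbove_of_isCompact (isCompact_closedBall c R)
  have hB' : ∀ z ∈ closedBall c R, φ z ≤ B ∧ 0 ≤ B := by
    intro z hz
    have := (trunc_le (ht z)).1 (hB ⟨z, hz, rfl⟩)
    simpa using this
  have hwsR : ws ∈ closedBall c R := by
    rw [mem_closedBall, dist_eq_norm]; linarith
  have hB0 : 0 ≤ B := (hB' ws hwsR).2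
  set L := s2 - s1 with hL
  have hL0 : 0 < L := by linarith
  set E := L / (4 * Real.exp 1) with hE
  have hE0 : 0 < E := by positivity
  have hRs0 : 0 < R - s2 := by linarith
  set Hm := Real.log (R - s2) - Real.log E with hHm
  suffices key : ∀ N : ℝ, 0 < N → φ ws ≤ ((B - N * Real.log 2 : ℝ) : EReal) by
    rw [EReal.eq_bot_iff_forall_lt]
    intro y
    have hl2 : 0 < Real.log 2 := Real.log_pos (by norm_num)
    have := key ((|B| + |y| + 1) / Real.log 2) (by positivity)
    refine this.trans_lt ?_
    rw [EReal.coe_lt_coe_iff]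
    field_simp
    have := neg_abs_le y
    have := le_abs_self B
    linarith
  intro N hN
  set N2 := N * |Hm| + N * Real.log 2 with hN2
  have hl2 : 0 < Real.log 2 := Real.log_pos (by norm_num)
  have hN20 : 0 < N2 := by positivity
  have hO : IsOpen {w | φ w < ((-N2 : ℝ) : EReal)} :=
    (upperSemicontinuousOn_univ_iff.1 hφ.1).isOpen_preimage _
  obtain ⟨ε, hε, hεO⟩ := uniform_eps h1 hO (fun s hs => hbad N2 s hs)
  obtain ⟨n, hn⟩ := exists_nat_gt (L / ε)
  have hn0 : (0:ℝ) < n := lt_trans (by positivity) hn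
  set Δ := L / n with hΔ
  have hΔ0 : 0 < Δ := by positivity
  have hΔε : Δ < ε := by
    rw [hΔ, div_lt_iff₀ hn0]; rw [div_lt_iff₀ hε] at hn; linarith
  have hnΔ : n * Δ = L := by rw [hΔ]; field_simp
  have hpt : ∀ i : ℕ, ∃ w, i < n → w ∈ sphere c (s1 + i * Δ) ∧ ball w ε ⊆ {w | φ w < ((-N2 : ℝ) : EReal)} := by
    intro i
    by_cases hi : i < n
    · have hi' : (i:ℝ) ≤ n := by exact_mod_cast hi.le
      obtain ⟨w, hw, hb⟩ := hεO (s1 + i * Δ) ⟨by have : 0 ≤ i * Δ := by positivity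
                                                 linarith, by
          have : i * Δ ≤ n * Δ := by gcongr
          linarith⟩
      exact ⟨w, fun _ => ⟨hw, hb⟩⟩
    · exact ⟨0, fun h => absurd h hi⟩
  choose wi hwi using hpt
  have hnorm : ∀ i < n, ‖wi i - c‖ = s1 + i * Δ := by
    intro i hi
    simpa [dist_eq_norm] using (hwi i hi).1
  have hle2 : ∀ i < n, s1 + i * Δ ≤ s2 := by
    intro i hi
    have hi' : (i:ℝ) ≤ n := by exact_mod_cast hi.le
    have : i * Δ ≤ n * Δ := by gcongr
    linarith
  let P : ℂ → ℂ := fun w => ∏ i ∈ Finset.range n, (w - wi i)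
  let K : Set ℂ := closedBall c R \ ⋃ i ∈ Finset.range n, ball (wi i) Δ
  have hKc : IsCompact K := (isCompact_closedBall c R).diff (isOpen_biUnion fun i _ => isOpen_ball)
  have hKm : ∀ w, w ∈ K ↔ w ∈ closedBall c R ∧ ∀ i < n, Δ ≤ ‖w - wi i‖ := by
    intro w
    simp [K, dist_eq_norm]
  have hPlow : ∀ w ∈ K, E ^ n ≤ ‖P w‖ := by
    intro w hw
    rw [hKm] at hw
    have a1 : ∏ i ∈ Finset.range n, (Δ * max 1 |(‖w - c‖ - s1) / Δ - i|) ≤ ‖P w‖ := by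
      simp only [P, norm_prod]
      apply Finset.prod_le_prod
      · intro i _; positivity
      · intro i hi
        rw [Finset.mem_range] at hi
        rw [mul_max_of_nonneg _ _ hΔ0.le, mul_one]
        apply max_le (hw.2 i hi)
        have : Δ * |(‖w - c‖ - s1) / Δ - i| = |‖w - c‖ - ‖wi i - c‖| := by
          rw [hnorm i hi]
          nth_rewrite 1 [← abs_of_pos hΔ0]
          rw [← abs_mul]
          congr 1; field_simp; ring
        rw [this]
        refine (abs_norm_sub_norm_le _ _).trans (le_of_eq ?_)
        congr 1; ring
    refine le_trans ?_ a1
    rw [Finset.prod_mul_distrib, Finset.prod_const, Finset.card_range]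
    have a2 := prod_lower n ((‖w - c‖ - s1) / Δ)
    have a3 : Δ ^ n * ((n.factorial : ℝ) / 4 ^ n) ≤ Δ ^ n * ∏ i ∈ Finset.range n, max 1 |(‖w - c‖ - s1) / Δ - i| := by
      gcongr
    refine le_trans ?_ a3
    have a4 := Real.pow_div_factorial_le_exp (n:ℝ) hn0.le n
    have hf : (0:ℝ) < n.factorial := by exact_mod_cast n.factorial_pos
    rw [div_le_iff₀ hf] at a4
    have a5 : Real.exp n = Real.exp 1 ^ n := by rw [← Real.exp_nat_mul]; simp
    rw [a5] at a4
    have a6 : E ^ n = Δ ^ n * ((n:ℝ) ^ n / (Real.exp 1 ^ n)) / 4 ^ n := by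
      rw [hE, ← hnΔ, div_pow, mul_pow, mul_pow]; field_simp
    rw [a6, mul_div_assoc, div_div]
    gcongr Δ ^ n * ?_
    rw [div_le_div_iff₀ (by positivity) (by positivity)]
    have : (0:ℝ) < 4 ^ n := by positivity
    nlinarith
  have hP0 : ∀ w ∈ K, P w ≠ 0 := by
    intro w hw h
    have := hPlow w hw
    rw [h, norm_zero] at this
    have : 0 < E ^ n := by positivity
    linarith
  have hPan : ∀ w, AnalyticAt ℂ P w := by
    intro w
    have : Differentiable ℂ P := by
      unfold P; fun_prop
    exact this.analyticAt w
  let H : ℂ → ℝ := fun w => N * (Real.log (R - s2) - (1 / n) * Real.log ‖P w‖)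
  have hHcont : ContinuousOn H K := by
    have hPc : Continuous P := by unfold P; fun_prop
    have : ContinuousOn (fun w => Real.log ‖P w‖) K := by
      apply ContinuousOn.log
      · fun_prop
      · intro w hw; simpa using hP0 w hw
    unfold H; fun_prop
  have hHub : ∀ w ∈ K, H w ≤ N * |Hm| := by
    intro w hw
    have b1 : n * Real.log E ≤ Real.log ‖P w‖ := by
      rw [← Real.log_pow]
      exact Real.log_le_log (by positivity) (hPlow w hw)
    have b2 : Real.log E ≤ (1 / n) * Real.log ‖P w‖ := by
      rw [one_div, le_inv_mul_iff₀ hn0]; exact b1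
    simp only [H]
    have := le_abs_self Hm
    gcongr
    linarith
  -- the hole values
  have hhole : ∀ w, ∀ i < n, ‖w - wi i‖ ≤ Δ → φ w < ((-N2 : ℝ) : EReal) := by
    intro w i hi hw
    apply (hwi i hi).2
    rw [mem_ball, dist_eq_norm]; linarith
  by_cases hws : ws ∈ K
  · have hmp := (hφ.subR ht N2).max_principle hKc hHcont (M := B) (by
      intro w hw
      have hw' := (hKm w).1 hw
      by_cases c1 : ∃ i < n, ‖w - wi i‖ ≤ Δ
      · left
        obtain ⟨i, hi, hwl⟩ := c1
        have d1 : trunc N2 (φ w) ≤ -N2 := (trunc_le (ht w)).2 ⟨(hhole w i hi hwl).le, le_rfl⟩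
        have d2 := hHub w hw
        have : 0 < N * Real.log 2 := by positivity
        linarith
      push Not at c1
      by_cases c2 : ‖w - c‖ < R
      · right
        constructor
        · have hopen : IsOpen {x : ℂ | ‖x - c‖ < R ∧ ∀ i ∈ Finset.range n, Δ < ‖x - wi i‖} := by
            apply IsOpen.and
            · exact isOpen_lt (by fun_prop) (by fun_prop)
            · have : {x : ℂ | ∀ i ∈ Finset.range n, Δ < ‖x - wi i‖} = ⋂ i ∈ Finset.range n, {x | Δ < ‖x - wi i‖} := by
                ext; simp
              rw [this]
              exact isOpen_biInter_finset fun i _ => isOpen_lt (by fun_prop) (by fun_prop)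
          refine Filter.mem_of_superset (hopen.mem_nhds ⟨c2, by simpa using c1⟩) ?_
          rintro x ⟨hx1, hx2⟩
          rw [hKm]
          refine ⟨by rw [mem_closedBall, dist_eq_norm]; exact hx1.le, fun i hi => (hx2 i (by simpa using hi)).le⟩
        · obtain ⟨g, hg, hge⟩ := log_norm_eq_re (hPan w) (hP0 w hw)
          refine ⟨fun x => ((N * Real.log (R - s2) : ℝ) : ℂ) - ((N * (1 / n) : ℝ) : ℂ) * g x, ?_, ?_⟩
          · exact analyticAt_const.sub (analyticAt_const.mul hg)
          · filter_upwards [hge] with x hx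
            simp only [H, hx, Complex.sub_re, Complex.re_ofReal_mul, Complex.ofReal_re]
            ring
      · left
        push Not at c2
        have e1 : trunc N2 (φ w) ≤ B := (trunc_le (ht w)).2 ⟨(hB' w hw'.1).1, by linarith⟩
        have e2 : (R - s2) ^ n ≤ ‖P w‖ := by
          simp only [P, norm_prod]
          calc (R - s2) ^ n = ∏ i ∈ Finset.range n, (R - s2) := by simp
            _ ≤ _ := by
              apply Finset.prod_le_prod
              · intro i _; exact hRs0.le
              · intro i hi
                rw [Finset.mem_range] at hi
                have := hle2 i hi
                have := hnorm i hi
                have := norm_sub_le_norm_sub_add_norm_sub w (wi i) c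
                linarith
        have e3 : n * Real.log (R - s2) ≤ Real.log ‖P w‖ := by
          rw [← Real.log_pow]
          exact Real.log_le_log (by positivity) e2
        have e4 : Real.log (R - s2) ≤ (1 / n) * Real.log ‖P w‖ := by
          rw [one_div, le_inv_mul_iff₀ hn0]; exact e3
        have : H w ≤ 0 := by
          simp only [H]
          apply mul_nonpos_of_nonneg_of_nonpos hN.le; linarith
        linarith) ws hws
    have f1 : ‖P ws‖ ≤ ((R - s2) / 2) ^ n := by
      simp only [P, norm_prod]
      calc _ ≤ ∏ i ∈ Finset.range n, ((R - s2) / 2) := by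
            apply Finset.prod_le_prod
            · intro i _; positivity
            · intro i hi
              rw [Finset.mem_range] at hi
              have := hle2 i hi
              have := hnorm i hi
              have := norm_sub_le_norm_sub_add_norm_sub ws c (wi i)
              rw [norm_sub_rev c] at this
              linarith
        _ = _ := by rw [Finset.prod_const, Finset.card_range]
    have f2 : Real.log ‖P ws‖ ≤ n * (Real.log (R - s2) - Real.log 2) := by
      rw [← Real.log_div hRs0.ne' (by norm_num), ← Real.log_pow]
      exact Real.log_le_log (by simpa using hP0 ws hws) f1
    have f3 : (1 / n) * Real.log ‖P ws‖ ≤ Real.log (R - s2) - Real.log 2 := by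
      rw [one_div, inv_mul_le_iff₀ hn0]; exact f2
    have f4 : N * Real.log 2 ≤ H ws := by
      simp only [H]
      gcongr
      linarith
    have f5 : trunc N2 (φ ws) ≤ B - N * Real.log 2 := by
      linarith
    exact ((trunc_le (ht ws)).1 f5).1
  · rw [hKm] at hws
    push Not at hws
    obtain ⟨i, hi, hw⟩ := hws hwsR
    refine (hhole ws i hi hw.le).le.trans ?_
    rw [EReal.coe_le_coe_iff]
    have : 0 ≤ N * |Hm| := by positivity
    linarith

lemma eq_bot_of_disc {φ : ℂ → EReal} (hφ : SubharmonicOn φ univ) (ht : ∀ z, φ z ≠ ⊤) {c : ℂ} {r : ℝ} (hr : 0 < r)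
    (h : ∀ w ∈ ball c r, φ w = ⊥) (w : ℂ) : φ w = ⊥ := by
  refine good_circle hφ ht (c := c) (s1 := r / 3) (s2 := r / 2) (by linarith) (by linarith) ?_ w
  intro N s hs
  have hs0 : 0 ≤ s := by linarith [hs.1]
  refine ⟨c + s, by simp [hs0], ?_⟩
  rw [h]
  · exact EReal.bot_lt_coe _
  · simp [abs_of_nonneg hs0]; linarith [hs.2]

end part4

section part5
def Psh2 (u : ℂ × ℂ → EReal) : Prop :=
  UpperSemicontinuous u ∧ (∀ z, u z ≠ ⊤) ∧ ∀ a b : ℂ × ℂ, SubharmonicOn (fun t : ℂ => u (a + t • b)) Set.univ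

def SMV (V : ℂ × ℂ → ℝ) : Prop := ∀ p a : ℂ × ℂ, V p ≤ Real.circleAverage (fun ζ : ℂ => V (p + ζ • a)) 0 1

section fubini
open MeasureTheory
variable {χ : ℂ × ℂ → ℝ} {w : ℂ × ℂ → ℝ}

lemma fub_int (hχ : Continuous χ) (hχc : HasCompactSupport χ) (hw : Measurable w)
    (hb : ∀ K : Set (ℂ × ℂ), IsCompact K → ∃ C, ∀ x ∈ K, |w x| ≤ C) {q : ℂ → ℂ × ℂ → ℂ × ℂ}
    (hq : Continuous (Function.uncurry q)) :
    Integrable (Function.uncurry fun (θ : ℝ) t => χ t * w (q (circleMap 0 1 θ) t)) 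
      ((volume.restrict (uIoc 0 (2 * Real.pi))).prod volume) := by
  have hK : IsCompact ((Function.uncurry q) '' (sphere (0:ℂ) 1 ×ˢ tsupport χ)) :=
    ((isCompact_sphere _ _).prod hχc).image hq
  obtain ⟨C, hC⟩ := hb _ hK
  have hχi : Integrable (fun t => C * ‖χ t‖) volume := 
    ((hχ.integrable_of_hasCompactSupport hχc).norm).const_mul C
  have : IsFiniteMeasure (volume.restrict (uIoc 0 (2 * Real.pi))) := by
    rw [uIoc_of_le Real.two_pi_pos.le]; infer_instance
  have := hχi.comp_snd (volume.restrict (uIoc 0 (2 * Real.pi)))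
  refine this.mono' ?_ ?_
  · apply Measurable.aestronglyMeasurable
    have h1 : Measurable (fun x : ℝ × (ℂ × ℂ) => q (circleMap 0 1 x.1) x.2) := by
      have : Continuous (fun x : ℝ × (ℂ × ℂ) => (circleMap (0:ℂ) 1 x.1, x.2)) := by
        have := continuous_circleMap (0:ℂ) 1
        fun_prop
      exact (hq.comp this).measurable
    exact (hχ.measurable.comp measurable_snd).mul (hw.comp h1)
  · filter_upwards with x
    simp only [Function.uncurry, norm_mul]
    rw [mul_comm]
    by_cases hx : x.2 ∈ tsupport χ
    · have := hC (q (circleMap 0 1 x.1) x.2) ⟨(circleMap 0 1 x.1, x.2), ⟨circleMap_mem_sphere _ zero_le_one _, hx⟩, rfl⟩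
      gcongr
      exact this
    · rw [image_eq_zero_of_notMem_tsupport hx]; simp

lemma fub (hχ : Continuous χ) (hχc : HasCompactSupport χ) (hw : Measurable w)
    (hb : ∀ K : Set (ℂ × ℂ), IsCompact K → ∃ C, ∀ x ∈ K, |w x| ≤ C) {q : ℂ → ℂ × ℂ → ℂ × ℂ}
    (hq : Continuous (Function.uncurry q)) :
    Integrable (fun t => χ t * Real.circleAverage (fun ζ => w (q ζ t)) 0 1) ∧ 
    ∫ t, χ t * Real.circleAverage (fun ζ => w (q ζ t)) 0 1 = 
      Real.circleAverage (fun ζ => ∫ t, χ t * w (q ζ t)) 0 1 := by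
  have h := fub_int hχ hχc hw hb hq
  have e : ∀ t, χ t * Real.circleAverage (fun ζ => w (q ζ t)) 0 1 = 
      (2 * Real.pi)⁻¹ * ∫ θ in 0..2 * Real.pi, χ t * w (q (circleMap 0 1 θ) t) := by
    intro t
    rw [Real.circleAverage, intervalIntegral.integral_const_mul, smul_eq_mul]; ring
  simp only [e]
  constructor
  · apply Integrable.const_mul
    have := h.integral_prod_right
    simp only [Function.uncurry] at this
    rw [uIoc_of_le Real.two_pi_pos.le] at this
    simpa only [intervalIntegral.integral_of_le Real.two_pi_pos.le] using this
  · rw [integral_const_mul, Real.circleAverage, smul_eq_mul]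
    rw [intervalIntegral_integral_swap h]
end fubini

section smoothing
open MeasureTheory

/-- the circle invariant bump function -/
def bump0 (δ : ℝ) (t : ℂ × ℂ) : ℝ := Real.smoothTransition (1 - (‖t.1‖ ^ 2 + ‖t.2‖ ^ 2) / δ ^ 2)

lemma bump0_contDiff (δ : ℝ) : ContDiff ℝ 2 (bump0 δ) := by
  have h1 : ContDiff ℝ 2 Real.smoothTransition := Real.smoothTransition.contDiff (n := 2)
  apply h1.comp
  have h2 : ContDiff ℝ 2 (fun t : ℂ × ℂ => ‖t.1‖ ^ 2) := (contDiff_norm_sq ℝ).comp contDiff_fst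
  have h3 : ContDiff ℝ 2 (fun t : ℂ × ℂ => ‖t.2‖ ^ 2) := (contDiff_norm_sq ℝ).comp contDiff_snd
  exact contDiff_const.sub ((h2.add h3).div_const _)

lemma bump0_supp {δ : ℝ} (hδ : 0 < δ) {t : ℂ × ℂ} (h : bump0 δ t ≠ 0) : ‖t‖ ≤ δ := by
  unfold bump0 at h
  rw [Ne, Real.smoothTransition.zero_iff_nonpos] at h
  push Not at h
  have h2 : ‖t.1‖ ^ 2 + ‖t.2‖ ^ 2 < δ ^ 2 := by
    rw [sub_pos, div_lt_one (by positivity)] at h; exact h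
  rw [Prod.norm_def]
  apply max_le
  · apply le_of_sq_le_sq _ hδ.le; nlinarith [sq_nonneg ‖t.2‖]
  · apply le_of_sq_le_sq _ hδ.le; nlinarith [sq_nonneg ‖t.1‖]

lemma rot_mp {ζ : ℂ} (hζ : ‖ζ‖ = 1) : MeasurePreserving (fun t : ℂ × ℂ => ζ • t) := by
  have h := (rotation (⟨ζ, by simpa [Submonoid.unitSphere] using hζ⟩ : Circle)).measurePreserving
  exact h.prod h

lemma smoothing {u : ℂ × ℂ → EReal} (hu : Psh2 u) (N : ℝ) {δ : ℝ} (hδ : 0 < δ) : ∃ V : ℂ × ℂ → ℝ,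
    ContDiff ℝ 2 V ∧ (∀ p, trunc N (u p) ≤ V p) ∧
    (∀ p c, (∀ q, dist q p ≤ δ → trunc N (u q) ≤ c) → V p ≤ c) ∧ SMV V := by
  obtain ⟨husc, ht, hl⟩ := hu
  set w : ℂ × ℂ → ℝ := fun p => trunc N (u p) with hw
  have hwusc : UpperSemicontinuous w := usc_trunc husc ht N
  have hwm : Measurable w := hwusc.measurable
  have hwlow : ∀ p, -N ≤ w p := fun p => neg_le_trunc (ht p)
  have hwb : ∀ K : Set (ℂ × ℂ), IsCompact K → ∃ C, ∀ x ∈ K, |w x| ≤ C := by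
    intro K hK
    obtain ⟨B, hB⟩ := (hwusc.upperSemicontinuousOn K).bddAbove_of_isCompact hK
    refine ⟨max |-N| |B|, fun x hx => abs_le_max_abs_abs (hwlow x) (hB ⟨x, hx, rfl⟩)⟩
  have hb0c : Continuous (bump0 δ) := (bump0_contDiff δ).continuous
  have hb0n : ∀ t, 0 ≤ bump0 δ t := fun t => Real.smoothTransition.nonneg _
  have hb0s : HasCompactSupport (bump0 δ) := by
    apply HasCompactSupport.of_support_subset_isCompact (isCompact_closedBall 0 δ)
    intro t h
    simpa using bump0_supp hδ h
  have hI : 0 < ∫ t, bump0 δ t := by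
    apply Continuous.integral_pos_of_hasCompactSupport_nonneg_nonzero (x := (0 : ℂ × ℂ)) hb0c hb0s hb0n
    simp [bump0]
  set I := ∫ t, bump0 δ t with hIdef
  let χ : ℂ × ℂ → ℝ := fun t => I⁻¹ * bump0 δ t
  have hχcd : ContDiff ℝ 2 χ := contDiff_const.mul (bump0_contDiff δ)
  have hχc : Continuous χ := hχcd.continuous
  have hχn : ∀ t, 0 ≤ χ t := fun t => mul_nonneg (inv_nonneg.2 hI.le) (hb0n t)
  have hχs : HasCompactSupport χ := hb0s.mul_left
  have hχint : Integrable χ := hχc.integrable_of_hasCompactSupport hχs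
  have hχ1 : ∫ t, χ t = 1 := by
    simp only [χ]
    rw [integral_const_mul, ← hIdef, inv_mul_cancel₀ hI.ne']
  have hχsupp : ∀ t, χ t ≠ 0 → ‖t‖ ≤ δ := fun t h => bump0_supp hδ (right_ne_zero_of_mul h)
  have hχrot : ∀ ζ : ℂ, ‖ζ‖ = 1 → ∀ t, χ (ζ • t) = χ t := by
    intro ζ hζ t
    simp [χ, bump0, hζ]
  have hwli : LocallyIntegrable w := by
    rw [locallyIntegrable_iff]
    intro K hK
    obtain ⟨C, hC⟩ := hwb K hK
    refine Measure.integrableOn_of_bounded (M := C) hK.measure_lt_top.ne hwm.aestronglyMeasurable ?_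
    filter_upwards [ae_restrict_mem hK.measurableSet] with x hx
    exact hC x hx
  let V : ℂ × ℂ → ℝ := fun p => ∫ t, χ t * w (p - t)
  have hVeq : V = convolution χ w (ContinuousLinearMap.lsmul ℝ ℝ) volume := by
    ext p
    simp [V, convolution_def]
  have hVcd : ContDiff ℝ 2 V := by
    rw [hVeq]
    have : (volume : Measure (ℂ × ℂ)).IsAddHaarMeasure := 
      inferInstanceAs ((volume : Measure ℂ).prod (volume : Measure ℂ)).IsAddHaarMeasure
    exact hχs.contDiff_convolution_left (n := 2) _ hχcd hwli
  have hconvInt : ∀ p, Integrable (fun t => χ t * w (p - t)) := by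
    intro p
    obtain ⟨C, hC⟩ := hwb _ (isCompact_closedBall p δ)
    refine (hχint.const_mul C).mono' ((hχc.measurable.mul (hwm.comp (by fun_prop))).aestronglyMeasurable) ?_
    filter_upwards with t
    by_cases h0 : χ t = 0
    · simp [h0]
    · rw [norm_mul, Real.norm_of_nonneg (hχn t), mul_comm]
      have := hC (p - t) (by simpa [dist_eq_norm] using hχsupp t h0)
      have := hχn t
      gcongr
      assumption
  have hsub : ∀ p a, w p ≤ Real.circleAverage (fun ζ => w (p + ζ • a)) 0 1 := by
    intro p a
    have := SubR.le_avg ((hl p a).subR (fun _ => ht _) N) (b := -N) (fun z => neg_le_trunc (ht _)) 0 one_pos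
    simpa using this
  refine ⟨V, hVcd, ?_, ?_, ?_⟩
  · intro p
    -- rotate
    have h1 : ∀ ζ ∈ sphere (0:ℂ) |1|, V p = ∫ t, χ t * w (p + ζ • (-t)) := by
      intro ζ hζ
      have hζ1 : ‖ζ‖ = 1 := by simpa using hζ
      have hz0 : ζ ≠ 0 := by rintro rfl; simp at hζ1
      have hme : MeasurableEmbedding (fun t : ℂ × ℂ => ζ • t) :=
        (Homeomorph.smulOfNeZero ζ hz0).measurableEmbedding
      have h2 := (rot_mp hζ1).integral_comp hme (fun t => χ t * w (p - t))
      simp only [V]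
      rw [← h2]
      simp only [hχrot ζ hζ1]
      congr 1; ext t
      rw [smul_neg, sub_eq_add_neg]
    obtain ⟨f1, f2⟩ := fub hχc hχs hwm hwb (q := fun ζ t => p + ζ • (-t)) (by
      simp only [Function.uncurry_def]; fun_prop)
    have h3 : V p = Real.circleAverage (fun ζ => ∫ t, χ t * w (p + ζ • (-t))) 0 1 := by
      rw [← Real.circleAverage_congr_sphere (f₁ := fun _ => V p) h1, Real.circleAverage_const]
    rw [h3, ← f2]
    change w p ≤ _
    have h4 : w p = ∫ t, χ t * w p := by
      rw [integral_mul_const, hχ1, one_mul]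
    rw [h4]
    apply integral_mono (hχint.mul_const _) f1
    intro t
    exact mul_le_mul_of_nonneg_left (hsub _ _) (hχn t)
  · intro p c hc
    have h4 : c = ∫ t, χ t * c := by
      rw [integral_mul_const, hχ1, one_mul]
    rw [h4]
    apply integral_mono (hconvInt p) (hχint.mul_const _)
    intro t
    by_cases h0 : χ t = 0
    · simp [h0]
    · exact mul_le_mul_of_nonneg_left (hc _ (by simpa [dist_eq_norm] using hχsupp t h0)) (hχn t)
  · intro p a
    obtain ⟨f1, f2⟩ := fub hχc hχs hwm hwb (q := fun ζ t => p + ζ • a - t) (by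
      simp only [Function.uncurry_def]; fun_prop)
    simp only [V]
    rw [← f2]
    apply integral_mono (hconvInt p) f1
    intro t
    refine mul_le_mul_of_nonneg_left ?_ (hχn t)
    refine (hsub (p - t) a).trans (le_of_eq ?_)
    congr 1; ext ζ; congr 1; abel
end smoothing

end part5

section part6
lemma taylor_lower {g g' g'' : ℝ → ℝ} (h1 : ∀ s, HasDerivAt g (g' s) s) (h2 : ∀ s, HasDerivAt g' (g'' s) s)
    {c : ℝ} (hc : ∀ s ∈ Icc (0:ℝ) 1, c ≤ g'' s) : g 0 + g' 0 + c / 2 ≤ g 1 := by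
  have a1 : ∀ s ∈ Icc (0:ℝ) 1, g' 0 + c * s ≤ g' s := by
    intro s hs
    have : MonotoneOn (fun s => g' s - c * s) (Icc 0 1) := by
      apply monotoneOn_of_deriv_nonneg (convex_Icc 0 1)
      · exact fun x _ => ((h2 x).sub ((hasDerivAt_id x).const_mul c)).continuousAt.continuousWithinAt
      · exact fun x _ => ((h2 x).sub ((hasDerivAt_id x).const_mul c)).differentiableAt.differentiableWithinAt
      · intro x hx
        rw [interior_Icc] at hx
        have h3 : HasDerivAt (fun s => g' s - c * s) (g'' x - c * 1) x := (h2 x).sub ((hasDerivAt_id x).const_mul c)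
        rw [h3.deriv]
        have := hc x ⟨hx.1.le, hx.2.le⟩
        linarith
    have := this (left_mem_Icc.2 zero_le_one) hs hs.1
    simp at this
    linarith
  have : MonotoneOn (fun s => g s - g' 0 * s - c / 2 * (s * s)) (Icc 0 1) := by
    have hd : ∀ x, HasDerivAt (fun s => g s - g' 0 * s - c / 2 * (s * s)) (g' x - g' 0 * 1 - c / 2 * (1 * x + x * 1)) x :=
      fun x => ((h1 x).sub ((hasDerivAt_id x).const_mul (g' 0))).sub (((hasDerivAt_id x).mul (hasDerivAt_id x)).const_mul (c / 2))
    apply monotoneOn_of_deriv_nonneg (convex_Icc 0 1)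
    · exact fun x _ => (hd x).continuousAt.continuousWithinAt
    · exact fun x _ => (hd x).differentiableAt.differentiableWithinAt
    · intro x hx
      rw [interior_Icc] at hx
      rw [(hd x).deriv]
      have := a1 x ⟨hx.1.le, hx.2.le⟩
      linarith
  have := this (left_mem_Icc.2 zero_le_one) (right_mem_Icc.2 zero_le_one) zero_le_one
  simp at this
  linarith

abbrev D2 (V : ℂ × ℂ → ℝ) (p : ℂ × ℂ) := fderiv ℝ (fderiv ℝ V) p

lemma D2_cont {V : ℂ × ℂ → ℝ} (hV : ContDiff ℝ 2 V) : Continuous (D2 V) := by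
  have h1 : ContDiff ℝ 1 (fderiv ℝ V) := hV.fderiv_right (by norm_num)
  exact h1.continuous_fderiv one_ne_zero

lemma V_derivs {V : ℂ × ℂ → ℝ} (hV : ContDiff ℝ 2 V) (x b : ℂ × ℂ) : 
    (∀ s : ℝ, HasDerivAt (fun s : ℝ => V (x + s • b)) (fderiv ℝ V (x + s • b) b) s) ∧
    (∀ s : ℝ, HasDerivAt (fun s : ℝ => fderiv ℝ V (x + s • b) b) (D2 V (x + s • b) b b) s) := by
  have hl : ∀ s : ℝ, HasDerivAt (fun s : ℝ => x + s • b) b s := by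
    intro s
    have := ((hasDerivAt_id s).smul_const b).const_add x
    simpa using this
  have h1 : ContDiff ℝ 1 (fderiv ℝ V) := hV.fderiv_right (by norm_num)
  constructor
  · intro s
    exact ((hV.differentiable (by norm_num)) (x + s • b)).hasFDerivAt.comp_hasDerivAt s (hl s)
  · intro s
    have h2 := ((h1.differentiable (by norm_num)) (x + s • b)).hasFDerivAt.comp_hasDerivAt s (hl s)
    have h3 := h2.clm_apply (hasDerivAt_const s b)
    simpa using h3

lemma V_lower {V : ℂ × ℂ → ℝ} (hV : ContDiff ℝ 2 V) {x b : ℂ × ℂ} {c : ℝ} 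
    (h : ∀ s ∈ Icc (0:ℝ) 1, c ≤ D2 V (x + s • b) b b) : V x + fderiv ℝ V x b + c / 2 ≤ V (x + b) := by
  obtain ⟨h1, h2⟩ := V_derivs hV x b
  simpa using taylor_lower h1 h2 h

lemma V_upper {V : ℂ × ℂ → ℝ} (hV : ContDiff ℝ 2 V) {x b : ℂ × ℂ} {c : ℝ} 
    (h : ∀ s ∈ Icc (0:ℝ) 1, D2 V (x + s • b) b b ≤ c) : V (x + b) ≤ V x + fderiv ℝ V x b + c / 2 := by
  obtain ⟨h1, h2⟩ := V_derivs hV x b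
  have := taylor_lower (fun s => (h1 s).neg) (fun s => (h2 s).neg) (c := -c) (fun s hs => neg_le_neg (h s hs))
  simp at this
  linarith

lemma unif_near {X E : Type*} [PseudoMetricSpace X] [SeminormedAddCommGroup E] {f : X → E} (hf : Continuous f) 
    {K : Set X} (hK : IsCompact K) {η : ℝ} (hη : 0 < η) : ∃ ρ > 0, ∀ p ∈ K, ∀ y, dist y p ≤ ρ → ‖f y - f p‖ < η := by
  have h := hK.uniformContinuousAt_of_continuousAt f (fun a _ => hf.continuousAt) (Metric.dist_mem_uniformity hη)
  obtain ⟨ρ, hρ, h2⟩ := Metric.mem_uniformity_dist.1 h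
  refine ⟨ρ / 2, by linarith, fun p hp y hy => ?_⟩
  have h3 : dist (f p) (f y) < η := h2 (by rw [dist_comm]; linarith) hp
  rwa [dist_comm, dist_eq_norm] at h3

lemma D2_near {V : ℂ × ℂ → ℝ} (hV : ContDiff ℝ 2 V) {K : Set (ℂ × ℂ)} (hK : IsCompact K) {η : ℝ} (hη : 0 < η) :
    ∃ ρ > 0, ∀ p ∈ K, ∀ y, dist y p ≤ ρ → ∀ b, |D2 V y b b - D2 V p b b| ≤ η * ‖b‖ ^ 2 := by
  obtain ⟨ρ, hρ, h2⟩ := unif_near (E := ℂ × ℂ →L[ℝ] ℂ × ℂ →L[ℝ] ℝ) (f := D2 V) (D2_cont hV) hK hη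
  refine ⟨ρ, hρ, fun p hp y hy b => ?_⟩
  have h3 := h2 p hp y hy
  have h4 := (D2 V y - D2 V p).le_opNorm₂ b b
  simp only [sub_apply, Real.norm_eq_abs] at h4
  refine h4.trans ?_
  rw [mul_assoc, ← sq]
  gcongr

/-- the restriction of a real bilinear form to a complex line -/
lemma bil_expand (h : ℂ × ℂ →L[ℝ] ℂ × ℂ →L[ℝ] ℝ) (hs : ∀ x y, h x y = h y x) (a : ℂ × ℂ) (ζ : ℂ) :
    h (ζ • a) (ζ • a) = ζ.re ^ 2 * h a a + 2 * (ζ.re * ζ.im) * h a (Complex.I • a) + 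
      ζ.im ^ 2 * h (Complex.I • a) (Complex.I • a) := by
  have e : ζ • a = ζ.re • a + ζ.im • (Complex.I • a) := by
    conv_lhs => rw [← Complex.re_add_im ζ]
    rw [add_smul, mul_smul]
    rfl
  rw [e]
  simp only [map_add, map_smul, add_apply, smul_apply, smul_eq_mul]
  rw [hs (Complex.I • a) a]
  ring

lemma lin_expand (h : ℂ × ℂ →L[ℝ] ℝ) (a : ℂ × ℂ) (ζ : ℂ) :
    h (ζ • a) = ζ.re * h a + ζ.im * h (Complex.I • a) := by
  have e : ζ • a = ζ.re • a + ζ.im • (Complex.I • a) := by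
    conv_lhs => rw [← Complex.re_add_im ζ]
    rw [add_smul, mul_smul]
    rfl
  rw [e]
  simp only [map_add, map_smul, smul_eq_mul]

lemma D2_symm {V : ℂ × ℂ → ℝ} (hV : ContDiff ℝ 2 V) (p x y : ℂ × ℂ) : D2 V p x y = D2 V p y x := by
  have := (hV.contDiffAt (x := p)).isSymmSndFDerivAt (by simp)
  exact this x y

lemma levi {V : ℂ × ℂ → ℝ} (hV : ContDiff ℝ 2 V) (hS : SMV V) (p a : ℂ × ℂ) : 
    0 ≤ D2 V p a a + D2 V p (Complex.I • a) (Complex.I • a) := by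
  by_contra hcon
  push Not at hcon
  set A := D2 V p a a
  set D := D2 V p (Complex.I • a) (Complex.I • a)
  set Bm := D2 V p a (Complex.I • a)
  set η := -(A + D) / (4 * (‖a‖ ^ 2 + 1)) with hη
  have hη0 : 0 < η := by apply div_pos <;> [linarith; positivity]
  have hηa : η * ‖a‖ ^ 2 < -(A + D) / 2 := by
    have : η * (‖a‖ ^ 2 + 1) = -(A + D) / 4 := by rw [hη]; field_simp
    nlinarith
  obtain ⟨ρ, hρ, hnear⟩ := D2_near hV (isCompact_singleton (x := p)) hη0
  set s : ℝ := ρ / (‖a‖ + 1) with hs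
  have hs0 : 0 < s := by positivity
  have hsa : s * ‖a‖ ≤ ρ := by
    have : s * (‖a‖ + 1) = ρ := by rw [hs]; field_simp
    nlinarith
  let q : ℂ[X] := C ((V p + s ^ 2 / 2 * ((A + D) / 2 + η * ‖a‖ ^ 2) : ℝ) : ℂ) + 
    C ((⟨s * fderiv ℝ V p a, -(s * fderiv ℝ V p (Complex.I • a))⟩ : ℂ)) * X + 
    C (⟨s ^ 2 / 2 * ((A - D) / 2), -(s ^ 2 / 2 * Bm)⟩ : ℂ) * X ^ 2
  have h1 := hS p ((s:ℂ) • a)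
  have h2 : Real.circleAverage (fun ζ : ℂ => V (p + ζ • (s:ℂ) • a)) 0 1 ≤ Real.circleAverage (fun ζ => (q.eval ζ).re) 0 1 := by
    apply Real.circleAverage_mono
    · apply ContinuousOn.circleIntegrable'
      have := hV.continuous
      fun_prop
    · exact (Complex.continuous_re.comp (Polynomial.continuous _)).continuousOn.circleIntegrable'
    · intro ζ hζ
      have hζ1 : ‖ζ‖ = 1 := by simpa using hζ
      have hζ2 : ζ.re ^ 2 + ζ.im ^ 2 = 1 := by
        have := Complex.sq_norm ζ
        rw [hζ1, Complex.normSq_apply] at this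
        nlinarith
      have e1 : ζ • (s:ℂ) • a = s • (ζ • a) := by
        rw [smul_comm]; rfl
      have hn : ‖s • (ζ • a)‖ = s * ‖a‖ := by
        rw [norm_smul, norm_smul, hζ1, Real.norm_of_nonneg hs0.le, one_mul]
      have h3 := V_upper hV (x := p) (b := s • (ζ • a)) (c := s ^ 2 * (D2 V p (ζ • a) (ζ • a) + η * ‖a‖ ^ 2)) (by
        intro τ hτ
        have h4 := hnear p rfl (p + τ • s • ζ • a) (by
          rw [dist_eq_norm, add_sub_cancel_left, norm_smul, hn, Real.norm_of_nonneg hτ.1]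
          have : 0 ≤ s * ‖a‖ := by positivity
          nlinarith [hτ.2]) (ζ • a)
        have h5 := (abs_le.1 h4).2
        rw [norm_smul, hζ1, one_mul] at h5
        have h6 : D2 V (p + τ • s • ζ • a) (s • ζ • a) (s • ζ • a) = s ^ 2 * D2 V (p + τ • s • ζ • a) (ζ • a) (ζ • a) := by
          generalize ζ • a = b
          rw [(D2 V (p + τ • s • b)).map_smul s, smul_apply, (D2 V (p + τ • s • b) b).map_smul s]
          simp only [smul_eq_mul]; ring
        rw [h6]
        gcongr
        linarith)
      simp only [e1]
      refine h3.trans (le_of_eq ?_)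
      rw [bil_expand _ (D2_symm hV p), map_smul, smul_eq_mul, lin_expand]
      change _ + _ * (_ * _ + _ * _) + (s ^ 2 * ((ζ.re ^ 2 * A + 2 * (ζ.re * ζ.im) * Bm + ζ.im ^ 2 * D) + _)) / 2 = _
      simp only [q, eval_add, eval_C, eval_mul, eval_X, eval_pow, Complex.add_re, Complex.ofReal_re, Complex.mul_re, sq ζ, Complex.mul_im]
      have : ζ.im ^ 2 = 1 - ζ.re ^ 2 := by linarith
      have h7 : ζ.im * ζ.im = 1 - ζ.re ^ 2 := by linarith
      rw [this, h7]
      ring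
  rw [poly_mean] at h2
  have h3 : (q.eval 0).re = V p + s ^ 2 / 2 * ((A + D) / 2 + η * ‖a‖ ^ 2) := by
    simp only [q, eval_add, eval_C, eval_mul, eval_X, eval_pow, Complex.add_re, Complex.ofReal_re]
    simp
  rw [h3] at h2
  have : 0 < s ^ 2 / 2 := by positivity
  have : s ^ 2 / 2 * ((A + D) / 2 + η * ‖a‖ ^ 2) < 0 := by
    apply mul_neg_of_pos_of_neg this; linarith
  linarith

lemma isotropic (h : ℂ × ℂ →L[ℝ] ℂ × ℂ →L[ℝ] ℝ) (hs : ∀ x y, h x y = h y x) 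
    (hl : ∀ a, 0 ≤ h a a + h (Complex.I • a) (Complex.I • a)) : 
    ∃ a, ‖a‖ = 1 ∧ ∀ ζ : ℂ, 0 ≤ h (ζ • a) (ζ • a) := by
  have main : ∃ a : ℂ × ℂ, a ≠ 0 ∧ h a a = h (Complex.I • a) (Complex.I • a) ∧ h a (Complex.I • a) = 0 := by
    let e1 : ℂ × ℂ := (1, 0)
    let e2 : ℂ × ℂ := (0, 1)
    by_cases h0 : h e2 e2 = h (Complex.I • e2) (Complex.I • e2) ∧ h e2 (Complex.I • e2) = 0
    · exact ⟨e2, by simp [e2], h0⟩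
    · let γ : ℂ := ⟨h e2 e2 - h (Complex.I • e2) (Complex.I • e2), -2 * h e2 (Complex.I • e2)⟩
      let α : ℂ := ⟨h e1 e1 - h (Complex.I • e1) (Complex.I • e1), -2 * h e1 (Complex.I • e1)⟩
      let β : ℂ := ⟨h e1 e2 - h (Complex.I • e1) (Complex.I • e2), -(h e1 (Complex.I • e2) + h (Complex.I • e1) e2)⟩
      have hγ : γ ≠ 0 := by
        intro hc
        apply h0
        have r := congrArg Complex.re hc
        have i := congrArg Complex.im hc
        simp [γ] at r i
        exact ⟨by linarith, i⟩
      obtain ⟨sq, hsq⟩ := IsAlgClosed.exists_pow_nat_eq (discrim γ (2 * β) α) (n := 2) two_pos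
      obtain ⟨l, hlam⟩ := exists_quadratic_eq_zero hγ (b := 2 * β) (c := α) ⟨sq, by rw [← hsq]; ring⟩
      refine ⟨e1 + l • e2, ?_, ?_⟩
      · intro hc
        have := congrArg Prod.fst hc
        simp [e1, e2] at this
      have f1 : e1 + l • e2 = e1 + (l.re • e2 + l.im • (Complex.I • e2)) := by
        conv_lhs => rw [← Complex.re_add_im l]
        rw [add_smul, mul_smul]
        rfl
      have f2 : Complex.I • (e1 + (l.re • e2 + l.im • (Complex.I • e2))) = Complex.I • e1 + (l.re • (Complex.I • e2) - l.im • e2) := by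
        simp [e1, e2]
        simp [Complex.ext_iff]
      rw [f1, f2]
      have r := congrArg Complex.re hlam
      have i := congrArg Complex.im hlam
      simp [α, β, γ] at r i
      simp only [map_add, map_sub, map_smul, add_apply, sub_apply, smul_apply, smul_eq_mul]
      rw [hs e2 e1, hs (Complex.I • e2) e1, hs (Complex.I • e2) e2, hs (Complex.I • e2) (Complex.I • e1), hs e2 (Complex.I • e1)] 
      constructor <;> linarith
  obtain ⟨a, ha, h1, h2⟩ := main
  have hn : ‖a‖ ≠ 0 := by simpa using ha
  have hnc : (‖a‖ : ℂ) ≠ 0 := by exact_mod_cast hn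
  refine ⟨((‖a‖ : ℂ)⁻¹) • a, ?_, fun ζ => ?_⟩
  · rw [norm_smul]; simp [hn]
  · rw [smul_smul, bil_expand h hs, h2, ← h1]
    have := hl a
    rw [← h1] at this
    have h5 : 0 ≤ h a a := by linarith
    have h6 := mul_nonneg (sq_nonneg (ζ * (‖a‖ : ℂ)⁻¹).re) h5
    have h7 := mul_nonneg (sq_nonneg (ζ * (‖a‖ : ℂ)⁻¹).im) h5
    linarith

/-- `v` is strictly convex at order two along a complex direction at each point of `K`. -/
def Iso (v : ℂ × ℂ → ℝ) (K : Set (ℂ × ℂ)) : Prop := ∃ c > 0, ∃ ρ > 0, ∀ p ∈ K, ∃ a : ℂ × ℂ, ‖a‖ = 1 ∧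
  ∀ x, dist x p ≤ ρ → ∃ L : ℂ →L[ℝ] ℝ, ∀ ζ : ℂ, ‖ζ‖ ≤ ρ → v x + L ζ + c * ‖ζ‖ ^ 2 ≤ v (x + ζ • a)

lemma iso_of_smv {V : ℂ × ℂ → ℝ} (hV : ContDiff ℝ 2 V) (hS : SMV V) {η : ℝ} (hη : 0 < η) {K : Set (ℂ × ℂ)} (hK : IsCompact K) :
    Iso (fun x => V x + η * (‖x.1‖ ^ 2 + ‖x.2‖ ^ 2)) K := by
  obtain ⟨ρ, hρ, hnear⟩ := D2_near hV hK hη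
  refine ⟨η / 2, by linarith, ρ / 2, by linarith, fun p hp => ?_⟩
  obtain ⟨a, ha, hiso⟩ := isotropic (D2 V p) (D2_symm hV p) (levi hV hS p)
  refine ⟨a, ha, fun x hx => ?_⟩
  let L1 : ℂ →L[ℝ] ℂ × ℂ := ((1 : ℂ →L[ℂ] ℂ).smulRight a).restrictScalars ℝ
  have hL1 : ∀ ζ, L1 ζ = ζ • a := fun ζ => by simp [L1]
  let L2 : ℂ →L[ℝ] ℝ := (2 * η) • (Complex.reCLM.comp ((ContinuousLinearMap.mul ℝ ℂ) ((starRingEnd ℂ) x.1 * a.1 + (starRingEnd ℂ) x.2 * a.2)))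
  have hL2 : ∀ ζ, L2 ζ = 2 * η * (((starRingEnd ℂ) x.1 * a.1 + (starRingEnd ℂ) x.2 * a.2) * ζ).re := fun ζ => rfl
  refine ⟨(fderiv ℝ V x).comp L1 + L2, fun ζ hζ => ?_⟩
  have h1 := V_lower hV (x := x) (b := ζ • a) (c := - (η * ‖ζ‖ ^ 2)) (by
    intro s hs
    have h2 := hnear p hp (x + s • ζ • a) (by
      refine (dist_triangle _ x _).trans ?_
      have : dist (x + s • ζ • a) x ≤ ρ / 2 := by
        rw [dist_eq_norm, add_sub_cancel_left, norm_smul, norm_smul, ha, Real.norm_of_nonneg hs.1]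
        nlinarith [hs.2, norm_nonneg ζ]
      linarith) (ζ • a)
    rw [norm_smul, ha, mul_one] at h2
    have := hiso ζ
    have := (abs_le.1 h2).1
    linarith)
  have hn : 1 ≤ ‖a.1‖ ^ 2 + ‖a.2‖ ^ 2 := by
    rw [Prod.norm_def] at ha
    rcases max_choice ‖a.1‖ ‖a.2‖ with h | h <;> rw [h] at ha <;> rw [ha] <;> nlinarith [sq_nonneg ‖a.1‖, sq_nonneg ‖a.2‖]
  have e : ‖(x + ζ • a).1‖ ^ 2 + ‖(x + ζ • a).2‖ ^ 2 = ‖x.1‖ ^ 2 + ‖x.2‖ ^ 2 + 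
      2 * (((starRingEnd ℂ) x.1 * a.1 + (starRingEnd ℂ) x.2 * a.2) * ζ).re + ‖ζ‖ ^ 2 * (‖a.1‖ ^ 2 + ‖a.2‖ ^ 2) := by
    simp only [Complex.sq_norm, Complex.normSq_apply]
    simp
    ring
  simp only [add_apply, ContinuousLinearMap.comp_apply, hL1, hL2, e]
  have : η * (‖ζ‖ ^ 2 * 1) ≤ η * (‖ζ‖ ^ 2 * (‖a.1‖ ^ 2 + ‖a.2‖ ^ 2)) := by gcongr
  linarith

end part6

section part7
lemma exists_kernel_unit (L : ℂ →L[ℝ] ℝ) : ∃ e : ℂ, ‖e‖ = 1 ∧ L e = 0 := by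
  by_cases h : (⟨L Complex.I, -L 1⟩ : ℂ) = 0
  · refine ⟨1, by simp, ?_⟩
    have := congrArg Complex.im h
    simpa using this
  · set w : ℂ := ⟨L Complex.I, -L 1⟩ with hw
    have hn : ‖w‖ ≠ 0 := by simpa using h
    refine ⟨(‖w‖⁻¹ : ℝ) • w, ?_, ?_⟩
    · rw [norm_smul]; simp [hn]
    · rw [map_smul]
      have : w = w.re • (1:ℂ) + w.im • Complex.I := by
        apply Complex.ext <;> simp
      have h2 : L w = 0 := by
        rw [this, map_add, map_smul, map_smul]
        simp [hw]
        ring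
      rw [h2, smul_zero]

lemma sign_choice (x : ℝ) : ∃ σ : ℝ, (σ = 1 ∨ σ = -1) ∧ 0 ≤ σ * x := by
  rcases le_total 0 x with h | h
  · exact ⟨1, Or.inl rfl, by linarith⟩
  · exact ⟨-1, Or.inr rfl, by linarith⟩

lemma local_conn {v : ℂ × ℂ → ℝ} (hv : Continuous v) {K : Set (ℂ × ℂ)} (hK : IsCompact K) (hI : Iso v K)
    {ρ0 : ℝ} (hρ0 : 0 < ρ0) : ∃ r > 0, ∃ δ > 0, ∀ p ∈ K, ∀ t < v p + δ, (∃ q ∈ ball p (r/2), t < v q) ∧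
      ∀ q q', q ∈ ball p r → q' ∈ ball p r → t < v q → t < v q' → JoinedIn ({x | t < v x} ∩ ball p ρ0) q q' := by
  obtain ⟨c, hc, ρ1, hρ1, hI⟩ := hI
  set ρ := min ρ1 (ρ0 / 3) with hρ
  have hρp : 0 < ρ := by positivity
  have hρ1' : ρ ≤ ρ1 := min_le_left _ _
  have hρ0' : ρ ≤ ρ0 / 3 := min_le_right _ _
  obtain ⟨r1, hr1, hu⟩ := unif_near hv (hK.cthickening (r := ρ)) (η := c * ρ ^ 2 / 2) (by positivity)
  set r := min r1 ρ with hr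
  have hrp : 0 < r := by positivity
  have hr1' : r ≤ r1 := min_le_left _ _
  have hrρ : r ≤ ρ := min_le_right _ _
  refine ⟨r, hrp, c * r ^ 2 / 16, by positivity, fun p hp t ht => ?_⟩
  obtain ⟨a, ha, hI⟩ := hI p hp
  obtain ⟨Lp, hLp⟩ := hI p (by simp [hρ1.le])
  obtain ⟨e, he, hLe⟩ := exists_kernel_unit Lp
  have hrr : c * r ^ 2 ≤ c * ρ ^ 2 := by gcongr
  refine ⟨?_, ?_⟩
  · refine ⟨p + ((r/4 : ℝ) • e) • a, ?_, ?_⟩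
    · rw [mem_ball, dist_eq_norm, add_sub_cancel_left, norm_smul, norm_smul, he, ha, Real.norm_of_nonneg (by positivity)]
      linarith
    · have h1 : ‖(r/4 : ℝ) • e‖ = r / 4 := by
        rw [norm_smul, he, Real.norm_of_nonneg (by positivity)]; ring
      have := hLp ((r/4 : ℝ) • e) (by rw [h1]; linarith)
      rw [h1, map_smul, hLe] at this
      simp only [smul_zero] at this
      linarith [this, ht, show c * (r/4)^2 = c * r^2/16 by ring]
  · obtain ⟨σ0, hσ0, hLi⟩ := sign_choice (Lp (Complex.I * e))
    set hub := p + ((ρ * σ0) • (Complex.I * e)) • a with hhub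
    have key : ∀ q, q ∈ ball p r → t < v q → JoinedIn ({x | t < v x} ∩ ball p ρ0) q hub := by
      intro q hq htq
      have hq' : dist q p < r := hq
      obtain ⟨Lq, hLq⟩ := hI q (by linarith)
      obtain ⟨σ, hσ, hLs⟩ := sign_choice (Lq e)
      have hσ1 : |σ| = 1 := by rcases hσ with h | h <;> rw [h] <;> simp
      have hσ01 : |σ0| = 1 := by rcases hσ0 with h | h <;> rw [h] <;> simp
      have j1 : JoinedIn ({x | t < v x} ∩ ball p ρ0) q (q + ((ρ * σ) • e) • a) := by
        apply JoinedIn.ofLine (f := fun s : ℝ => q + ((s * (ρ * σ)) • e) • a)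
        · fun_prop
        · simp
        · simp
        · rintro _ ⟨s, hs, rfl⟩
          have hn : ‖(s * (ρ * σ)) • e‖ = s * ρ := by
            rw [norm_smul, he, mul_one, Real.norm_eq_abs, abs_mul, abs_mul, hσ1, abs_of_nonneg hs.1, abs_of_pos hρp, mul_one]
          have hsρ : s * ρ ≤ ρ := by nlinarith [hs.2]
          refine ⟨?_, ?_⟩
          · have := hLq ((s * (ρ * σ)) • e) (by rw [hn]; linarith)
            rw [map_smul, smul_eq_mul] at this
            have h2 : 0 ≤ s * (ρ * σ) * Lq e := by
              have : s * (ρ * σ) * Lq e = s * ρ * (σ * Lq e) := by ring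
              rw [this]
              have := hs.1
              positivity
            have h3 : 0 ≤ c * ‖(s * (ρ * σ)) • e‖ ^ 2 := by positivity
            show t < v (q + ((s * (ρ * σ)) • e) • a)
            linarith
          · rw [mem_ball]
            refine (dist_triangle _ q _).trans_lt ?_
            have : dist (q + ((s * (ρ * σ)) • e) • a) q = s * ρ := by
              rw [dist_eq_norm, add_sub_cancel_left, norm_smul, hn, ha, mul_one]
            simp only [this]
            linarith
      have hne : ‖(ρ * σ) • e‖ = ρ := by
        rw [norm_smul, he, mul_one, Real.norm_eq_abs, abs_mul, hσ1, abs_of_pos hρp, mul_one]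
      have hpe : v p + c * ρ ^ 2 ≤ v (p + ((ρ * σ) • e) • a) := by
        have := hLp ((ρ * σ) • e) (by rw [hne]; linarith)
        rw [map_smul, hLe, hne, smul_zero] at this
        linarith
      have j2 : JoinedIn ({x | t < v x} ∩ ball p ρ0) (q + ((ρ * σ) • e) • a) (p + ((ρ * σ) • e) • a) := by
        apply JoinedIn.ofLine (f := fun s : ℝ => (p + (1 - s) • (q - p)) + ((ρ * σ) • e) • a)
        · fun_prop
        · simp
        · simp
        · rintro _ ⟨s, hs, rfl⟩
          have hd : ‖(1 - s) • (q - p)‖ ≤ ‖q - p‖ := by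
            rw [norm_smul, Real.norm_of_nonneg (by linarith [hs.2])]
            nlinarith [hs.1, norm_nonneg (q - p)]
          rw [dist_eq_norm] at hq'
          refine ⟨?_, ?_⟩
          · have := hu (p + ((ρ * σ) • e) • a) (mem_cthickening_of_dist_le _ p _ _ hp (by
              rw [dist_eq_norm, add_sub_cancel_left, norm_smul, hne, ha, mul_one])) ((p + (1 - s) • (q - p)) + ((ρ * σ) • e) • a) (by
                rw [dist_eq_norm]
                have : (p + (1 - s) • (q - p)) + ((ρ * σ) • e) • a - (p + ((ρ * σ) • e) • a) = (1 - s) • (q - p) := by abel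
                rw [this]; linarith)
            rw [Real.norm_eq_abs] at this
            have := (abs_lt.1 this).1
            show t < v ((p + (1 - s) • (q - p)) + ((ρ * σ) • e) • a)
            have : 0 < c * ρ ^ 2 := by positivity
            linarith
          · rw [mem_ball, dist_eq_norm]
            have : (p + (1 - s) • (q - p)) + ((ρ * σ) • e) • a - p = (1 - s) • (q - p) + ((ρ * σ) • e) • a := by abel
            simp only [this]
            refine (norm_add_le _ _).trans_lt ?_
            rw [norm_smul _ a, hne, ha]
            linarith
      have j3 : JoinedIn ({x | t < v x} ∩ ball p ρ0) (p + ((ρ * σ) • e) • a) hub := by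
        apply JoinedIn.ofLine (f := fun s : ℝ => p + (((1 - s) * (ρ * σ)) • e + (s * (ρ * σ0)) • (Complex.I * e)) • a)
        · fun_prop
        · simp
        · simp [hhub]
        · rintro _ ⟨s, hs, rfl⟩
          set ζ := ((1 - s) * (ρ * σ)) • e + (s * (ρ * σ0)) • (Complex.I * e) with hζ
          have hσ2 : σ ^ 2 = 1 := by rcases hσ with h | h <;> rw [h] <;> norm_num
          have hσ02 : σ0 ^ 2 = 1 := by rcases hσ0 with h | h <;> rw [h] <;> norm_num
          have hn : ‖ζ‖ ^ 2 = ρ ^ 2 * ((1 - s) ^ 2 + s ^ 2) := by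
            have e1 : ζ = (⟨(1 - s) * (ρ * σ), s * (ρ * σ0)⟩ : ℂ) * e := by
              apply Complex.ext <;> simp [hζ] <;> ring
            rw [e1, norm_mul, he, mul_one, Complex.sq_norm, Complex.normSq_apply]
            linear_combination (1-s)^2 * ρ^2 * hσ2 + s^2*ρ^2*hσ02
          have hn1 : ‖ζ‖ ≤ ρ := by
            apply (sq_le_sq₀ (norm_nonneg _) hρp.le).1
            rw [hn]
            have : (1 - s) ^ 2 + s ^ 2 ≤ 1 := by nlinarith [hs.1, hs.2]
            nlinarith [sq_nonneg ρ]
          refine ⟨?_, ?_⟩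
          · have := hLp ζ (by linarith)
            rw [hn] at this
            have h2 : 0 ≤ Lp ζ := by
              rw [hζ, map_add, map_smul, map_smul, hLe, smul_zero, zero_add, smul_eq_mul]
              have : s * (ρ * σ0) * Lp (Complex.I * e) = s * ρ * (σ0 * Lp (Complex.I * e)) := by ring
              rw [this]
              have := hs.1
              positivity
            have h3 : 1 / 2 ≤ (1 - s) ^ 2 + s ^ 2 := by nlinarith [sq_nonneg (1 - 2 * s)]
            have h4 : c * (ρ ^ 2 * (1 / 2)) ≤ c * (ρ ^ 2 * ((1 - s) ^ 2 + s ^ 2)) := by gcongr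
            show t < v (p + ζ • a)
            have : 0 < c * ρ ^ 2 := by positivity
            linarith
          · rw [mem_ball, dist_eq_norm, add_sub_cancel_left, norm_smul, ha]
            linarith
      exact (j1.trans j2).trans j3
    intro q q' hq hq' h1 h2
    exact (key q hq h1).trans (key q' hq' h2).symm

lemma exp_const_of_preconnected {X : Type*} [TopologicalSpace X] {S : Set X} (hS : IsPreconnected S) {g : X → ℂ}
    (hg : ContinuousOn g S) {w : ℂ} (hw : ∀ x ∈ S, Complex.exp (g x) = w) {x y : X} (hx : x ∈ S) (hy : y ∈ S) : g x = g y := by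
  have hw0 : w ≠ 0 := by rw [← hw x hx]; exact Complex.exp_ne_zero _
  have hd : DiscreteTopology (Complex.exp ⁻¹' {w}) := (Complex.isCoveringMapOn_exp w hw0).discreteTopology_fiber
  have hT : IsDiscrete (Complex.exp ⁻¹' {w}) := isDiscrete_iff_discreteTopology.2 hd
  exact hS.constant_of_mapsTo hT hg (fun x hx => hw x hx) hx hy

lemma log_step {v : ℂ × ℂ → ℝ} (hv : Continuous v) {Ω : Set (ℂ × ℂ)} (hΩ : IsOpen Ω) {T0 T1 : ℝ} (hT : T0 < T1)
    (hK : IsCompact {p | p ∈ Ω ∧ 0 ≤ v p ∧ v p ≤ T1}) (hI : Iso v {p | p ∈ Ω ∧ 0 ≤ v p ∧ v p ≤ T1})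
    {F : ℂ × ℂ → ℂ} (hFc : ∀ p ∈ Ω, 0 ≤ v p → ContinuousAt F p) (hF0 : ∀ p ∈ Ω, 0 ≤ v p → F p ≠ 0) : 
    ∃ δ > 0, ∀ t, 0 ≤ t → t ≤ T0 → (∃ l : ℂ × ℂ → ℂ, ContinuousOn l (Ω ∩ {p | t < v p}) ∧ ∀ p ∈ Ω, t < v p → Complex.exp (l p) = F p) →
      (∃ l : ℂ × ℂ → ℂ, ContinuousOn l (Ω ∩ {p | max (t - δ) 0 < v p}) ∧ ∀ p ∈ Ω, max (t - δ) 0 < v p → Complex.exp (l p) = F p) := by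
  set K := {p | p ∈ Ω ∧ 0 ≤ v p ∧ v p ≤ T1} with hKdef
  obtain ⟨μ, hμ, hμF⟩ : ∃ μ > 0, ∀ p ∈ K, μ ≤ ‖F p‖ := by
    rcases K.eq_empty_or_nonempty with h | h
    · exact ⟨1, one_pos, by simp [h]⟩
    · obtain ⟨p0, hp0, hmin⟩ := hK.exists_isMinOn h (f := fun p => ‖F p‖) 
        (fun p hp => (hFc p hp.1 hp.2.1).norm.continuousWithinAt)
      exact ⟨‖F p0‖, by simpa using hF0 p0 hp0.1 hp0.2.1, fun p hp => hmin hp⟩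
  have h := hK.uniformContinuousAt_of_continuousAt F (fun a ha => hFc a ha.1 ha.2.1) (Metric.dist_mem_uniformity hμ)
  obtain ⟨ρ1, hρ1, hFu⟩ := Metric.mem_uniformity_dist.1 h
  obtain ⟨ρ2, hρ2, hsub⟩ := hK.exists_cthickening_subset_open hΩ (fun p hp => hp.1)
  set ρ0 := min ρ1 ρ2
  have hρ0 : 0 < ρ0 := by positivity
  have hFq : ∀ p ∈ K, ∀ q, dist q p < ρ0 → 0 < (F q / F p).re ∧ q ∈ Ω := by
    intro p hp q hq
    constructor
    · have h3 : dist (F p) (F q) < μ := hFu (by rw [dist_comm]; exact hq.trans_le (min_le_left _ _)) hp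
      have h4 := hμF p hp
      have h5 : ‖1 - F q / F p‖ < 1 := by
        have h0 := hF0 p hp.1 hp.2.1
        have : 1 - F q / F p = (F p - F q) / F p := by field_simp
        rw [this, norm_div, div_lt_one (by positivity), ← dist_eq_norm]
        linarith
      have := (Complex.re_le_norm (1 - F q / F p)).trans_lt h5
      simp at this
      linarith
    · exact hsub (mem_cthickening_of_dist_le _ p _ _ hp (hq.le.trans (min_le_right _ _)))
  obtain ⟨r, hr, δ, hδ, hloc⟩ := local_conn hv hK hI hρ0
  refine ⟨δ, hδ, fun t ht0 htT => ?_⟩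
  rintro ⟨l, hl, hle⟩
  have hop : IsOpen (Ω ∩ {p | t < v p}) := hΩ.inter (isOpen_lt continuous_const hv)
  have hop' : IsOpen (Ω ∩ {p | max (t - δ) 0 < v p}) := hΩ.inter (isOpen_lt continuous_const hv)
  have hlc : ∀ p ∈ Ω, t < v p → ContinuousAt l p := fun p h1 h2 => hl.continuousAt (hop.mem_nhds ⟨h1, h2⟩)
  have hr0 : ∀ p ∈ K, t < v p + δ → ∀ q, q ∈ ball p r → t < v q → dist q p < ρ0 := by
    intro p hp htp q hq hq2
    exact (((hloc p hp t htp).2 q q hq hq hq2 hq2).source_mem).2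
  -- independence
  have hind : ∀ p ∈ K, t < v p + δ → ∀ q q', q ∈ ball p r → q' ∈ ball p r → t < v q → t < v q' → 
      l q - Complex.log (F q / F p) = l q' - Complex.log (F q' / F p) := by
    intro p hp htp q q' hq hq' h1 h2
    obtain ⟨γ, hγ⟩ := (hloc p hp t htp).2 q q' hq hq' h1 h2
    have hS : IsPreconnected (range γ) := isPreconnected_range γ.continuous
    apply exp_const_of_preconnected hS (g := fun x => l x - Complex.log (F x / F p)) (w := F p) _ _ ⟨0, by simp⟩ ⟨1, by simp⟩
    · rintro _ ⟨s, rfl⟩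
      obtain ⟨g1, g2⟩ := hγ s
      obtain ⟨g3, g4⟩ := hFq p hp _ g2
      apply ContinuousAt.continuousWithinAt
      refine (hlc _ g4 g1).sub ?_
      apply ContinuousAt.clog
      · exact (hFc _ g4 (ht0.trans g1.le)).div_const _
      · exact Or.inl g3
    · rintro _ ⟨s, rfl⟩
      obtain ⟨g1, g2⟩ := hγ s
      obtain ⟨g3, g4⟩ := hFq p hp _ g2
      have h5 := hF0 _ g4 (ht0.trans g1.le)
      have h6 := hF0 p hp.1 hp.2.1
      rw [Complex.exp_sub, hle _ g4 g1, Complex.exp_log (div_ne_zero h5 h6)]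
      field_simp
  have hex : ∀ p, ∃ q, p ∈ K → t < v p + δ → q ∈ ball p (r / 2) ∧ t < v q := by
    intro p
    by_cases hp : p ∈ K ∧ t < v p + δ
    · obtain ⟨q, h1, h2⟩ := (hloc p hp.1 t hp.2).1
      exact ⟨q, fun _ _ => ⟨h1, h2⟩⟩
    · exact ⟨p, fun h1 h2 => absurd ⟨h1, h2⟩ hp⟩
  choose Q hQ using hex
  let l' : ℂ × ℂ → ℂ := fun p => if t < v p then l p else l (Q p) - Complex.log (F (Q p) / F p)
  have hb2 : ∀ p q : ℂ × ℂ, q ∈ ball p (r / 2) → q ∈ ball p r := fun p q hq => ball_subset_ball (by linarith) hq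
  have hstar : ∀ p ∈ K, t < v p + δ → ∀ q, q ∈ ball p r → t < v q → l' p = l q - Complex.log (F q / F p) := by
    intro p hp htp q hq h1
    by_cases h2 : t < v p
    · have := hind p hp htp p q (by simp [hr]) hq h2 h1
      simp only [l', if_pos h2]
      rw [← this, div_self (hF0 p hp.1 hp.2.1)]
      simp
    · simp only [l', if_neg h2]
      obtain ⟨g1, g2⟩ := hQ p hp htp
      exact hind p hp htp _ q (hb2 _ _ g1) hq g2 h1
  have hcase : ∀ p ∈ Ω, max (t - δ) 0 < v p → ¬ t < v p → p ∈ K ∧ t < v p + δ := by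
    intro p hp h1 h2
    have h3 := (le_max_left _ _).trans_lt h1
    have h4 := (le_max_right _ _).trans_lt h1
    push Not at h2
    exact ⟨⟨hp, h4.le, by linarith⟩, by linarith⟩
  refine ⟨l', ?_, ?_⟩
  · rintro p ⟨hp, hpv⟩
    apply ContinuousAt.continuousWithinAt
    by_cases h2 : t < v p
    · apply (hlc p hp h2).congr
      filter_upwards [hop.mem_nhds ⟨hp, h2⟩] with x hx
      have : t < v x := hx.2
      simp [l', this]
    · obtain ⟨h3, h4⟩ := hcase p hp hpv h2
      obtain ⟨g1, g2⟩ := hQ p h3 h4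
      have hd := hr0 p h3 h4 _ (hb2 _ _ g1) g2
      obtain ⟨g3, g4⟩ := hFq p h3 _ hd
      have hc : ContinuousAt (fun x => l (Q p) - Complex.log (F (Q p) / F x)) p := by
        apply continuousAt_const.sub
        apply ContinuousAt.clog
        · exact continuousAt_const.div (hFc p hp h3.2.1) (hF0 p hp h3.2.1)
        · exact Or.inl g3
      apply hc.congr
      have hT1 : v p < T1 := by push Not at h2; linarith
      filter_upwards [hop'.mem_nhds ⟨hp, hpv⟩, (isOpen_lt hv continuous_const).mem_nhds hT1, ball_mem_nhds p (half_pos hr)] with x hx hx2 hx3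
      have hx4 : max (t - δ) 0 < v x := hx.2
      have h0 := (le_max_right _ _).trans_lt hx4
      have h00 := (le_max_left _ _).trans_lt hx4
      symm
      apply hstar x ⟨hx.1, h0.le, le_of_lt hx2⟩ (by linarith) _ _ g2
      rw [mem_ball] at *
      have := dist_triangle (Q p) p x
      rw [dist_comm] at hx3
      linarith
  · intro p hp hpv
    by_cases h2 : t < v p
    · simp only [l', if_pos h2]
      exact hle p hp h2
    · obtain ⟨h3, h4⟩ := hcase p hp hpv h2
      obtain ⟨g1, g2⟩ := hQ p h3 h4
      have hd := hr0 p h3 h4 _ (hb2 _ _ g1) g2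
      obtain ⟨g3, g4⟩ := hFq p h3 _ hd
      have h5 := hF0 _ g4 (ht0.trans g2.le)
      have h6 := hF0 p hp h3.2.1
      simp only [l', if_neg h2]
      rw [Complex.exp_sub, hle _ g4 g2, Complex.exp_log (div_ne_zero h5 h6)]
      field_simp

theorem log_exists {v : ℂ × ℂ → ℝ} (hv : Continuous v) {Ω : Set (ℂ × ℂ)} (hΩ : IsOpen Ω) {T0 T1 : ℝ} (hT0 : 0 ≤ T0) (hT : T0 < T1)
    (hK : IsCompact {p | p ∈ Ω ∧ 0 ≤ v p ∧ v p ≤ T1}) (hI : Iso v {p | p ∈ Ω ∧ 0 ≤ v p ∧ v p ≤ T1})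
    {F : ℂ × ℂ → ℂ} (hFc : ∀ p ∈ Ω, 0 ≤ v p → ContinuousAt F p) (hF0 : ∀ p ∈ Ω, 0 ≤ v p → F p ≠ 0) 
    (hFs : ∀ p ∈ Ω, T0 < v p → 0 < (F p).re) :
    ∃ l : ℂ × ℂ → ℂ, ContinuousOn l (Ω ∩ {p | 0 < v p}) ∧ ∀ p ∈ Ω, 0 < v p → Complex.exp (l p) = F p := by
  obtain ⟨δ, hδ, hstep⟩ := log_step hv hΩ hT hK hI hFc hF0
  have ind : ∀ k : ℕ, (∃ l : ℂ × ℂ → ℂ, ContinuousOn l (Ω ∩ {p | max (T0 - k * δ) 0 < v p}) ∧ 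
      ∀ p ∈ Ω, max (T0 - k * δ) 0 < v p → Complex.exp (l p) = F p) := by
    intro k
    induction k with
    | zero => 
      refine ⟨fun p => Complex.log (F p), ?_, ?_⟩
      · rintro p ⟨hp, hpv⟩
        simp [hT0] at hpv
        apply ContinuousAt.continuousWithinAt
        exact (hFc p hp (hT0.trans hpv.le)).clog (Or.inl (hFs p hp hpv))
      · intro p hp hpv
        simp [hT0] at hpv
        exact Complex.exp_log (hF0 p hp (hT0.trans hpv.le))
    | succ k ih => 
      have h1 : max (T0 - k * δ) 0 ≤ T0 := max_le (by have : 0 ≤ k * δ := by positivity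
                                                      linarith) hT0
      have := hstep _ (le_max_right _ _) h1 ih
      have e : max (max (T0 - k * δ) 0 - δ) 0 = max (T0 - (k+1 : ℕ) * δ) 0 := by
        push_cast
        rcases le_total (T0 - k * δ) 0 with h | h
        · rw [max_eq_right h, max_eq_right (by linarith), max_eq_right (by linarith)]
        · rw [max_eq_left h]; ring_nf
      rwa [e] at this
  obtain ⟨k, hk⟩ := exists_nat_gt (T0 / δ)
  have h2 := ind k
  rw [div_lt_iff₀ hδ] at hk
  rwa [max_eq_right (by linarith)] at h2

end part7

section part8
lemma cInt_of_cont {V : ℂ × ℂ → ℝ} (hV : Continuous V) (p a : ℂ × ℂ) : CircleIntegrable (fun ζ : ℂ => V (p + ζ • a)) 0 1 := by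
  apply ContinuousOn.circleIntegrable'
  fun_prop

lemma SMV.add' {V W : ℂ × ℂ → ℝ} (hV : SMV V) (hW : SMV W) (cV : Continuous V) (cW : Continuous W) : SMV (fun x => V x + W x) := by
  intro p a
  rw [Real.circleAverage_fun_add (cInt_of_cont cV p a) (cInt_of_cont cW p a)]
  exact add_le_add (hV p a) (hW p a)

lemma SMV.const_mul' {V : ℂ × ℂ → ℝ} (hV : SMV V) {c : ℝ} (hc : 0 ≤ c) : SMV (fun x => c * V x) := by
  intro p a
  have : Real.circleAverage (fun ζ : ℂ => c * V (p + ζ • a)) 0 1 = c * Real.circleAverage (fun ζ : ℂ => V (p + ζ • a)) 0 1 := by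
    have := Real.circleAverage_fun_smul (f := fun ζ : ℂ => V (p + ζ • a)) (c := 0) (R := 1) (a := c)
    simpa [smul_eq_mul] using this
  rw [this]
  exact mul_le_mul_of_nonneg_left (hV p a) hc

lemma mean_re {G : ℂ × ℂ → ℂ} (hG : Differentiable ℂ G) (b : ℂ) (d : ℝ) (p a : ℂ × ℂ) : 
    Real.circleAverage (fun ζ : ℂ => (b * G (p + ζ • a)).re + d) 0 1 = (b * G p).re + d := by
  have hd : Differentiable ℂ (fun ζ : ℂ => b * G (p + ζ • a)) := by fun_prop
  have h1 := (hd.diffContOnCl (s := ball (0:ℂ) |1|)).circleAverage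
  have hi : CircleIntegrable (fun ζ : ℂ => b * G (p + ζ • a)) 0 1 := hd.continuous.continuousOn.circleIntegrable'
  have h2 := Complex.reCLM.circleAverage_comp_comm hi
  have h3 : Real.circleAverage (fun ζ : ℂ => (b * G (p + ζ • a)).re) 0 1 = (b * G p).re := by
    rw [h1] at h2
    simpa [Function.comp_def] using h2
  rw [Real.circleAverage_fun_add, h3, Real.circleAverage_const]
  · exact (Complex.continuous_re.comp hd.continuous).continuousOn.circleIntegrable'
  · exact continuousOn_const.circleIntegrable'

lemma smv_re {G : ℂ × ℂ → ℂ} (hG : Differentiable ℂ G) : SMV (fun x => (G x).re) := by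
  intro p a
  have := mean_re hG 1 0 p a
  simp only [one_mul, add_zero] at this
  rw [this]

lemma smv_sq {G : ℂ × ℂ → ℂ} (hG : Differentiable ℂ G) : SMV (fun x => ‖G x‖ ^ 2) := by
  intro p a
  have h1 := mean_re hG (2 * (starRingEnd ℂ) (G p)) (-‖G p‖ ^ 2) p a
  have h2 : ‖G p‖ ^ 2 = (2 * (starRingEnd ℂ) (G p) * G p).re + (-‖G p‖ ^ 2) := by
    simp only [Complex.sq_norm, Complex.normSq_apply]
    simp
    ring
  simp only
  conv_lhs => rw [h2, ← h1]
  have hc := hG.continuous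
  apply Real.circleAverage_mono
  · apply ContinuousOn.circleIntegrable'
    fun_prop
  · apply ContinuousOn.circleIntegrable'
    fun_prop
  · intro ζ _
    simp only [Complex.sq_norm, Complex.normSq_apply]
    simp
    nlinarith [sq_nonneg ((G p).re - (G (p + ζ • a)).re), sq_nonneg ((G p).im - (G (p + ζ • a)).im)]

lemma no_circle_log {l : ℂ → ℂ} (hl : ContinuousOn l (sphere 0 1)) (h : ∀ ζ ∈ sphere (0:ℂ) 1, Complex.exp (l ζ) = ζ) : False := by
  have hm : ∀ θ : ℝ, Complex.exp (θ * Complex.I) ∈ sphere (0:ℂ) 1 := fun θ => by simp [Complex.norm_exp_ofReal_mul_I]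
  have h1 := exp_const_of_preconnected (X := ℝ) (S := univ) isPreconnected_univ 
    (g := fun θ : ℝ => l (Complex.exp (θ * Complex.I)) - θ * Complex.I) (w := 1) (by
      apply ContinuousOn.sub
      · apply hl.comp (by fun_prop) (fun θ _ => hm θ)
      · fun_prop) (by
      intro θ _
      rw [Complex.exp_sub, h _ (hm θ), div_self (Complex.exp_ne_zero _)]) (x := 0) (y := 2 * Real.pi) trivial trivial
  simp [Complex.exp_two_pi_mul_I] at h1
  have h2 : 2 * (Real.pi : ℂ) * Complex.I = 0 := by linear_combination h1
  simp at h2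

lemma dense_slice {u : ℂ × ℂ → EReal} (hu : Psh2 u) {q0 : ℂ × ℂ} (hq : u q0 ≠ ⊥) (z : ℂ) {r : ℝ} (hr : 0 < r) : 
    ∃ z0 ∈ ball z r, ∃ w, u (z0, w) ≠ ⊥ := by
  by_contra hcon
  push Not at hcon
  obtain ⟨x0, y0⟩ := q0
  by_cases hz : z = x0
  · exact hq (hcon x0 (by simp [hz, hr]) y0)
  have hz' : 0 < ‖z - x0‖ := by simpa [sub_eq_zero] using hz
  have := eq_bot_of_disc (hu.2.2 (x0, y0) (z - x0, 0)) (fun t => hu.2.1 _) (c := 1) (r := r / ‖z - x0‖) (by positivity) (by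
    intro t ht
    have : ((x0, y0) + t • (z - x0, 0) : ℂ × ℂ) = (x0 + t * (z - x0), y0) := by simp
    simp only [this]
    apply hcon
    rw [mem_ball, dist_eq_norm] at *
    have : x0 + t * (z - x0) - z = (t - 1) * (z - x0) := by ring
    rw [this, norm_mul]
    rwa [lt_div_iff₀ hz'] at ht) 0
  simp at this
  exact hq this

lemma good_slice {u : ℂ × ℂ → EReal} (hu : Psh2 u) {z0 w : ℂ} (hw : u (z0, w) ≠ ⊥) (c : ℂ) {s2 : ℝ} (hs : 0 < s2) :
    ∃ B : ℝ, 0 ≤ B ∧ ∃ s, 0 < s ∧ s ≤ s2 ∧ s2 / 2 ≤ s ∧ ∀ w ∈ sphere c s, ((-B : ℝ) : EReal) ≤ u (z0, w) := by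
  by_contra hcon
  push Not at hcon
  have hsub := hu.2.2 (z0, 0) (0, 1)
  have e : (fun t : ℂ => u ((z0, 0) + t • (0, 1))) = fun t => u (z0, t) := by
    funext t; simp
  rw [e] at hsub
  apply hw
  apply good_circle hsub (fun t => hu.2.1 _) (c := c) (s1 := s2 / 2) (s2 := s2) (by positivity) (by linarith)
  intro N s hs'
  obtain ⟨w, h1, h2⟩ := hcon (max N 0) (le_max_right _ _) s (by linarith [hs'.1]) hs'.2 hs'.1
  refine ⟨w, h1, h2.trans_le ?_⟩
  have : -(max N 0) ≤ -N := neg_le_neg (le_max_left _ _)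
  exact_mod_cast this

end part8

section part9
set_option maxHeartbeats 1600000 in
lemma barrier {u : ℂ × ℂ → EReal} (hu : Psh2 u) {G0 : ℂ × ℂ → ℂ} (hG : ContDiff ℂ 2 G0) {z1 : ℂ} {R ρ : ℝ} (hR : 0 < R) (hρ : 0 < ρ)
    {Γ : Set (ℂ × ℂ)} (hΓ : IsCompact Γ) (hΓc : Γ ⊆ closedBall z1 R ×ˢ closedBall 0 ρ) (hΓu : ∀ x ∈ Γ, u x = ⊥)
    {B m τ : ℝ} (hB : 0 ≤ B) (hm : 0 < m) (hτ : 0 < τ) : 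
    ∃ v : ℂ × ℂ → ℝ, Continuous v ∧ ∃ T0 T1 : ℝ, 0 ≤ T0 ∧ T0 < T1 ∧ 
      IsCompact {x | x ∈ ball z1 (R + 2) ×ˢ ball (0:ℂ) (ρ + 2) ∧ 0 ≤ v x ∧ v x ≤ T1} ∧ 
      Iso v {x | x ∈ ball z1 (R + 2) ×ˢ ball (0:ℂ) (ρ + 2) ∧ 0 ≤ v x ∧ v x ≤ T1} ∧ 
      (∀ x ∈ Γ, v x < 0) ∧ (∀ x ∈ closedBall z1 R ×ˢ closedBall (0:ℂ) ρ, (G0 x).re ≤ -τ → v x < 0) ∧ 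
      (∀ x ∈ closedBall z1 R ×ˢ closedBall (0:ℂ) ρ, v x ≤ T0) ∧ 
      (∀ x ∈ closedBall z1 R ×ˢ closedBall (0:ℂ) ρ, ((-B : ℝ) : EReal) ≤ u x → m ≤ (G0 x).re → 0 < v x) := by
  set core := closedBall z1 R ×ˢ closedBall (0:ℂ) ρ with hcore
  set Ω := ball z1 (R + 2) ×ˢ ball (0:ℂ) (ρ + 2) with hΩ
  set C2 := closedBall z1 (R + 2) ×ˢ closedBall (0:ℂ) (ρ + 2) with hC2
  have kcore : IsCompact core := (isCompact_closedBall _ _).prod (isCompact_closedBall _ _)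
  have kC2 : IsCompact C2 := (isCompact_closedBall _ _).prod (isCompact_closedBall _ _)
  have hcC : core ⊆ C2 := prod_mono (closedBall_subset_closedBall (by linarith)) (closedBall_subset_closedBall (by linarith))
  obtain ⟨M0, hM0p, hM0⟩ : ∃ M0 ≥ 0, ∀ x ∈ C2, |(G0 x).re| ≤ M0 := by
    obtain ⟨M, hM⟩ := kC2.exists_bound_of_continuousOn (f := fun x => (G0 x).re) 
      (Complex.continuous_re.comp hG.continuous).continuousOn
    exact ⟨max M 0, le_max_right _ _, fun x hx => (hM x hx).trans (le_max_left _ _)⟩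
  obtain ⟨Cu, hCup, hCu⟩ : ∃ Cu : ℝ, 0 ≤ Cu ∧ ∀ x ∈ cthickening 1 core, u x ≤ ((Cu : ℝ) : EReal) := by
    have hne : (cthickening 1 core).Nonempty := ⟨(z1, 0), self_subset_cthickening _ ⟨by simp [hR.le], by simp [hρ.le]⟩⟩
    obtain ⟨x0, _, hx0⟩ := (hu.1.upperSemicontinuousOn _).exists_isMaxOn hne (kcore.cthickening (r := 1))
    refine ⟨max (u x0).toReal 0, le_max_right _ _, fun x hx => ?_⟩
    refine (hx0 hx).trans ((EReal.le_coe_toReal (hu.2.1 x0)).trans ?_)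
    exact_mod_cast le_max_left _ _
  set ε := m / (2 * (B + Cu + 1)) with hε
  have hεp : 0 < ε := by positivity
  have hεB : ε * (B + Cu) < m := by
    have : ε * (B + Cu + 1) = m / 2 := by rw [hε]; field_simp
    nlinarith
  set N := (M0 + 2) / ε with hN
  have hNp : 0 ≤ N := by positivity
  have hεN : ε * N = M0 + 2 := by rw [hN]; field_simp
  obtain ⟨δ1, hδ1, hδΓ⟩ := hΓ.exists_cthickening_subset_open (t := {x | u x < ((-N : ℝ) : EReal)}) (hu.1.isOpen_preimage _) 
    (fun x hx => by show u x < _; rw [hΓu x hx]; exact EReal.bot_lt_coe _)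
  obtain ⟨V, hV2, hVl, hVu, hVS⟩ := smoothing hu N (δ := min δ1 1) (by positivity)
  have hVcore : ∀ x ∈ core, V x ≤ Cu := by
    intro x hx
    apply hVu
    intro q hq
    rw [trunc_le (hu.2.1 q)]
    exact ⟨hCu q (mem_cthickening_of_dist_le _ x _ _ hx (hq.trans (min_le_right _ _))), by linarith⟩
  have hVΓ : ∀ x ∈ Γ, V x ≤ -N := by
    intro x hx
    apply hVu
    intro q hq
    rw [trunc_le (hu.2.1 q)]
    exact ⟨le_of_lt (hδΓ (mem_cthickening_of_dist_le _ x _ _ hx (hq.trans (min_le_left _ _)))), le_rfl⟩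
  have hVN : ∀ x, -N ≤ V x := fun x => (neg_le_trunc (hu.2.1 x)).trans (hVl x)
  set σ := min (τ / 2) 1 with hσ
  have hσp : 0 < σ := by positivity
  obtain ⟨Mq, hMqp, hMq⟩ : ∃ Mq ≥ 0, ∀ x ∈ core, ‖x.1‖ ^ 2 + ‖x.2‖ ^ 2 ≤ Mq := by
    obtain ⟨M, hM⟩ := kcore.exists_bound_of_continuousOn (f := fun x => ‖x.1‖ ^ 2 + ‖x.2‖ ^ 2) (by fun_prop)
    exact ⟨max M 0, le_max_right _ _, fun x hx => ((le_abs_self _).trans (hM x hx)).trans (le_max_left _ _)⟩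
  set η := σ / (4 * (Mq + 1)) with hη
  have hηp : 0 < η := by positivity
  have hηM : η * Mq ≤ σ / 4 := by
    have : η * (Mq + 1) = σ / 4 := by rw [hη]; field_simp
    nlinarith
  set Big := 2 * M0 + 3 + ε * (N + Cu) with hBig
  obtain ⟨k, hk1, hk2, hk3, hk4⟩ : ∃ k : ℕ, (R / (R + 1)) ^ k < σ / 4 ∧ (ρ / (ρ + 1)) ^ k < σ / 4 ∧ 
      Big < ((R + 2) / (R + 1)) ^ k ∧ Big < ((ρ + 2) / (ρ + 1)) ^ k := by
    have t1 := tendsto_pow_atTop_nhds_zero_of_lt_one (r := R / (R + 1)) (by positivity) (by rw [div_lt_one (by positivity)]; linarith)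
    have t2 := tendsto_pow_atTop_nhds_zero_of_lt_one (r := ρ / (ρ + 1)) (by positivity) (by rw [div_lt_one (by positivity)]; linarith)
    have t3 := tendsto_pow_atTop_atTop_of_one_lt (r := (R + 2) / (R + 1)) (by rw [one_lt_div (by positivity)]; linarith)
    have t4 := tendsto_pow_atTop_atTop_of_one_lt (r := (ρ + 2) / (ρ + 1)) (by rw [one_lt_div (by positivity)]; linarith)
    have := (t1.eventually (gt_mem_nhds (show (0:ℝ) < σ / 4 by positivity))).and ((t2.eventually (gt_mem_nhds (show (0:ℝ) < σ / 4 by positivity))).and 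
      ((t3.eventually_gt_atTop Big).and (t4.eventually_gt_atTop Big)))
    exact this.exists
  let A1 : ℂ × ℂ → ℂ := fun x => ((x.1 - z1) / (R + 1 : ℝ)) ^ k
  let A2 : ℂ × ℂ → ℂ := fun x => (x.2 / (ρ + 1 : ℝ)) ^ k
  have hA1 : ∀ x, ‖A1 x‖ = (‖x.1 - z1‖ / (R + 1)) ^ k := fun x => by
    simp only [A1, norm_pow, norm_div, Complex.norm_real, Real.norm_of_nonneg (show 0 ≤ R + 1 by linarith)]
  have hA2 : ∀ x, ‖A2 x‖ = (‖x.2‖ / (ρ + 1)) ^ k := fun x => by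
    simp only [A2, norm_pow, norm_div, Complex.norm_real, Real.norm_of_nonneg (show 0 ≤ ρ + 1 by linarith)]
  have dA1 : ContDiff ℂ 2 A1 := by fun_prop
  have dA2 : ContDiff ℂ 2 A2 := by fun_prop
  let G1 : ℂ × ℂ → ℂ := fun x => G0 x - (ε * Cu : ℝ)
  have dG1 : ContDiff ℂ 2 G1 := by fun_prop
  have cV := hV2.continuous
  have c1 : ContDiff ℝ 2 (fun x => (G1 x).re) := Complex.reCLM.contDiff.comp (dG1.restrict_scalars ℝ)
  have c2 : ContDiff ℝ 2 (fun x => ‖A1 x‖ ^ 2) := (dA1.restrict_scalars ℝ).norm_sq ℝ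
  have c3 : ContDiff ℝ 2 (fun x => ‖A2 x‖ ^ 2) := (dA2.restrict_scalars ℝ).norm_sq ℝ
  have c4 : ContDiff ℝ 2 (fun x => ε * V x) := contDiff_const.mul hV2
  let W : ℂ × ℂ → ℝ := fun x => (((G1 x).re + ε * V x) + ‖A1 x‖ ^ 2) + ‖A2 x‖ ^ 2
  have hW2 : ContDiff ℝ 2 W := ((c1.add c4).add c2).add c3
  have hWS : SMV W := 
    (((smv_re (dG1.differentiable (by norm_num))).add' (hVS.const_mul' hεp.le) c1.continuous c4.continuous).add' 
      (smv_sq (dA1.differentiable (by norm_num))) (c1.add c4).continuous c2.continuous).add' 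
      (smv_sq (dA2.differentiable (by norm_num))) ((c1.add c4).add c2).continuous c3.continuous
  let v : ℂ × ℂ → ℝ := fun x => W x + η * (‖x.1‖ ^ 2 + ‖x.2‖ ^ 2)
  have hvc : Continuous v := by
    have := hW2.continuous
    fun_prop
  have hve : ∀ x, v x = (G0 x).re - ε * Cu + ε * V x + ‖A1 x‖ ^ 2 + ‖A2 x‖ ^ 2 + η * (‖x.1‖ ^ 2 + ‖x.2‖ ^ 2) := fun x => by
    simp only [v, W, G1, Complex.sub_re, Complex.ofReal_re]
  have hlow : ∀ x, (G0 x).re - ε * Cu + ε * V x + ‖A1 x‖ ^ 2 + ‖A2 x‖ ^ 2 ≤ v x := fun x => by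
    rw [hve]
    have : 0 ≤ η * (‖x.1‖ ^ 2 + ‖x.2‖ ^ 2) := by positivity
    linarith
  have hup : ∀ x ∈ core, v x ≤ (G0 x).re - ε * Cu + ε * V x + 3 * (σ / 4) := fun x hx => by
    rw [hve]
    have h1 : η * (‖x.1‖ ^ 2 + ‖x.2‖ ^ 2) ≤ σ / 4 := by
      refine le_trans ?_ hηM
      have := hMq x hx
      gcongr
    have hσ1 : σ ≤ 1 := min_le_right _ _
    have h2 : ‖A1 x‖ < σ / 4 := by
      rw [hA1]
      refine lt_of_le_of_lt ?_ hk1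
      have : ‖x.1 - z1‖ ≤ R := by rw [← dist_eq_norm]; exact hx.1
      gcongr
    have h3 : ‖A2 x‖ < σ / 4 := by
      rw [hA2]
      refine lt_of_le_of_lt ?_ hk2
      have : ‖x.2‖ ≤ ρ := by rw [← dist_zero_right]; exact hx.2
      gcongr
    have h4 : ‖A1 x‖ ^ 2 ≤ ‖A1 x‖ := by nlinarith [norm_nonneg (A1 x)]
    have h5 : ‖A2 x‖ ^ 2 ≤ ‖A2 x‖ := by nlinarith [norm_nonneg (A2 x)]
    linarith
  have hσ1 : σ ≤ 1 := min_le_right _ _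
  have hσ2 : σ ≤ τ / 2 := min_le_left _ _
  have hbd : ∀ x ∈ C2, x ∉ Ω → M0 + 2 < v x := by
    intro x hx hxΩ
    have h1 := hlow x
    have h2 := (abs_le.1 (hM0 x hx)).1
    have h3 : ε * (-N) ≤ ε * V x := by have := hVN x; gcongr
    have h4 : Big < ‖A1 x‖ ^ 2 + ‖A2 x‖ ^ 2 := by
      have hB1 : 1 < Big := by
        have : 0 ≤ ε * (N + Cu) := by positivity
        linarith
      have hxx : ¬ (dist x.1 z1 < R + 2 ∧ dist x.2 0 < ρ + 2) := hxΩ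
      rw [not_and_or] at hxx
      rcases hxx with h | h
      · have : Big < ‖A1 x‖ := by
          rw [hA1]
          refine hk3.trans_le ?_
          rw [dist_eq_norm] at h
          push Not at h
          gcongr
        nlinarith [sq_nonneg ‖A2 x‖]
      · have : Big < ‖A2 x‖ := by
          rw [hA2]
          refine hk4.trans_le ?_
          rw [dist_zero_right] at h
          push Not at h
          gcongr
        nlinarith [sq_nonneg ‖A1 x‖]
    have h5 : Big = 2 * M0 + 3 + ε * N + ε * Cu := by rw [hBig]; ring
    linarith
  have hK : IsCompact {x | x ∈ Ω ∧ 0 ≤ v x ∧ v x ≤ M0 + 2} := by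
    have e : {x | x ∈ Ω ∧ 0 ≤ v x ∧ v x ≤ M0 + 2} = C2 ∩ {x | 0 ≤ v x ∧ v x ≤ M0 + 2} := by
      ext x
      constructor
      · rintro ⟨h1, h2⟩
        exact ⟨prod_mono ball_subset_closedBall ball_subset_closedBall h1, h2⟩
      · rintro ⟨h1, h2⟩
        refine ⟨?_, h2⟩
        by_contra h3
        have := hbd x h1 h3
        have := h2.2
        linarith
    rw [e]
    apply kC2.inter_right
    exact (isClosed_le continuous_const hvc).inter (isClosed_le hvc continuous_const)
  refine ⟨v, hvc, M0 + 1, M0 + 2, by linarith, by linarith, hK, iso_of_smv hW2 hWS hηp hK, ?_, ?_, ?_, ?_⟩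
  · intro x hx
    have h1 := hup x (hΓc hx)
    have h2 := (abs_le.1 (hM0 x (hcC (hΓc hx)))).2
    have h3 : ε * V x ≤ ε * (-N) := by have := hVΓ x hx; gcongr
    have h4 : 0 ≤ ε * Cu := by positivity
    linarith
  · intro x hx hg
    have h1 := hup x hx
    have h3 : ε * V x ≤ ε * Cu := by have := hVcore x hx; gcongr
    linarith
  · intro x hx
    have h1 := hup x hx
    have h2 := (abs_le.1 (hM0 x (hcC hx))).2
    have h3 : ε * V x ≤ ε * Cu := by have := hVcore x hx; gcongr
    linarith
  · intro x hx hub hg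
    have h1 := hlow x
    have h2 : -B ≤ V x := by
      have : ((-B : ℝ) : EReal) ≤ ((V x : ℝ) : EReal) := (hub.trans (le_trunc (M := N) (hu.2.1 x))).trans (by exact_mod_cast hVl x)
      exact_mod_cast this
    have h3 : ε * (-B) ≤ ε * V x := by gcongr
    have h4 := sq_nonneg ‖A1 x‖
    have h5 := sq_nonneg ‖A2 x‖
    linarith

end part9

section part10
open Filter Topology
set_option maxHeartbeats 1600000 in
lemma G_core {u : ℂ × ℂ → EReal} (hu : Psh2 u) {q0 : ℂ × ℂ} (hq : u q0 ≠ ⊥) {z1 : ℂ} {R : ℝ} (hR : 0 < R) {f : ℂ → ℂ}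
    (hf : ContinuousOn f (closedBall z1 R)) (hfu : ∀ z ∈ closedBall z1 R, u (z, f z) = ⊥) (H p : ℂ[X])
    (hH : ∀ z ∈ closedBall z1 R, H.eval z ≠ 0) {τ : ℝ} (hτ : 0 < τ)
    (hs : ∀ z ∈ sphere z1 R, (f z * H.eval z + p.eval z).re ≤ -2 * τ) {zs : ℂ} (hzs : zs ∈ closedBall z1 R)
    (hg0 : 0 < (f zs * H.eval zs + p.eval zs).re) : False := by
  set g : ℂ → ℝ := fun z => (f z * H.eval z + p.eval z).re with hg
  have hHc : Continuous (fun z => H.eval z) := H.continuous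
  have hpc : Continuous (fun z => p.eval z) := p.continuous
  have hgc : ContinuousOn g (closedBall z1 R) := 
    Complex.continuous_re.comp_continuousOn ((hf.mul hHc.continuousOn).add hpc.continuousOn)
  set c : ℂ → ℂ := fun z => ((max 0 (g z + τ) : ℝ) : ℂ) / H.eval z with hc
  have hcc : ContinuousOn c (closedBall z1 R) := by
    apply ContinuousOn.div _ hHc.continuousOn hH
    exact Complex.continuous_ofReal.comp_continuousOn (continuousOn_const.sup (hgc.add continuousOn_const))
  have hnb : ∀ z ∈ ball z1 R, closedBall z1 R ∈ 𝓝 z := fun z hz => mem_of_superset (isOpen_ball.mem_nhds hz) ball_subset_closedBall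
  -- choose z0
  have hzb : zs ∈ ball z1 R := by
    by_contra h
    have : zs ∈ sphere z1 R := by
      rw [mem_sphere]; rw [mem_ball] at h; rw [mem_closedBall] at hzs; linarith
    have := hs zs this
    linarith
  obtain ⟨r0, hr0, hr0s⟩ := Metric.mem_nhds_iff.1 (Filter.inter_mem (isOpen_ball.mem_nhds hzb) 
    ((hgc.continuousAt (hnb zs hzb)).eventually (lt_mem_nhds hg0)))
  obtain ⟨z0, hz0, w0, hw0⟩ := dense_slice hu hq zs hr0
  obtain ⟨hz0b, hz0g⟩ := hr0s hz0
  have hz0c := ball_subset_closedBall hz0b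
  change 0 < g z0 at hz0g
  have hH0 : 0 < ‖H.eval z0‖ := by simpa using hH z0 hz0c
  set s2 := g z0 / (2 * ‖H.eval z0‖) with hs2
  have hs2p : 0 < s2 := by positivity
  obtain ⟨B, hB, s, hsp, hss2, hs2s, hsB⟩ := good_slice hu hw0 (f z0) hs2p
  obtain ⟨Mf, hMf⟩ := (isCompact_closedBall z1 R).exists_bound_of_continuousOn hf
  obtain ⟨Mc, hMc⟩ := (isCompact_closedBall z1 R).exists_bound_of_continuousOn hcc
  have hMfp : 0 ≤ Mf := (norm_nonneg _).trans (hMf z0 hz0c)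
  have hMcp : 0 ≤ Mc := (norm_nonneg _).trans (hMc z0 hz0c)
  set ρ := Mf + Mc + s2 + 1 with hρ
  have hρp : 0 < ρ := by positivity
  set Γ := (fun z => (z, f z)) '' closedBall z1 R with hΓ
  have kΓ : IsCompact Γ := (isCompact_closedBall z1 R).image_of_continuousOn (continuousOn_id.prodMk hf)
  obtain ⟨v, hvc, T0, T1, hT0, hT, hK, hI, hvΓ, hvτ, hvT, hvB⟩ := barrier hu (G0 := fun x => x.2 * H.eval x.1 + p.eval x.1) (by
      have h1 : ContDiff ℂ 2 (fun x : ℂ × ℂ => H.eval x.1) := H.differentiable.contDiff.comp contDiff_fst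
      have h2 : ContDiff ℂ 2 (fun x : ℂ × ℂ => p.eval x.1) := p.differentiable.contDiff.comp contDiff_fst
      fun_prop) hR hρp (B := B) (m := g z0 / 2) (τ := τ) kΓ (by
      rintro _ ⟨z, hz, rfl⟩
      refine ⟨hz, ?_⟩
      rw [mem_closedBall, dist_zero_right]
      have := hMf z hz
      show ‖f z‖ ≤ ρ
      linarith) (by
      rintro _ ⟨z, hz, rfl⟩
      exact hfu z hz) hB (by positivity) hτ
  classical
  let F : ℂ × ℂ → ℂ := fun x => if x.1 ∈ ball z1 R then 1 + c x.1 / (x.2 - f x.1) else 1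
  have hne : ∀ x : ℂ × ℂ, 0 ≤ v x → x.1 ∈ ball z1 R → x.2 - f x.1 ≠ 0 := by
    intro x hx h1 h2
    have : x ∈ Γ := ⟨x.1, ball_subset_closedBall h1, by ext <;> simp; linear_combination -h2⟩
    have := hvΓ x this
    linarith
  obtain ⟨l, hlc, hle⟩ := log_exists (F := F) hvc (Ω := ball z1 (R + 2) ×ˢ ball (0:ℂ) (ρ + 2)) (isOpen_ball.prod isOpen_ball) hT0 hT hK hI (by
    intro x hx hvx
    by_cases h1 : x.1 ∈ ball z1 R
    · have h2 : ContinuousAt (fun x : ℂ × ℂ => 1 + c x.1 / (x.2 - f x.1)) x := by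
        have e1 : ContinuousAt (fun x : ℂ × ℂ => c x.1) x := (hcc.continuousAt (hnb _ h1)).comp continuousAt_fst
        have e2 : ContinuousAt (fun x : ℂ × ℂ => f x.1) x := (hf.continuousAt (hnb _ h1)).comp continuousAt_fst
        exact continuousAt_const.add (e1.div (continuousAt_snd.sub e2) (hne x hvx h1))
      apply h2.congr
      filter_upwards [continuousAt_fst.eventually (isOpen_ball.mem_nhds h1)] with y hy
      have hy' : y.1 ∈ ball z1 R := hy
      simp only [F, if_pos hy']
    · have h2 : ∀ᶠ z in 𝓝 x.1, z ∈ ball z1 R → c z = 0 := by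
        by_cases h3 : x.1 ∈ closedBall z1 R
        · have h4 : x.1 ∈ sphere z1 R := by
            rw [mem_sphere]; rw [mem_ball] at h1; rw [mem_closedBall] at h3; linarith
          have h5 : g x.1 < -τ := by
            have : g x.1 ≤ -2 * τ := hs _ h4
            linarith
          have h6 := (hgc x.1 h3).eventually (gt_mem_nhds h5)
          rw [eventually_nhdsWithin_iff] at h6
          filter_upwards [h6] with z hz hzb
          have := hz (ball_subset_closedBall hzb)
          simp only [hc]
          rw [max_eq_left (by linarith)]
          simp
        · filter_upwards [isClosed_closedBall.isOpen_compl.mem_nhds h3] with z hz hzb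
          exact absurd (ball_subset_closedBall hzb) hz
      apply (continuousAt_const (y := (1:ℂ))).congr
      filter_upwards [continuousAt_fst.eventually h2] with y hy
      by_cases h3 : y.1 ∈ ball z1 R
      · simp only [F, if_pos h3, hy h3]; simp
      · simp only [F, if_neg h3]) (by
    intro x hx hvx
    by_cases h1 : x.1 ∈ ball z1 R
    · simp only [F, if_pos h1]
      have h2 := hne x hvx h1
      have hcb := ball_subset_closedBall h1
      intro h3
      have h4 : x.2 = f x.1 - c x.1 := by
        field_simp at h3
        linear_combination h3
      have hκ : g x.1 + τ > 0 := by
        by_contra h5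
        apply h2
        have : c x.1 = 0 := by
          simp only [hc]; rw [max_eq_left (by linarith)]; simp
        rw [h4, this]; ring
      have hcH : c x.1 * H.eval x.1 = ((g x.1 + τ : ℝ) : ℂ) := by
        simp only [hc]; rw [max_eq_right hκ.le, div_mul_cancel₀ _ (hH _ hcb)]
      have := hvτ x ⟨hcb, by
        rw [mem_closedBall, dist_zero_right, h4]
        have := norm_sub_le (f x.1) (c x.1)
        have := hMf _ hcb
        have := hMc _ hcb
        linarith⟩ (by
        have e : x.2 * H.eval x.1 + p.eval x.1 = (f x.1 * H.eval x.1 + p.eval x.1) - ((g x.1 + τ : ℝ) : ℂ) := by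
          rw [h4, ← hcH]; ring
        rw [e, Complex.sub_re, Complex.ofReal_re]
        simp only [hg]
        linarith)
      linarith
    · simp only [F, if_neg h1]; exact one_ne_zero) (by
    intro x hx hvx
    by_cases h1 : x.1 ∈ ball z1 R
    · simp only [F, if_pos h1]
      have hcb := ball_subset_closedBall h1
      have h2 : ρ < ‖x.2‖ := by
        by_contra h
        push Not at h
        have := hvT x ⟨hcb, by rw [mem_closedBall, dist_zero_right]; exact h⟩
        linarith
      have h3 : ‖c x.1‖ < ‖x.2 - f x.1‖ := by
        have := norm_sub_norm_le x.2 (f x.1)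
        have := hMf _ hcb
        have := hMc _ hcb
        linarith
      have h4 : ‖c x.1 / (x.2 - f x.1)‖ < 1 := by
        rw [norm_div, div_lt_one ((norm_nonneg _).trans_lt h3)]; exact h3
      have := (abs_lt.1 ((Complex.abs_re_le_norm _).trans_lt h4)).1
      simp only [Complex.add_re, Complex.one_re]
      linarith
    · simp only [F, if_neg h1]; simp)
  -- the circle
  let φ : ℂ → ℂ × ℂ := fun ζ => (z0, f z0 + s * ζ)
  have hφc : Continuous φ := by fun_prop
  have hφm : ∀ ζ ∈ sphere (0:ℂ) 1, φ ζ ∈ (ball z1 (R + 2) ×ˢ ball (0:ℂ) (ρ + 2)) ∧ 0 < v (φ ζ) := by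
    intro ζ hζ
    have hζ1 : ‖ζ‖ = 1 := by simpa using hζ
    have hn : ‖f z0 + s * ζ‖ ≤ ρ := by
      refine (norm_add_le _ _).trans ?_
      rw [norm_mul, hζ1, Complex.norm_real, Real.norm_of_nonneg hsp.le]
      have := hMf _ hz0c
      linarith
    refine ⟨⟨ball_subset_ball (by linarith) hz0b, ?_⟩, ?_⟩
    · rw [mem_ball, dist_zero_right]; show ‖f z0 + s * ζ‖ < _; linarith
    · apply hvB (φ ζ) ⟨hz0c, by rw [mem_closedBall, dist_zero_right]; exact hn⟩
      · apply hsB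
        rw [mem_sphere, dist_eq_norm, add_sub_cancel_left, norm_mul, hζ1, Complex.norm_real, Real.norm_of_nonneg hsp.le, mul_one]
      · simp only [φ]
        have e : (f z0 + s * ζ) * H.eval z0 + p.eval z0 = (f z0 * H.eval z0 + p.eval z0) + s * ζ * H.eval z0 := by ring
        rw [e, Complex.add_re]
        have h1 : ‖s * ζ * H.eval z0‖ ≤ g z0 / 2 := by
          rw [norm_mul, norm_mul, hζ1, Complex.norm_real, Real.norm_of_nonneg hsp.le, mul_one]
          have : s2 * ‖H.eval z0‖ = g z0 / 2 := by rw [hs2]; field_simp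
          rw [← this]
          gcongr
        have h2 := (abs_le.1 ((Complex.abs_re_le_norm _).trans h1)).1
        have : (f z0 * H.eval z0 + p.eval z0).re = g z0 := rfl
        linarith
  set K : ℂ := c z0 / s with hKdef
  have hsC : (s:ℂ) ≠ 0 := by exact_mod_cast hsp.ne'
  have hK1 : 1 < ‖K‖ := by
    rw [hKdef, norm_div, Complex.norm_real, Real.norm_of_nonneg hsp.le, one_lt_div hsp]
    simp only [hc]
    rw [norm_div, Complex.norm_real, Real.norm_of_nonneg (le_max_left _ _), max_eq_right (by linarith), lt_div_iff₀ hH0]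
    have : s2 * ‖H.eval z0‖ = g z0 / 2 := by rw [hs2]; field_simp
    have : s * ‖H.eval z0‖ ≤ s2 * ‖H.eval z0‖ := by gcongr
    linarith
  have hK0 : K ≠ 0 := by intro h; rw [h] at hK1; simp at hK1; linarith
  have hsmall : ∀ ζ ∈ sphere (0:ℂ) 1, 0 < (1 + ζ / K).re := by
    intro ζ hζ
    have hζ1 : ‖ζ‖ = 1 := by simpa using hζ
    have : ‖ζ / K‖ < 1 := by rw [norm_div, hζ1, div_lt_one (by linarith)]; exact hK1
    have := (abs_lt.1 ((Complex.abs_re_le_norm _).trans_lt this)).1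
    simp only [Complex.add_re, Complex.one_re]
    linarith
  apply no_circle_log (l := fun ζ => Complex.log (1 + ζ / K) + Complex.log K - l (φ ζ))
  · apply ContinuousOn.sub
    · apply ContinuousOn.add _ continuousOn_const
      apply ContinuousOn.clog (by fun_prop)
      intro ζ hζ
      exact Or.inl (hsmall ζ hζ)
    · exact hlc.comp hφc.continuousOn (fun ζ hζ => hφm ζ hζ)
  · intro ζ hζ
    have hζ0 : ζ ≠ 0 := by
      intro h; rw [h] at hζ; simp at hζ
    have h1 : 1 + ζ / K ≠ 0 := by
      intro h
      have := hsmall ζ hζ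
      rw [h] at this
      simp at this
    rw [Complex.exp_sub, Complex.exp_add, Complex.exp_log h1, Complex.exp_log hK0, hle _ (hφm ζ hζ).1 (hφm ζ hζ).2]
    have hF : F (φ ζ) = 1 + K / ζ := by
      have : (φ ζ).1 ∈ ball z1 R := hz0b
      simp only [F, if_pos this]
      simp only [φ, hKdef]
      field_simp
      ring
    rw [hF]
    have h2 : K + ζ ≠ 0 := by
      intro h
      apply h1
      field_simp
      linear_combination h
    have h3 : 1 + K / ζ ≠ 0 := by
      intro h
      apply h2
      field_simp at h
      linear_combination h
    rw [div_eq_iff h3]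
    field_simp
    ring

theorem thmG {u : ℂ × ℂ → EReal} (hu : Psh2 u) {q0 : ℂ × ℂ} (hq : u q0 ≠ ⊥) {z1 : ℂ} {R : ℝ} (hR : 0 < R) {f : ℂ → ℂ}
    (hf : ContinuousOn f (closedBall z1 R)) (hfu : ∀ z ∈ closedBall z1 R, u (z, f z) = ⊥) (H p : ℂ[X])
    (hH : ∀ z ∈ closedBall z1 R, H.eval z ≠ 0) 
    (hs : ∀ z ∈ sphere z1 R, (f z * H.eval z + p.eval z).re ≤ 0) : ∀ z ∈ closedBall z1 R, (f z * H.eval z + p.eval z).re ≤ 0 := by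
  intro zs hzs
  by_contra hcon
  push Not at hcon
  set m := (f zs * H.eval zs + p.eval zs).re with hm
  refine G_core hu hq hR hf hfu H (p - C ((m / 2 : ℝ) : ℂ)) hH (τ := m / 4) (by linarith) ?_ hzs ?_
  · intro z hz
    have := hs z hz
    rw [eval_sub, eval_C, ← add_sub_assoc, Complex.sub_re, Complex.ofReal_re]
    linarith
  · rw [eval_sub, eval_C, ← add_sub_assoc, Complex.sub_re, Complex.ofReal_re]
    linarith

end part10

section part11
open Filter Topology
/-- maximum principle for all `Re (f H + p)` -/
def MaxP (f : ℂ → ℂ) (c : ℂ) (r : ℝ) : Prop := ∀ H p : ℂ[X], (∀ z ∈ closedBall c r, H.eval z ≠ 0) → 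
  (∀ z ∈ sphere c r, (f z * H.eval z + p.eval z).re ≤ 0) → ∀ z ∈ closedBall c r, (f z * H.eval z + p.eval z).re ≤ 0

lemma maxP_harm {F : ℂ → ℂ} (hM : MaxP F 0 1) (H P Q : ℂ[X]) (hH : ∀ z ∈ closedBall (0:ℂ) 1, H.eval z ≠ 0) {e : ℝ} 
    (h : ∀ z ∈ sphere (0:ℂ) 1, ‖F z * H.eval z - (P.eval z + (starRingEnd ℂ) (Q.eval z))‖ ≤ e) : 
    ∀ z ∈ closedBall (0:ℂ) 1, ‖F z * H.eval z - (P.eval z + (starRingEnd ℂ) (Q.eval z))‖ ≤ 2 * e := by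
  have key : ∀ u : ℂ, ‖u‖ = 1 → ∀ z ∈ closedBall (0:ℂ) 1, (u * (F z * H.eval z - (P.eval z + (starRingEnd ℂ) (Q.eval z)))).re ≤ e := by
    intro u hu z hz
    have e1 : ∀ z, (F z * (C u * H).eval z + (-(C u * P) - C ((starRingEnd ℂ) u) * Q - C (e:ℂ)).eval z).re = 
        (u * (F z * H.eval z - (P.eval z + (starRingEnd ℂ) (Q.eval z)))).re - e := by
      intro z
      simp
      ring
    have hu0 : u ≠ 0 := by intro h; rw [h] at hu; simp at hu
    have := hM (C u * H) (-(C u * P) - C ((starRingEnd ℂ) u) * Q - C (e:ℂ)) (by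
      intro z hz
      rw [eval_mul, eval_C]
      exact mul_ne_zero hu0 (hH z hz)) (by
      intro z hz
      rw [e1]
      have h1 := Complex.re_le_norm (u * (F z * H.eval z - (P.eval z + (starRingEnd ℂ) (Q.eval z))))
      rw [norm_mul, hu, one_mul] at h1
      linarith [h z hz]) z hz
    rw [e1] at this
    linarith
  intro z hz
  have h1 := key 1 (by simp) z hz
  have h2 := key (-1) (by simp) z hz
  have h3 := key Complex.I (by simp) z hz
  have h4 := key (-Complex.I) (by simp) z hz
  set X := F z * H.eval z - (P.eval z + (starRingEnd ℂ) (Q.eval z))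
  simp only [one_mul, neg_mul, Complex.neg_re, Complex.I_mul_re] at h1 h2 h3 h4
  have := Complex.norm_le_abs_re_add_abs_im X
  have a1 : |X.re| ≤ e := abs_le.2 ⟨by linarith, h1⟩
  have a2 : |X.im| ≤ e := abs_le.2 ⟨by linarith, by linarith⟩
  linarith

lemma maxP_approx {F : ℂ → ℂ} (hF : ContinuousOn F (closedBall 0 1)) (hM : MaxP F 0 1) {ε : ℝ} (hε : 0 < ε) : 
    ∃ A : ℂ[X], ∀ z ∈ ball (0:ℂ) 1, ‖F z - A.eval z‖ ≤ 2 * ε + 12 * ε / (1 - ‖z‖ ^ 2) := by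
  obtain ⟨A, C1, hA⟩ := trig_approx (f := F) (c := 0) (r := 1) one_pos (hF.mono sphere_subset_closedBall) hε
  refine ⟨A, fun z hz => ?_⟩
  have hzc := ball_subset_closedBall hz
  have hz1 : ‖z‖ < 1 := by simpa using hz
  have h1 := maxP_harm hM 1 A (X * C1) (by simp) (e := ε) (by
    intro z hz
    have := hA z hz
    simpa using this.le) z hzc
  have h2 := maxP_harm hM (C 2 + X) ((C 2 + X) * A) ((C 2 * X + 1) * C1) (by
    intro z hz h
    simp at h hz
    have : z = -2 := by linear_combination h
    rw [this] at hz
    norm_num at hz) (e := 3 * ε) (by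
    intro z hz
    have h3 := (hA z hz).le
    have hz1 : ‖z‖ = 1 := by simpa using hz
    have hzz : z * (starRingEnd ℂ) z = 1 := by
      rw [Complex.mul_conj, Complex.normSq_eq_norm_sq, hz1]; simp
    have e1 : F z * (C 2 + X : ℂ[X]).eval z - (((C 2 + X) * A : ℂ[X]).eval z + (starRingEnd ℂ) (((C 2 * X + 1) * C1 : ℂ[X]).eval z)) = 
        (2 + z) * (F z - (A.eval z + (starRingEnd ℂ) (z * C1.eval z))) := by
      have h22 : (starRingEnd ℂ) (2:ℂ) = 2 := map_ofNat _ 2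
      simp [h22]
      linear_combination ((starRingEnd ℂ) (eval z C1)) * hzz
    rw [e1, norm_mul]
    have h4 : ‖2 + z‖ ≤ 3 := by
      refine (norm_add_le _ _).trans ?_
      rw [hz1]; norm_num
    have h5 : ‖F z - (A.eval z + (starRingEnd ℂ) (z * C1.eval z))‖ ≤ ε := by simpa using h3
    gcongr) z hzc
  have hpos : 0 < 1 - ‖z‖ ^ 2 := by nlinarith [norm_nonneg z]
  have h3 : ‖C1.eval z‖ * (1 - ‖z‖ ^ 2) ≤ 12 * ε := by
    have e1 : (starRingEnd ℂ) (C1.eval z) * ((1 - ‖z‖ ^ 2 : ℝ) : ℂ) = 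
      (2 + z) * (F z * (1 : ℂ[X]).eval z - (A.eval z + (starRingEnd ℂ) ((X * C1).eval z))) - 
        (F z * (C 2 + X : ℂ[X]).eval z - (((C 2 + X) * A : ℂ[X]).eval z + (starRingEnd ℂ) (((C 2 * X + 1) * C1 : ℂ[X]).eval z))) := by
      have hzz : ((‖z‖ ^ 2 : ℝ) : ℂ) = z * (starRingEnd ℂ) z := by
        rw [Complex.mul_conj, Complex.normSq_eq_norm_sq]
      rw [Complex.ofReal_sub, hzz]
      have h22 : (starRingEnd ℂ) (2:ℂ) = 2 := map_ofNat _ 2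
      simp [h22]
      ring
    have e2 := congrArg norm e1
    rw [norm_mul, RCLike.norm_conj, Complex.norm_real, Real.norm_of_nonneg hpos.le] at e2
    rw [e2]
    refine (norm_sub_le _ _).trans ?_
    rw [norm_mul]
    have h4 : ‖2 + z‖ ≤ 3 := by
      refine (norm_add_le _ _).trans ?_
      norm_num; linarith
    have : ‖2 + z‖ * ‖F z * (1 : ℂ[X]).eval z - (A.eval z + (starRingEnd ℂ) ((X * C1).eval z))‖ ≤ 3 * (2 * ε) := by gcongr
    linarith
  have h4 : ‖C1.eval z‖ ≤ 12 * ε / (1 - ‖z‖ ^ 2) := by rw [le_div_iff₀ hpos]; exact h3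
  have e3 : F z - A.eval z = (F z * (1 : ℂ[X]).eval z - (A.eval z + (starRingEnd ℂ) ((X * C1).eval z))) + (starRingEnd ℂ) (z * C1.eval z) := by
    simp
    ring
  rw [e3]
  refine (norm_add_le _ _).trans (add_le_add h1 ?_)
  rw [RCLike.norm_conj, norm_mul]
  refine le_trans ?_ h4
  nlinarith [norm_nonneg (C1.eval z)]

lemma maxP_unit {F : ℂ → ℂ} (hF : ContinuousOn F (closedBall 0 1)) (hM : MaxP F 0 1) : DifferentiableOn ℂ F (ball 0 1) := by
  choose A hA using fun n : ℕ => maxP_approx hF hM (ε := 1 / ((n:ℝ) + 1)) (by positivity)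
  have : TendstoLocallyUniformlyOn (fun n z => (A n).eval z) F atTop (ball 0 1) := by
    rw [Metric.tendstoLocallyUniformlyOn_iff]
    intro ε hε x hx
    have hx1 : ‖x‖ < 1 := by simpa using hx
    set d := (1 - ‖x‖) / 2 with hd
    have hdp : 0 < d := by rw [hd]; linarith
    refine ⟨ball x d, mem_nhdsWithin_of_mem_nhds (ball_mem_nhds x hdp), ?_⟩
    have ht : Tendsto (fun n : ℕ => (2 + 12 / d) * (1 / ((n:ℝ) + 1))) atTop (𝓝 ((2 + 12 / d) * 0)) := 
      tendsto_one_div_add_atTop_nhds_zero_nat.const_mul _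
    rw [mul_zero] at ht
    filter_upwards [ht.eventually (gt_mem_nhds hε)] with n hn y hy
    have hyd : ‖y‖ < 1 - d := by
      rw [mem_ball, dist_eq_norm] at hy
      have : ‖y‖ ≤ ‖y - x‖ + ‖x‖ := by simpa using norm_add_le (y - x) x
      linarith
    have h1 := hA n y (by simp; linarith)
    rw [dist_eq_norm]
    refine h1.trans_lt (lt_of_le_of_lt ?_ hn)
    have h2 : d ≤ 1 - ‖y‖ ^ 2 := by nlinarith [norm_nonneg y]
    have h3 : 12 * (1 / ((n:ℝ) + 1)) / (1 - ‖y‖ ^ 2) ≤ 12 * (1 / ((n:ℝ) + 1)) / d := by gcongr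
    have h4 : (2 + 12 / d) * (1 / ((n:ℝ) + 1)) = 2 * (1 / ((n:ℝ) + 1)) + 12 * (1 / ((n:ℝ) + 1)) / d := by ring
    linarith
  exact this.differentiableOn (Eventually.of_forall fun n => (A n).differentiable.differentiableOn) isOpen_ball

theorem lemH {f : ℂ → ℂ} {c : ℂ} {r : ℝ} (hr : 0 < r) (hf : ContinuousOn f (closedBall c r)) (hM : MaxP f c r) : 
    DifferentiableOn ℂ f (ball c r) := by
  have hrC : (r:ℂ) ≠ 0 := by exact_mod_cast hr.ne'
  have hmc : ∀ ζ ∈ closedBall (0:ℂ) 1, c + r * ζ ∈ closedBall c r := by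
    intro ζ hζ
    have : ‖ζ‖ ≤ 1 := by simpa using hζ
    simp [abs_of_pos hr]
    nlinarith
  have hz : ∀ z, c + r * ((z - c) / r) = z := fun z => by field_simp; ring
  have hms : ∀ z ∈ sphere c r, (z - c) / r ∈ sphere (0:ℂ) 1 := by
    intro z hz
    rw [mem_sphere, dist_eq_norm] at hz
    simp [hz, abs_of_pos hr, hr.ne']
  have hmi : ∀ z ∈ closedBall c r, (z - c) / r ∈ closedBall (0:ℂ) 1 := by
    intro z hz
    rw [mem_closedBall, dist_eq_norm] at hz
    simp [abs_of_pos hr]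
    rw [div_le_one hr]; exact hz
  have hmb : ∀ z ∈ ball c r, (z - c) / r ∈ ball (0:ℂ) 1 := by
    intro z hz
    rw [mem_ball, dist_eq_norm] at hz
    simp [abs_of_pos hr]
    rw [div_lt_one hr]; exact hz
  have hF := maxP_unit (F := fun ζ => f (c + r * ζ)) (hf.comp (by fun_prop) hmc) (by
    intro H p hH hs ζ hζ
    let S : ℂ[X] := C ((r:ℂ)⁻¹) * (X - C c)
    have hS : ∀ z, S.eval z = (z - c) / r := fun z => by simp [S]; field_simp
    have := hM (H.comp S) (p.comp S) (by
      intro z hz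
      rw [eval_comp, hS]
      exact hH _ (hmi z hz)) (by
      intro z hz'
      rw [eval_comp, eval_comp, hS]
      have := hs _ (hms z hz')
      simp only [hz] at this
      exact this) (c + r * ζ) (hmc ζ hζ)
    rw [eval_comp, eval_comp, hS, add_sub_cancel_left, mul_div_cancel_left₀ _ hrC] at this
    exact this)
  have h2 : DifferentiableOn ℂ (fun z => (fun ζ => f (c + r * ζ)) ((z - c) / r)) (ball c r) := 
    hF.comp (by fun_prop) hmb
  exact h2.congr (fun z _ => by simp only [hz])

end part11

section part12
open Filter Topology
lemma rado_maxmod {h : ℂ → ℂ} {c : ℂ} {r S : ℝ} (hc : ContinuousOn h (closedBall c r))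
    (hd : ∀ z ∈ ball c r, h z ≠ 0 → DifferentiableAt ℂ h z) (hS : 0 ≤ S)
    (hs : ∀ z ∈ sphere c r, ‖h z‖ ≤ S) : ∀ z ∈ closedBall c r, ‖h z‖ ≤ S := by
  intro z hz
  by_cases hzs : z ∈ sphere c r
  · exact hs z hzs
  by_cases hz0 : h z = 0
  · rw [hz0]; simpa using hS
  have hzb : z ∈ ball c r := by
    rw [← ball_union_sphere] at hz
    exact hz.resolve_right hzs
  set U : Set ℂ := ball c r ∩ h ⁻¹' {0}ᶜ with hU
  have hUo : IsOpen U := (hc.mono ball_subset_closedBall).isOpen_inter_preimage isOpen_ball isOpen_compl_singleton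
  have hUc : closure U ⊆ closedBall c r :=
    closure_minimal (inter_subset_left.trans ball_subset_closedBall) isClosed_closedBall
  refine Complex.norm_le_of_forall_mem_frontier_norm_le (U := U) (isBounded_ball.subset inter_subset_left)
    ⟨fun x hx => (hd x hx.1 hx.2).differentiableWithinAt, hc.mono hUc⟩ ?_ (subset_closure ⟨hzb, hz0⟩)
  intro x hx
  rw [hUo.frontier_eq] at hx
  have hxc := hUc hx.1
  rw [← ball_union_sphere] at hxc
  rcases hxc with h1 | h1
  · have : h x = 0 := by
      by_contra h2
      exact hx.2 ⟨h1, h2⟩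
    rw [this]; simpa using hS
  · exact hs x h1

lemma rado_maxP {σ : ℂ → ℂ} {c : ℂ} {r : ℝ} (hc : ContinuousOn σ (closedBall c r))
    (hd : ∀ z ∈ ball c r, σ z ≠ 0 → DifferentiableAt ℂ σ z) : MaxP σ c r := by
  intro H p _ hs
  set g : ℂ → ℂ := fun z => Complex.exp (σ z * H.eval z + p.eval z) with hg
  have hgn : ∀ z, ‖g z‖ = Real.exp (σ z * H.eval z + p.eval z).re := fun z => Complex.norm_exp _
  have hgc : ContinuousOn g (closedBall c r) := by
    apply Complex.continuous_exp.comp_continuousOn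
    exact (hc.mul H.continuous.continuousOn).add p.continuous.continuousOn
  have hgd : ∀ z, DifferentiableAt ℂ σ z → DifferentiableAt ℂ g z := by
    intro z h
    exact ((h.mul H.differentiable.differentiableAt).add p.differentiable.differentiableAt).cexp
  have hgs : ∀ z ∈ sphere c r, ‖g z‖ ≤ 1 := by
    intro z hz
    rw [hgn, Real.exp_le_one_iff]; exact hs z hz
  obtain ⟨S, hS⟩ := (isCompact_sphere c r).exists_bound_of_continuousOn (hc.mono sphere_subset_closedBall)
  have hS' : ∀ z ∈ sphere c r, ‖σ z‖ ≤ max S 0 := fun z hz => (hS z hz).trans (le_max_left _ _)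
  have h1 : ∀ z ∈ closedBall c r, σ z ≠ 0 → ‖g z‖ ≤ 1 := by
    intro z hz h0
    by_contra hlt
    push Not at hlt
    have hb : ∀ n : ℕ, ‖g z‖ ^ n ≤ max S 0 / ‖σ z‖ := by
      intro n
      rw [le_div_iff₀ (norm_pos_iff.2 h0)]
      have := rado_maxmod (h := fun z => g z ^ n * σ z) (c := c) (r := r) (S := max S 0) ((hgc.pow n).mul hc)
        (by
          intro x hx hx0
          have : σ x ≠ 0 := fun h => hx0 (by simp [h])
          exact ((hgd x (hd x hx this)).pow n).mul (hd x hx this)) (le_max_right _ _) (by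
          intro x hx
          rw [norm_mul, norm_pow]
          calc ‖g x‖ ^ n * ‖σ x‖ ≤ 1 * ‖σ x‖ := by
                gcongr
                exact pow_le_one₀ (norm_nonneg _) (hgs x hx)
            _ ≤ _ := by rw [one_mul]; exact hS' x hx) z hz
      simpa [norm_mul, norm_pow] using this
    obtain ⟨n, hn⟩ := pow_unbounded_of_one_lt (max S 0 / ‖σ z‖) hlt
    exact absurd (hb n) (not_le.2 hn)
  have main : ∀ z ∈ closedBall c r, ‖g z‖ ≤ 1 := by
    set T : Set ℂ := {z | z ∈ closedBall c r ∧ ‖g z‖ ≤ 1} with hT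
    have hTcl : IsClosed T := by
      have := hgc.norm.preimage_isClosed_of_isClosed isClosed_closedBall (isClosed_Iic (a := (1:ℝ)))
      exact this
    set W : Set ℂ := ball c r \ T with hW
    have hWo : IsOpen W := isOpen_ball.sdiff hTcl
    have hW0 : ∀ x ∈ W, σ x = 0 := by
      intro x hx
      by_contra h0
      exact hx.2 ⟨ball_subset_closedBall hx.1, h1 x (ball_subset_closedBall hx.1) h0⟩
    have hWc : closure W ⊆ closedBall c r :=
      closure_minimal (diff_subset.trans ball_subset_closedBall) isClosed_closedBall
    intro z hz
    by_contra hlt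
    have hzW : z ∈ W := by
      refine ⟨?_, fun h => hlt h.2⟩
      rw [← ball_union_sphere] at hz
      exact hz.resolve_right (fun h => hlt (hgs z h))
    apply hlt
    refine Complex.norm_le_of_forall_mem_frontier_norm_le (U := W) (isBounded_ball.subset diff_subset)
      ⟨fun x hx => (hgd x ?_).differentiableWithinAt, hgc.mono hWc⟩ ?_ (subset_closure hzW)
    · have : σ =ᶠ[𝓝 x] fun _ => 0 := by
        filter_upwards [hWo.mem_nhds hx] with y hy using hW0 y hy
      exact this.differentiableAt_iff.2 (differentiableAt_const _)
    · intro x hx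
      rw [hWo.frontier_eq] at hx
      have hxc := hWc hx.1
      by_contra h2
      apply hx.2
      refine ⟨?_, fun h => h2 h.2⟩
      rw [← ball_union_sphere] at hxc
      exact hxc.resolve_right (fun h => h2 (hgs x h))
  intro z hz
  have := main z hz
  rwa [hgn, Real.exp_le_one_iff] at this

/-- Rado's theorem on an open ball. -/
lemma rado {σ : ℂ → ℂ} {c : ℂ} {r : ℝ} (hc : ContinuousOn σ (ball c r))
    (hd : ∀ z ∈ ball c r, σ z ≠ 0 → DifferentiableAt ℂ σ z) : DifferentiableOn ℂ σ (ball c r) := by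
  intro z hz
  obtain ⟨ε, hε, hsub⟩ := nhds_basis_closedBall.mem_iff.1 (isOpen_ball.mem_nhds hz)
  have := lemH hε (hc.mono hsub) (rado_maxP (hc.mono hsub) fun x hx => hd x (hsub (ball_subset_closedBall hx)))
  exact (this.differentiableAt (ball_mem_nhds z hε)).differentiableWithinAt

/-- continuous, holomorphic off the zero set of a nontrivial σ -/
lemma rado_removable {σ a : ℂ → ℂ} {c : ℂ} {r : ℝ} (hc : ContinuousOn σ (ball c r))
    (hd : ∀ z ∈ ball c r, σ z ≠ 0 → DifferentiableAt ℂ σ z) {z0 : ℂ} (hz0 : z0 ∈ ball c r) (hσ : σ z0 ≠ 0)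
    (ha : ContinuousOn a (ball c r)) (had : ∀ z ∈ ball c r, σ z ≠ 0 → DifferentiableAt ℂ a z) :
    DifferentiableOn ℂ a (ball c r) := by
  have hσd := rado hc hd
  have hσa : AnalyticOnNhd ℂ σ (ball c r) := hσd.analyticOnNhd isOpen_ball
  intro z hz
  have hev : ∀ᶠ w in 𝓝[≠] z, σ w ≠ 0 := by
    rcases (hσa z hz).eventually_eq_zero_or_eventually_ne_zero with h | h
    · exact absurd (hσa.eqOn_zero_of_preconnected_of_eventuallyEq_zero (convex_ball c r).isPreconnected hz h hz0) hσ
    · exact h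
  have hev2 : ∀ᶠ w in 𝓝[≠] z, DifferentiableAt ℂ a w := by
    filter_upwards [hev, nhdsWithin_le_nhds (isOpen_ball.mem_nhds hz)] with w h1 h2 using had w h2 h1
  exact (Complex.analyticAt_of_differentiable_on_punctured_nhds_of_continuousAt hev2
    (ha.continuousAt (isOpen_ball.mem_nhds hz))).differentiableAt.differentiableWithinAt

end part12

section part13
open Filter Topology
lemma finset_sep (Z : Finset ℂ) : ∃ ε > 0, ∀ x ∈ Z, ∀ y ∈ Z, x ≠ y → 2 * ε < dist x y := by
  have : ∀ᶠ ε in 𝓝[>] (0:ℝ), ∀ x ∈ Z, ∀ y ∈ Z, x ≠ y → 2 * ε < dist x y := by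
    rw [Finset.eventually_all]; intro x _
    rw [Finset.eventually_all]; intro y _
    by_cases h : x = y
    · simp [h]
    · have h1 : 0 < dist x y := dist_pos.2 h
      have h2 : Tendsto (fun ε : ℝ => 2 * ε) (𝓝[>] 0) (𝓝 0) := by
        have : Tendsto (fun ε : ℝ => 2 * ε) (𝓝 0) (𝓝 (2 * 0)) := tendsto_id.const_mul 2
        rw [mul_zero] at this
        exact this.mono_left nhdsWithin_le_nhds
      filter_upwards [h2.eventually (gt_mem_nhds h1)] with ε hε _ using hε
  obtain ⟨ε, h1, h2⟩ := (this.and self_mem_nhdsWithin).exists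
  exact ⟨ε, h2, h1⟩

lemma branches {B : Set ℂ} (hBo : IsOpen B) {Z : ℂ → Finset ℂ}
    (hA : ∀ z0 ∈ B, ∀ l ∈ Z z0, ∀ ε > 0, ∀ᶠ z in 𝓝 z0, ∃ μ ∈ Z z, dist μ l < ε)
    {z0 : ℂ} (hz0 : z0 ∈ B) (hmax : ∀ z ∈ B, (Z z).card ≤ (Z z0).card) :
    ∃ f : ℂ → ℂ → ℂ, ∃ r > 0, closedBall z0 r ⊆ B ∧ (∀ l ∈ Z z0, ContinuousOn (f l) (closedBall z0 r)) ∧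
      (∀ z ∈ closedBall z0 r, Z z = (Z z0).image (fun l => f l z) ∧ InjOn (fun l => f l z) (Z z0)) ∧
      ∀ l ∈ Z z0, f l z0 = l := by
  obtain ⟨ε, hε, hsep⟩ := finset_sep (Z z0)
  have hsep2 : ∀ x ∈ Z z0, ∀ y ∈ Z z0, ∀ w, dist w x < ε → dist w y < ε → x = y := by
    intro x hx y hy w h1 h2
    by_contra h
    have := hsep x hx y hy h
    have h3 := dist_triangle_left x y w
    linarith
  have hev : ∀ᶠ z in 𝓝 z0, z ∈ B ∧ ∀ l ∈ Z z0, ∃ μ ∈ Z z, dist μ l < ε := by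
    refine Filter.Eventually.and (hBo.mem_nhds hz0) ?_
    rw [Finset.eventually_all]
    intro l hl
    exact hA z0 hz0 l hl ε hε
  obtain ⟨R, hR, hball⟩ := Metric.eventually_nhds_iff_ball.1 hev
  classical
  set f : ℂ → ℂ → ℂ := fun l z => if h : ∃ μ ∈ Z z, dist μ l < ε then h.choose else 0 with hf
  have hfs : ∀ z ∈ ball z0 R, ∀ l ∈ Z z0, f l z ∈ Z z ∧ dist (f l z) l < ε := by
    intro z hz l hl
    have h := (hball z hz).2 l hl
    simp only [hf, dif_pos h]
    exact h.choose_spec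
  have hinj : ∀ z ∈ ball z0 R, InjOn (fun l => f l z) (Z z0) := by
    intro z hz x hx y hy hxy
    have h1 := (hfs z hz x hx).2
    have h2 := (hfs z hz y hy).2
    simp only at hxy
    rw [← hxy] at h2
    exact hsep2 x hx y hy _ h1 h2
  have him : ∀ z ∈ ball z0 R, Z z = (Z z0).image (fun l => f l z) := by
    intro z hz
    symm
    apply Finset.eq_of_subset_of_card_le
    · intro w hw
      obtain ⟨l, hl, rfl⟩ := Finset.mem_image.1 hw
      exact (hfs z hz l hl).1
    · rw [Finset.card_image_of_injOn (hinj z hz)]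
      exact hmax z (hball z hz).1
  have huniq : ∀ z ∈ ball z0 R, ∀ l ∈ Z z0, ∀ w ∈ Z z, dist w l < ε → w = f l z := by
    intro z hz l hl w hw hwl
    rw [him z hz] at hw
    obtain ⟨l', hl', rfl⟩ := Finset.mem_image.1 hw
    have := hsep2 l hl l' hl' _ hwl (hfs z hz l' hl').2
    rw [this]
  have hsub : closedBall z0 (R / 2) ⊆ ball z0 R := closedBall_subset_ball (by linarith)
  refine ⟨f, R / 2, by positivity, fun z hz => (hball z (hsub hz)).1, ?_, fun z hz => ⟨him z (hsub hz), hinj z (hsub hz)⟩, ?_⟩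
  · intro l hl z1 hz1
    have hz1 := hsub hz1
    apply ContinuousAt.continuousWithinAt
    rw [Metric.continuousAt_iff']
    intro η hη
    have h1 := hfs z1 hz1 l hl
    have hη' : 0 < min η (ε - dist (f l z1) l) := lt_min hη (by linarith [h1.2])
    filter_upwards [hA z1 (hball z1 hz1).1 _ h1.1 _ hη', isOpen_ball.mem_nhds hz1] with z hz hzb
    obtain ⟨μ, hμ, hd⟩ := hz
    have h2 := hd.trans_le (min_le_left _ _)
    have h3 := hd.trans_le (min_le_right _ _)
    have h4 := dist_triangle μ (f l z1) l
    rw [← huniq z hzb l hl μ hμ (by linarith)]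
    exact h2
  · intro l hl
    exact (huniq z0 (mem_ball_self hR) l hl l hl (by simpa using hε)).symm

/-- discriminant-like function -/
def discr' (Z : Finset ℂ) : ℂ := ∏ p ∈ Z.offDiag, (p.1 - p.2)

lemma discr'_ne (Z : Finset ℂ) : discr' Z ≠ 0 := by
  rw [discr', Finset.prod_ne_zero_iff]
  intro p hp
  exact sub_ne_zero.2 (Finset.mem_offDiag.1 hp).2.2

def sig (Z : ℂ → Finset ℂ) (k : ℕ) (z : ℂ) : ℂ := if (Z z).card = k then discr' (Z z) else 0

lemma sig_ne {Z : ℂ → Finset ℂ} {k : ℕ} {z : ℂ} : sig Z k z ≠ 0 ↔ (Z z).card = k := by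
  unfold sig
  split_ifs with h
  · simp [h, discr'_ne]
  · simp [h]

lemma sig_diff {Z : ℂ → Finset ℂ} {f : ℂ → ℂ → ℂ} {z0 : ℂ} {r : ℝ} (hr : 0 < r)
    (hf : ∀ l ∈ Z z0, DifferentiableAt ℂ (f l) z0)
    (hZ : ∀ z ∈ closedBall z0 r, Z z = (Z z0).image (fun l => f l z) ∧ InjOn (fun l => f l z) (Z z0)) :
    DifferentiableAt ℂ (sig Z (Z z0).card) z0 := by
  have : sig Z (Z z0).card =ᶠ[𝓝 z0] fun z => ∏ p ∈ (Z z0).offDiag, (f p.1 z - f p.2 z) := by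
    filter_upwards [closedBall_mem_nhds z0 hr] with z hz
    obtain ⟨h1, h2⟩ := hZ z hz
    have hc : (Z z).card = (Z z0).card := by rw [h1, Finset.card_image_of_injOn h2]
    rw [sig, if_pos hc, discr']
    symm
    apply Finset.prod_bij (fun p _ => (f p.1 z, f p.2 z))
    · intro p hp
      rw [Finset.mem_offDiag] at hp ⊢
      rw [h1]
      exact ⟨Finset.mem_image_of_mem _ hp.1, Finset.mem_image_of_mem _ hp.2.1, fun h => hp.2.2 (h2 hp.1 hp.2.1 h)⟩
    · intro p hp q hq h
      rw [Finset.mem_offDiag] at hp hq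
      rw [Prod.mk.injEq] at h
      exact Prod.ext (h2 hp.1 hq.1 h.1) (h2 hp.2.1 hq.2.1 h.2)
    · intro q hq
      rw [Finset.mem_offDiag, h1] at hq
      obtain ⟨⟨x, hx, hx'⟩, ⟨y, hy, hy'⟩⟩ := And.intro (Finset.mem_image.1 hq.1) (Finset.mem_image.1 hq.2.1)
      refine ⟨(x, y), Finset.mem_offDiag.2 ⟨hx, hy, ?_⟩, Prod.ext hx' hy'⟩
      rintro h
      apply hq.2.2
      rw [← hx', ← hy']
      simp only at h
      rw [h]
    · intro p hp; rfl
  rw [this.differentiableAt_iff]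
  apply DifferentiableAt.fun_finsetProd
  intro p hp
  rw [Finset.mem_offDiag] at hp
  exact (hf _ hp.1).sub (hf _ hp.2.1)

lemma sig_cont {Z : ℂ → Finset ℂ} {z0 : ℂ} {k : ℕ}
    (hB : ∀ ε > 0, ∀ᶠ z in 𝓝 z0, ∀ μ ∈ Z z, ∃ l ∈ Z z0, dist μ l < ε)
    (hk : (Z z0).card < k) : ContinuousAt (sig Z k) z0 := by
  have h0 : sig Z k z0 = 0 := by rw [sig, if_neg hk.ne]
  obtain ⟨M, hM⟩ : ∃ M, ∀ l ∈ Z z0, ‖l‖ ≤ M := by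
    obtain ⟨M, hM⟩ := ((Z z0).finite_toSet.isCompact).isBounded.exists_norm_le
    exact ⟨M, fun l hl => hM l hl⟩
  set N := max M 0 + 1 with hN
  have hN1 : 1 ≤ N := by rw [hN]; linarith [le_max_right M 0]
  have hMN : M + 1 ≤ N := by rw [hN]; linarith [le_max_left M 0]
  rw [Metric.continuousAt_iff']
  intro η hη
  set K := (2 * N) ^ (k * k) with hK
  have hKp : 0 < K := by positivity
  set ε := min 1 (η / (4 * K)) with hε
  have hεp : 0 < ε := by rw [hε]; positivity
  filter_upwards [hB ε hεp] with z hz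
  rw [h0, dist_zero_right]
  by_cases hc : (Z z).card = k
  swap
  · rw [sig, if_neg hc]; simpa using hη
  rw [sig, if_pos hc]
  classical
  choose! g hg using hz
  obtain ⟨x, hx, y, hy, hxy, hgxy⟩ := Finset.exists_ne_map_eq_of_card_lt_of_maps_to (s := Z z) (t := Z z0) (f := g) (by omega) (fun w hw => (hg w hw).1)
  have hd : dist x y ≤ 2 * ε := by
    have h1 := (hg x hx).2
    have h2 := (hg y hy).2
    rw [← hgxy] at h2
    have := dist_triangle_right x y (g x)
    linarith
  have hbd : ∀ w ∈ Z z, ‖w‖ ≤ N := by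
    intro w hw
    have h1 := hM _ (hg w hw).1
    have h2 := (hg w hw).2
    rw [dist_eq_norm] at h2
    have h3 := norm_le_norm_add_norm_sub' w (g w)
    have : ε ≤ 1 := min_le_left _ _
    linarith
  rw [discr', ← Finset.mul_prod_erase _ _ (Finset.mem_offDiag.2 ⟨hx, hy, hxy⟩ : (x, y) ∈ (Z z).offDiag), norm_mul, norm_prod]
  have h1 : ∏ p ∈ (Z z).offDiag.erase (x, y), ‖p.1 - p.2‖ ≤ K := by
    calc ∏ p ∈ (Z z).offDiag.erase (x, y), ‖p.1 - p.2‖ ≤ ∏ p ∈ (Z z).offDiag.erase (x, y), (2 * N) := by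
          apply Finset.prod_le_prod (fun _ _ => norm_nonneg _)
          intro p hp
          have := Finset.mem_offDiag.1 (Finset.mem_of_mem_erase hp)
          have h1 := hbd _ this.1
          have h2 := hbd _ this.2.1
          have := norm_sub_le p.1 p.2
          linarith
      _ = (2 * N) ^ ((Z z).offDiag.erase (x, y)).card := by rw [Finset.prod_const]
      _ ≤ K := by
          rw [hK]
          apply pow_le_pow_right₀ (by linarith)
          refine (Finset.card_erase_le).trans ?_
          rw [Finset.offDiag_card, hc]
          exact Nat.sub_le _ _
  have h2 : ‖x - y‖ ≤ 2 * ε := by rw [← dist_eq_norm]; exact hd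
  have h3 : ε ≤ η / (4 * K) := min_le_right _ _
  calc ‖x - y‖ * ∏ p ∈ (Z z).offDiag.erase (x, y), ‖p.1 - p.2‖ ≤ (2 * (η / (4 * K))) * K := by
        apply mul_le_mul _ h1 (Finset.prod_nonneg fun _ _ => norm_nonneg _) (by positivity)
        linarith
    _ = η / 2 := by field_simp; ring
    _ < η := by linarith

end part13

section part14
open Filter Topology
def pol {m : ℕ} (c : Fin m → ℂ) : ℂ[X] := X ^ m + ∑ i : Fin m, C (c i) * X ^ (m - ((i : ℕ) + 1))

lemma pol_eval {m : ℕ} (c : Fin m → ℂ) (w : ℂ) :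
    (pol c).eval w = w ^ m + ∑ i : Fin m, c i * w ^ (m - ((i : ℕ) + 1)) := by
  simp [pol, eval_finsetSum]

lemma pol_deg {m : ℕ} (c : Fin m → ℂ) : (∑ i : Fin m, C (c i) * X ^ (m - ((i : ℕ) + 1)) : ℂ[X]).degree < (m : WithBot ℕ) := by
  refine lt_of_le_of_lt (degree_sum_le _ _) ?_
  refine (Finset.sup_lt_iff (WithBot.bot_lt_coe m)).2 ?_
  intro i _
  refine (degree_C_mul_X_pow_le _ _).trans_lt ?_
  have := i.2
  exact WithBot.coe_lt_coe.2 (by omega : m - ((i:ℕ) + 1) < m)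

lemma pol_monic {m : ℕ} (c : Fin m → ℂ) : (pol c).Monic := monic_X_pow_add (pol_deg c)

lemma pol_natDegree {m : ℕ} (c : Fin m → ℂ) : (pol c).natDegree = m := by
  have : (pol c).degree = m := by
    rw [pol, degree_add_eq_left_of_degree_lt]
    · simp
    · simpa using pol_deg c
  exact natDegree_eq_of_degree_eq_some this

lemma pol_coeff {m : ℕ} (c : Fin m → ℂ) (i : Fin m) : (pol c).coeff (m - ((i : ℕ) + 1)) = c i := by
  have hi := i.2
  simp only [pol, coeff_add, coeff_X_pow, finsetSum_coeff, coeff_C_mul]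
  rw [if_neg (by omega), Finset.sum_eq_single i]
  · simp
  · intro j _ hj
    have := j.2
    rw [if_neg, mul_zero]
    intro h
    apply hj
    ext; omega
  · simp

lemma pol_card {m : ℕ} (c : Fin m → ℂ) : (pol c).roots.card = m := by
  rw [IsAlgClosed.card_roots_eq_natDegree, pol_natDegree]

lemma pol_prod {m : ℕ} (c : Fin m → ℂ) : pol c = ((pol c).roots.map (fun r => X - C r)).prod :=
  (IsAlgClosed.splits (pol c)).eq_prod_roots_of_monic (pol_monic c)

lemma mset_far (w : ℂ) {ε : ℝ} (hε : 0 ≤ ε) (s : Multiset ℂ) (h : ∀ l ∈ s, ε ≤ dist w l) :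
    ε ^ s.card ≤ ‖((s.map (fun r => X - C r)).prod : ℂ[X]).eval w‖ := by
  induction s using Multiset.induction_on with
  | empty => simp
  | cons x s ih =>
    simp only [Multiset.card_cons, Multiset.map_cons, Multiset.prod_cons, eval_mul, norm_mul, pow_succ]
    rw [mul_comm]
    have h1 := h x (Multiset.mem_cons_self x s)
    rw [dist_eq_norm] at h1
    apply mul_le_mul (by simpa using h1) (ih fun l hl => h l (Multiset.mem_cons_of_mem hl)) (by positivity) (norm_nonneg _)

lemma pol_near {m : ℕ} (c : Fin m → ℂ) (w : ℂ) {ε : ℝ} (hε : 0 ≤ ε) (h : ‖(pol c).eval w‖ < ε ^ m) :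
    ∃ l ∈ (pol c).roots.toFinset, dist w l < ε := by
  by_contra hcon
  push Not at hcon
  have := mset_far w hε (pol c).roots (fun l hl => hcon l (by simpa using hl))
  rw [← pol_prod, pol_card] at this
  linarith

lemma pol_mem {m : ℕ} (c : Fin m → ℂ) (w : ℂ) : w ∈ (pol c).roots.toFinset ↔ (pol c).eval w = 0 := by
  rw [Multiset.mem_toFinset, mem_roots (pol_monic c).ne_zero, IsRoot.def]

lemma roots_A {m : ℕ} {a : Fin m → ℂ → ℂ} {z0 : ℂ} (ha : ∀ i, ContinuousAt (a i) z0) :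
    ∀ l ∈ (pol (fun i => a i z0)).roots.toFinset, ∀ ε > 0, ∀ᶠ z in 𝓝 z0, ∃ μ ∈ (pol (fun i => a i z)).roots.toFinset, dist μ l < ε := by
  intro l hl ε hε
  rw [pol_mem] at hl
  have hc : ContinuousAt (fun z => ‖(pol (fun i => a i z)).eval l‖) z0 := by
    simp only [pol_eval]
    fun_prop
  have : ∀ᶠ z in 𝓝 z0, ‖(pol (fun i => a i z)).eval l‖ < ε ^ m := by
    apply hc.eventually_lt_const
    simp only [hl, norm_zero]; positivity
  filter_upwards [this] with z hz
  obtain ⟨μ, h1, h2⟩ := pol_near _ l hε.le hz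
  exact ⟨μ, h1, by rwa [dist_comm]⟩

lemma pol_root_bound {m : ℕ} (c : Fin m → ℂ) (w : ℂ) (h : (pol c).eval w = 0) : ‖w‖ ≤ 1 + ∑ i, ‖c i‖ := by
  have hs : 0 ≤ ∑ i, ‖c i‖ := Finset.sum_nonneg fun _ _ => norm_nonneg _
  by_cases hw : ‖w‖ ≤ 1
  · linarith
  push Not at hw
  rcases Nat.eq_zero_or_pos m with rfl | hm
  · simp [pol_eval] at h
  rw [pol_eval] at h
  have h1 : ‖w‖ ^ m ≤ (∑ i, ‖c i‖) * ‖w‖ ^ (m - 1) := by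
    rw [← norm_pow, eq_neg_of_add_eq_zero_left h, norm_neg, Finset.sum_mul]
    refine (norm_sum_le _ _).trans (Finset.sum_le_sum fun i _ => ?_)
    rw [norm_mul, norm_pow]
    gcongr
    · exact hw.le
    · omega
  have h2 : ‖w‖ ^ m = ‖w‖ * ‖w‖ ^ (m - 1) := by
    rw [← pow_succ']; congr 1; omega
  rw [h2] at h1
  have := le_of_mul_le_mul_right h1 (by positivity)
  linarith

lemma roots_B {m : ℕ} {a : Fin m → ℂ → ℂ} {z0 : ℂ} (ha : ∀ i, ContinuousAt (a i) z0) :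
    ∀ ε > 0, ∀ᶠ z in 𝓝 z0, ∀ μ ∈ (pol (fun i => a i z)).roots.toFinset, ∃ l ∈ (pol (fun i => a i z0)).roots.toFinset, dist μ l < ε := by
  intro ε hε
  set R := 2 + ∑ i, ‖a i z0‖ with hR
  have hs : 0 ≤ ∑ i, ‖a i z0‖ := Finset.sum_nonneg fun _ _ => norm_nonneg _
  have h1 : ∀ᶠ z in 𝓝 z0, 1 + ∑ i, ‖a i z‖ < R := by
    have hc : ContinuousAt (fun z => 1 + ∑ i, ‖a i z‖) z0 := by fun_prop
    apply hc.eventually_lt_const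
    rw [hR]; linarith
  have h2 : ∀ᶠ z in 𝓝 z0, ∑ i, ‖a i z0 - a i z‖ * R ^ m < ε ^ m := by
    have hc : ContinuousAt (fun z => ∑ i, ‖a i z0 - a i z‖ * R ^ m) z0 := by fun_prop
    apply hc.eventually_lt_const
    simp; positivity
  filter_upwards [h1, h2] with z hz1 hz2 w hw
  rw [pol_mem] at hw
  apply pol_near _ _ hε.le
  have hwR : ‖w‖ ≤ R := (pol_root_bound _ w hw).trans hz1.le
  refine lt_of_le_of_lt ?_ hz2
  rw [← sub_zero ((pol _).eval w), ← hw, pol_eval, pol_eval, add_sub_add_left_eq_sub, ← Finset.sum_sub_distrib]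
  refine (norm_sum_le _ _).trans (Finset.sum_le_sum fun i _ => ?_)
  rw [← sub_mul, norm_mul, norm_pow]
  gcongr
  calc ‖w‖ ^ (m - ((i:ℕ) + 1)) ≤ R ^ (m - ((i:ℕ) + 1)) := by gcongr
    _ ≤ R ^ m := pow_le_pow_right₀ (by rw [hR]; linarith) (by omega)

lemma coeff_prod_diff {ι : Type*} (s : Finset ι) (Q : ι → ℂ → ℂ[X]) {z0 : ℂ}
    (h : ∀ i ∈ s, ∀ n, DifferentiableAt ℂ (fun z => (Q i z).coeff n) z0) :
    ∀ n, DifferentiableAt ℂ (fun z => (∏ i ∈ s, Q i z).coeff n) z0 := by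
  classical
  induction s using Finset.induction_on with
  | empty => intro n; simp
  | insert i s hi ih =>
    intro n
    simp only [Finset.prod_insert hi, coeff_mul]
    apply DifferentiableAt.fun_sum
    intro p _
    exact (h i (Finset.mem_insert_self _ _) _).mul (ih (fun j hj => h j (Finset.mem_insert_of_mem hj)) _)

lemma coeff_lin_diff {f : ℂ → ℂ} {z0 : ℂ} (hf : DifferentiableAt ℂ f z0) (k : ℕ) :
    ∀ n, DifferentiableAt ℂ (fun z => ((X - C (f z)) ^ k : ℂ[X]).coeff n) z0 := by
  have := coeff_prod_diff (Finset.range k) (fun _ z => (X - C (f z) : ℂ[X])) (z0 := z0) (by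
    intro i _ n
    simp only [coeff_sub, coeff_C]
    split_ifs <;> fun_prop)
  simpa using this

lemma mult_const {m : ℕ} {a : Fin m → ℂ → ℂ} {z0 : ℂ} (ha : ∀ i, ContinuousAt (a i) z0)
    {f : ℂ → ℂ → ℂ} {S : Finset ℂ} (hf : ∀ l ∈ S, ContinuousAt (f l) z0) (hf0 : ∀ l ∈ S, f l z0 = l)
    (hZ : ∀ᶠ z in 𝓝 z0, (pol (fun i => a i z)).roots.toFinset = S.image (fun l => f l z) ∧ InjOn (fun l => f l z) S) :
    ∃ M : S → ℕ, ∀ᶠ z in 𝓝 z0, pol (fun i => a i z) = ∏ l : S, (X - C (f l z)) ^ M l := by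
  classical
  set Mz : ℂ → S → Fin (m + 1) := fun z l => ⟨(pol (fun i => a i z)).roots.count (f l z),
    Nat.lt_succ_of_le ((Multiset.count_le_card _ _).trans (pol_card _).le)⟩ with hMz
  have hprod : ∀ᶠ z in 𝓝 z0, pol (fun i => a i z) = ∏ l : S, (X - C (f l z)) ^ (Mz z l : ℕ) := by
    filter_upwards [hZ] with z hz
    conv_lhs => rw [pol_prod, Finset.prod_multiset_map_count, hz.1, Finset.prod_image hz.2, ← Finset.prod_coe_sort]
  have hconst : ∀ᶠ z in 𝓝 z0, ∀ N : S → Fin (m + 1), N ≠ Mz z0 → Mz z ≠ N := by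
    rw [eventually_all]
    intro N
    by_cases hN : N = Mz z0
    · simp [hN]
    by_contra hcon
    apply hN
    have hfr : ∃ᶠ z in 𝓝 z0, Mz z = N := by
      intro h
      apply hcon
      filter_upwards [h] with z hz _ using hz
    have heq : pol (fun i => a i z0) = ∏ l : S, (X - C (l:ℂ)) ^ (N l : ℕ) := by
      apply Polynomial.funext
      intro w
      have h1 : Tendsto (fun z => (pol (fun i => a i z)).eval w) (𝓝 z0) (𝓝 ((pol (fun i => a i z0)).eval w)) := by
        have : ContinuousAt (fun z => (pol (fun i => a i z)).eval w) z0 := by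
          simp only [pol_eval]; fun_prop
        exact this
      have h2 : Tendsto (fun z => (∏ l : S, (X - C (f l z)) ^ (N l : ℕ) : ℂ[X]).eval w) (𝓝 z0) (𝓝 ((∏ l : S, (X - C (l:ℂ)) ^ (N l : ℕ) : ℂ[X]).eval w)) := by
        simp only [eval_prod, eval_pow, eval_sub, eval_X, eval_C]
        apply tendsto_finsetProd
        intro l _
        have := hf l l.2
        have h3 : Tendsto (f l) (𝓝 z0) (𝓝 (l:ℂ)) := by
          have h4 : Tendsto (f l) (𝓝 z0) (𝓝 (f l z0)) := this
          rwa [hf0 l l.2] at h4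
        exact (tendsto_const_nhds.sub h3).pow _
      refine tendsto_nhds_unique_of_frequently_eq h1 h2 ?_
      refine (hfr.and_eventually hprod).mono ?_
      rintro z ⟨h3, h4⟩
      rw [h4, h3]
    have hr : (pol (fun i => a i z0)).roots = ∑ l : S, (N l : ℕ) • ({(l:ℂ)} : Multiset ℂ) := by
      rw [heq, roots_prod _ _ (by
        rw [Finset.prod_ne_zero_iff]
        intro l _
        exact pow_ne_zero _ (X_sub_C_ne_zero _))]
      simp only [roots_pow, roots_X_sub_C]
      rfl
    funext l
    apply Fin.ext
    simp only [hMz]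
    rw [hf0 l l.2, hr, Multiset.count_sum']
    simp only [Multiset.count_nsmul, Multiset.count_singleton]
    rw [Finset.sum_eq_single l]
    · simp
    · intro b _ hb
      rw [if_neg (fun h => hb (Subtype.ext h.symm)), mul_zero]
    · simp
  refine ⟨fun l => Mz z0 l, ?_⟩
  filter_upwards [hconst, hprod] with z h1 h2
  have : Mz z = Mz z0 := by
    by_contra h
    exact h1 (Mz z) h rfl
  rw [h2, this]

/-- One variable version -/
theorem one_var {u : ℂ × ℂ → EReal} (hu : Psh2 u) {q0 : ℂ × ℂ} (hq : u q0 ≠ ⊥) {m : ℕ} (a : Fin m → ℂ → ℂ) {c : ℂ} {r : ℝ}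
    (ha : ∀ i, ContinuousOn (a i) (ball c r))
    (hE : ∀ z ∈ ball c r, ∀ w : ℂ, w ^ m + ∑ i : Fin m, a i z * w ^ (m - ((i : ℕ) + 1)) = 0 → u (z, w) = ⊥) :
    ∀ i, DifferentiableOn ℂ (a i) (ball c r) := by
  have haz : ∀ z ∈ ball c r, ∀ i, ContinuousAt (a i) z := fun z hz i => (ha i).continuousAt (isOpen_ball.mem_nhds hz)
  set Z : ℂ → Finset ℂ := fun z => (pol (fun i => a i z)).roots.toFinset with hZ
  have hcard : ∀ z, (Z z).card ≤ m := fun z => (Multiset.toFinset_card_le _).trans (pol_card _).le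
  by_cases hr : 0 < r
  swap
  · intro i; rw [ball_eq_empty.2 (not_lt.1 hr)]; exact differentiableOn_empty
  have hbdd : BddAbove ((fun z => (Z z).card) '' ball c r) := ⟨m, by rintro _ ⟨z, _, rfl⟩; exact hcard z⟩
  obtain ⟨z0, hz0, hk⟩ := Nat.sSup_mem (s := (fun z => (Z z).card) '' ball c r) ⟨_, c, mem_ball_self hr, rfl⟩ hbdd
  set k := sSup ((fun z => (Z z).card) '' ball c r) with hkdef
  have hmax : ∀ z ∈ ball c r, (Z z).card ≤ k := fun z hz => le_csSup hbdd ⟨z, hz, rfl⟩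
  have hloc : ∀ z ∈ ball c r, (Z z).card = k → DifferentiableAt ℂ (sig Z k) z ∧ ∀ i, DifferentiableAt ℂ (a i) z := by
    intro z hz hzk
    obtain ⟨f, ρ, hρ, hsub, hfc, him, hf0⟩ := branches isOpen_ball (Z := Z) (fun z hz => roots_A (haz z hz)) hz (by rw [hzk]; exact hmax)
    have hfd : ∀ l ∈ Z z, DifferentiableAt ℂ (f l) z := by
      intro l hl
      refine (lemH hρ (hfc l hl) ?_).differentiableAt (ball_mem_nhds z hρ)
      intro H p hH hs
      refine thmG hu hq hρ (hfc l hl) ?_ H p hH hs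
      intro x hx
      apply hE x (hsub hx)
      rw [← pol_eval, ← pol_mem]
      change f l x ∈ Z x
      rw [(him x hx).1]
      exact Finset.mem_image_of_mem _ hl
    constructor
    · rw [← hzk]; exact sig_diff hρ hfd him
    · intro i
      obtain ⟨M, hM⟩ := mult_const (haz z hz) (f := f) (S := Z z) (fun l hl => (hfd l hl).continuousAt) hf0 (by
        filter_upwards [closedBall_mem_nhds z hρ] with x hx using him x hx)
      have : a i =ᶠ[𝓝 z] fun x => (∏ l : Z z, (X - C (f l x)) ^ M l : ℂ[X]).coeff (m - ((i:ℕ) + 1)) := by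
        filter_upwards [hM] with x hx
        rw [← hx, pol_coeff]
      rw [this.differentiableAt_iff]
      apply coeff_prod_diff
      intro l _
      exact coeff_lin_diff (hfd l l.2) _
  intro i
  refine rado_removable (σ := sig Z k) ?_ ?_ hz0 (sig_ne.2 hk) (ha i) ?_
  · intro z hz
    by_cases hzk : (Z z).card = k
    · exact (hloc z hz hzk).1.continuousAt.continuousWithinAt
    · exact (sig_cont (roots_B (haz z hz)) (lt_of_le_of_ne (hmax z hz) hzk)).continuousWithinAt
  · intro z hz h
    exact (hloc z hz (sig_ne.1 h)).1
  · intro z hz h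
    exact (hloc z hz (sig_ne.1 h)).2 i

end part14

section part15
open Filter Topology
lemma slice_unif {n : ℕ} {D : Set (Fin n → ℂ)} (hD : IsOpen D) {g : (Fin n → ℂ) → ℂ} (hg : ContinuousOn g D) {z : Fin n → ℂ}
    (hz : z ∈ D) (b : Fin n → ℂ) : ∃ ρ > 0, (∀ᶠ x in 𝓝 z, ∀ t ∈ ball (0:ℂ) ρ, x + t • b ∈ D) ∧
      TendstoUniformlyOn (fun x (t : ℂ) => g (x + t • b)) (fun t => g (z + t • b)) (𝓝 z) (ball 0 ρ) := by
  obtain ⟨R, hR, hsub⟩ := nhds_basis_closedBall.mem_iff.1 (hD.mem_nhds hz)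
  set ρ := R / 2 / (‖b‖ + 1) with hρ
  have hρp : 0 < ρ := by positivity
  have hmem : ∀ x ∈ ball z (R / 2), ∀ t ∈ ball (0:ℂ) ρ, x + t • b ∈ closedBall z R := by
    intro x hx t ht
    rw [mem_ball, dist_eq_norm] at hx
    rw [mem_ball_zero_iff] at ht
    rw [mem_closedBall, dist_eq_norm]
    have h1 : ‖t • b‖ ≤ R / 2 := by
      rw [norm_smul]
      calc ‖t‖ * ‖b‖ ≤ ρ * (‖b‖ + 1) := by gcongr; linarith
        _ = R / 2 := by rw [hρ]; field_simp
    have h2 : x + t • b - z = (x - z) + t • b := by abel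
    rw [h2]
    refine (norm_add_le _ _).trans ?_
    linarith
  have hxev : ∀ᶠ x in 𝓝 z, x ∈ ball z (R / 2) := ball_mem_nhds z (by positivity)
  refine ⟨ρ, hρp, ?_, ?_⟩
  · filter_upwards [hxev] with x hx t ht using hsub (hmem x hx t ht)
  · have huc := (isCompact_closedBall z R).uniformContinuousOn_of_continuous (hg.mono hsub)
    rw [Metric.uniformContinuousOn_iff] at huc
    rw [Metric.tendstoUniformlyOn_iff]
    intro ε hε
    obtain ⟨δ, hδ, hδ'⟩ := huc ε hε
    filter_upwards [hxev, ball_mem_nhds z hδ] with x hx hxδ t ht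
    apply hδ' _ (hmem z (mem_ball_self (by positivity)) t ht) _ (hmem x hx t ht)
    rw [dist_add_right, dist_comm]
    exact hxδ

lemma osgood {n : ℕ} {D : Set (Fin n → ℂ)} (hD : IsOpen D) {g : (Fin n → ℂ) → ℂ} (hg : ContinuousOn g D)
    (hl : ∀ z ∈ D, ∀ b, DifferentiableAt ℂ (fun t : ℂ => g (z + t • b)) 0) : DifferentiableOn ℂ g D := by
  have hl2 : ∀ z b (t : ℂ), z + t • b ∈ D → DifferentiableAt ℂ (fun t : ℂ => g (z + t • b)) t := by
    intro z b t h
    have h1 := hl _ h b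
    have h2 : (fun s : ℂ => g (z + s • b)) = (fun s : ℂ => g (z + t • b + s • b)) ∘ (fun s => s - t) := by
      funext s
      simp only [Function.comp]
      congr 1
      rw [sub_smul]; abel
    rw [h2]
    apply DifferentiableAt.comp
    · rwa [sub_self]
    · fun_prop
  intro z hz
  apply DifferentiableAt.differentiableWithinAt
  set e : Fin n → (Fin n → ℂ) := fun j => Pi.single j 1 with he
  set d : Fin n → (Fin n → ℂ) → ℂ := fun j x => deriv (fun t : ℂ => g (x + t • e j)) 0 with hd
  have hdd : ∀ j x (t : ℂ), x + t • e j ∈ D → HasDerivAt (fun t : ℂ => g (x + t • e j)) (d j (x + t • e j)) t := by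
    intro j x t h
    have h1 := (hl2 x (e j) t h).hasDerivAt
    have h3 : deriv (fun t : ℂ => g (x + t • e j)) t = d j (x + t • e j) := by
      simp only [hd]
      have h2 : (fun s : ℂ => g (x + t • e j + s • e j)) = (fun s : ℂ => (fun s => g (x + s • e j)) (t + s)) := by
        funext s
        simp only
        rw [add_smul, add_assoc]
      rw [h2]
      have h4 := deriv_comp_const_add (fun s : ℂ => g (x + s • e j)) t 0
      rw [add_zero] at h4
      exact h4.symm
    rwa [h3] at h1
  have hdc : ∀ j, Tendsto (d j) (𝓝 z) (𝓝 (d j z)) := by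
    intro j
    obtain ⟨ρ, hρ, h1, h2⟩ := slice_unif hD hg hz (e j)
    have h3 := h2.tendstoLocallyUniformlyOn.deriv (by
      filter_upwards [h1] with x hx t ht
      exact (hl2 x (e j) t (hx t ht)).differentiableWithinAt) isOpen_ball
    exact h3.tendsto_at (mem_ball_self hρ)
  set L : (Fin n → ℂ) →L[ℂ] ℂ := ∑ j, (d j z) • ContinuousLinearMap.proj j with hL
  refine HasFDerivAt.differentiableAt (f' := L) ?_
  rw [hasFDerivAt_iff_isLittleO_nhds_zero, Asymptotics.isLittleO_iff]
  intro ε hε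
  have hε' : 0 < ε / (n + 1) := by positivity
  have hev : ∀ᶠ x in 𝓝 z, x ∈ D ∧ ∀ j, ‖d j x - d j z‖ ≤ ε / (n + 1) := by
    refine Filter.Eventually.and (hD.mem_nhds hz) ?_
    rw [eventually_all]
    intro j
    have := (hdc j).eventually (closedBall_mem_nhds (d j z) hε')
    filter_upwards [this] with x hx
    rwa [dist_eq_norm] at hx
  obtain ⟨R, hR, hball⟩ := Metric.eventually_nhds_iff_ball.1 hev
  filter_upwards [ball_mem_nhds (0 : Fin n → ℂ) hR] with h hh
  rw [mem_ball_zero_iff] at hh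
  classical
  have key : ∀ s : Finset (Fin n), ‖g (z + s.piecewise h 0) - g z - ∑ j ∈ s, d j z * h j‖ ≤ s.card * (ε / (n + 1) * ‖h‖) := by
    intro s
    induction s using Finset.induction_on with
    | empty => simp
    | insert j s hj ih =>
      have hpw : (insert j s).piecewise h 0 = s.piecewise h 0 + h j • e j := by
        funext i
        by_cases hij : i = j
        · subst hij
          simp [he, hj]
        · simp [he, Finset.piecewise, hij]
      have hin : ∀ t ∈ closedBall (0:ℂ) ‖h j‖, z + s.piecewise h 0 + t • e j ∈ ball z R := by
        intro t ht
        rw [mem_closedBall_zero_iff] at ht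
        rw [mem_ball, dist_eq_norm, add_assoc, add_sub_cancel_left]
        refine lt_of_le_of_lt ?_ hh
        rw [pi_norm_le_iff_of_nonneg (norm_nonneg _)]
        intro i
        by_cases hij : i = j
        · subst hij
          simp [he, hj]
          exact ht.trans (norm_le_pi_norm h i)
        · simp [he, Finset.piecewise, hij]
          split_ifs
          · exact norm_le_pi_norm h i
          · simp
      have hmv := Convex.norm_image_sub_le_of_norm_hasDerivWithin_le (𝕜 := ℂ) (s := closedBall (0:ℂ) ‖h j‖)
        (f := fun t : ℂ => g (z + s.piecewise h 0 + t • e j) - t * d j z)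
        (f' := fun t => d j (z + s.piecewise h 0 + t • e j) - 1 * d j z) (C := ε / (n + 1)) (x := 0) (y := h j)
        (fun t ht => ((hdd j _ t (hball _ (hin t ht)).1).sub ((hasDerivAt_id t).mul_const _)).hasDerivWithinAt)
        (fun t ht => by rw [one_mul]; exact (hball _ (hin t ht)).2 j) (convex_closedBall _ _) (by simp) (by simp)
      simp only [zero_smul, add_zero, zero_mul, sub_zero] at hmv
      rw [Finset.sum_insert hj, hpw, ← add_assoc, Finset.card_insert_of_notMem hj]
      have e1 : g (z + s.piecewise h 0 + h j • e j) - g z - (d j z * h j + ∑ j ∈ s, d j z * h j) = 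
        (g (z + s.piecewise h 0 + h j • e j) - h j * d j z - g (z + s.piecewise h 0)) + (g (z + s.piecewise h 0) - g z - ∑ j ∈ s, d j z * h j) := by ring
      rw [e1]
      refine (norm_add_le _ _).trans ((add_le_add hmv ih).trans ?_)
      push_cast
      have : ε / (n + 1) * ‖h j‖ ≤ ε / (n + 1) * ‖h‖ := by gcongr; exact norm_le_pi_norm h j
      linarith
  have hk := key Finset.univ
  rw [Finset.piecewise_univ, Finset.card_univ, Fintype.card_fin] at hk
  have hLh : L h = ∑ j, d j z * h j := by
    simp [hL]
  rw [hLh]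
  refine hk.trans ?_
  have : (n:ℝ) * (ε / (n + 1) * ‖h‖) = (n / (n + 1)) * (ε * ‖h‖) := by ring
  rw [this]
  have h1 : (n:ℝ) / (n + 1) ≤ 1 := by rw [div_le_one (by positivity)]; linarith
  calc _ ≤ 1 * (ε * ‖h‖) := by gcongr
    _ = _ := one_mul _

lemma snoc_lin {n : ℕ} (x b : Fin n → ℂ) (w v t : ℂ) :
    (Fin.snoc (x + t • b) (w + t * v) : Fin (n + 1) → ℂ) = Fin.snoc x w + t • (Fin.snoc b v : Fin (n + 1) → ℂ) := by
  funext i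
  refine Fin.lastCases ?_ (fun j => ?_) i <;> simp

lemma slice_psh {n : ℕ} {u : (Fin (n + 1) → ℂ) → EReal} (hu : Plurisubharmonic u) (x b : Fin n → ℂ) :
    Psh2 (fun p => u (Fin.snoc (x + p.1 • b) p.2)) := by
  refine ⟨?_, fun z => hu.2.1 _, ?_⟩
  · have : Continuous fun p : ℂ × ℂ => (Fin.snoc (x + p.1 • b) p.2 : Fin (n + 1) → ℂ) := by
      apply Continuous.finSnoc
      · fun_prop
      · fun_prop
    exact hu.1.comp this
  · intro p q
    have := hu.2.2 (Fin.snoc (x + p.1 • b) p.2) (Fin.snoc (q.1 • b) q.2)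
    convert this using 3 with t
    rw [← snoc_lin]
    congr 1
    simp [add_smul, smul_smul, add_assoc]

theorem final
    {n m : ℕ} (D : Set (Fin n → ℂ))
    (hDopen : IsOpen D)
    (a : Fin m → (Fin n → ℂ) → ℂ) (ha : ∀ i, ContinuousOn (a i) D)
    (hE : Pluripolar {p : Fin (n + 1) → ℂ | ∃ z ∈ D, ∃ w : ℂ, p = Fin.snoc z w ∧
        w ^ m + ∑ i : Fin m, a i z * w ^ (m - ((i : ℕ) + 1)) = 0}) :
    ∀ i, DifferentiableOn ℂ (a i) D := by
  obtain ⟨u, hu, hne, hbot⟩ := hE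
  push Not at hne
  obtain ⟨q, hq⟩ := hne
  have hfreq : ∀ z, ∃ᶠ x in 𝓝 z, ∃ w, u (Fin.snoc x w) ≠ ⊥ := by
    intro z hcon
    have hcon' : ∀ᶠ x in 𝓝 z, ∀ w, u (Fin.snoc x w) = ⊥ := by
      filter_upwards [hcon] with x hx w
      by_contra h
      exact hx ⟨w, h⟩
    set x0 : Fin n → ℂ := fun i => q i.castSucc
    set w0 := q (Fin.last n)
    have hq0 : (Fin.snoc x0 w0 : Fin (n + 1) → ℂ) = q := Fin.snoc_init_self q
    have hev : ∀ᶠ t in 𝓝 (0:ℂ), u ((Fin.snoc z w0 : Fin (n + 1) → ℂ) + t • (Fin.snoc (x0 - z) 0 : Fin (n + 1) → ℂ)) = ⊥ := by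
      have hc : Tendsto (fun t : ℂ => z + t • (x0 - z)) (𝓝 0) (𝓝 z) := by
        have : Continuous (fun t : ℂ => z + t • (x0 - z)) := by fun_prop
        have h := this.tendsto 0
        simpa using h
      filter_upwards [hc.eventually hcon'] with t ht
      rw [← snoc_lin]
      exact ht _
    obtain ⟨r, hr, hb⟩ := Metric.eventually_nhds_iff_ball.1 hev
    have := eq_bot_of_disc (hu.2.2 (Fin.snoc z w0) (Fin.snoc (x0 - z) 0)) (fun t => hu.2.1 _) hr hb 1
    simp only [← snoc_lin] at this
    rw [one_smul, add_sub_cancel, mul_zero, add_zero, hq0] at this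
    exact hq this
  intro i
  apply osgood hDopen (ha i)
  intro z hz b
  obtain ⟨ρ, hρ, h1, h2⟩ := slice_unif hDopen (ha i) hz b
  have h3 : TendstoLocallyUniformlyOn (fun x (t : ℂ) => a i (x + t • b)) (fun t => a i (z + t • b))
      (𝓝 z ⊓ 𝓟 {x | ∃ w, u (Fin.snoc x w) ≠ ⊥}) (ball 0 ρ) :=
    (tendstoUniformlyOn_iff_tendstoUniformlyOnFilter.2
      ((tendstoUniformlyOn_iff_tendstoUniformlyOnFilter.1 h2).mono_left inf_le_left)).tendstoLocallyUniformlyOn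
  have hNB : (𝓝 z ⊓ 𝓟 {x | ∃ w, u (Fin.snoc x w) ≠ ⊥}).NeBot := frequently_mem_iff_neBot.1 (hfreq z)
  refine (h3.differentiableOn ?_ isOpen_ball).differentiableAt (ball_mem_nhds 0 hρ)
  filter_upwards [mem_inf_of_left h1, mem_inf_of_right (mem_principal_self _)] with x hx hw
  obtain ⟨w, hw⟩ := hw
  refine one_var (slice_psh hu x b) (q0 := (0, w)) (by simpa using hw) (fun j t => a j (x + t • b)) (c := 0) (r := ρ) ?_ ?_ i
  · intro j
    refine (ha j).comp ?_ (fun t ht => hx t ht)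
    fun_prop
  · intro t ht w hw
    exact hbot _ ⟨x + t • b, hx t ht, w, rfl, hw⟩

end part15

/-- If the zero set `𝓔` of the Weierstrass pseudopolynomial with continuous coefficients
`a₁, …, a_m` on a domain `D ⊆ ℂⁿ` is pluripolar in `ℂ^{n+1}`, then `a₁, …, a_m` are
holomorphic on `D`. -/
theorem holomorphic_of_pluripolar
    {n m : ℕ} (hm : 0 < m) (D : Set (Fin n → ℂ))
    (hDopen : IsOpen D) (hDconn : IsConnected D)
    (a : Fin m → (Fin n → ℂ) → ℂ) (ha : ∀ i, ContinuousOn (a i) D)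
    (hE : Pluripolar {p : Fin (n + 1) → ℂ | ∃ z ∈ D, ∃ w : ℂ, p = Fin.snoc z w ∧
        w ^ m + ∑ i : Fin m, a i z * w ^ (m - ((i : ℕ) + 1)) = 0}) :
    ∀ i, DifferentiableOn ℂ (a i) D := by
  exact final D hDopen a ha hE
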